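/- For every positive integer m there exists Q = Q(m) with the following property. Let F_q be a finite field with q > Q elements and characteristic p, and let f_1, ..., f_r ∈ F_q[T,X] be pairwise non-associate absolutely irreducible polynomials such that for each i, writing d_i for the total degree of f_i, one has d_i ≥ 2, p does not divide d_i(d_i − 1), the projective plane curve defined by the homogenization of f_i is smooth, and ∑_{i=1}^r d_i ≤ m. Then there exists a pair (a_1, a_2) ∈ F_q × F_q such that f_i(T, a_1·T + a_2) is irreducible in F_q[T] for every i = 1, ..., r. -/

import Mathlib

open MvPolynomial

/-- The univariate polynomial `f(T, a₁·T + a₂) ∈ K[T]` obtained from `f ∈ K[T,X]`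
(variable `0` is `T`, variable `1` is `X`) by substituting `X := a₁·T + a₂`. -/
noncomputable def lineSub {K : Type*} [CommSemiring K] (f : MvPolynomial (Fin 2) K)
    (a₁ a₂ : K) : Polynomial K :=
  MvPolynomial.aeval ![Polynomial.X, Polynomial.C a₁ * Polynomial.X + Polynomial.C a₂] f

/-- `f ∈ K[T,X]` is absolutely irreducible: it is irreducible over an algebraic
closure of `K`. -/
def AbsolutelyIrreducible {K : Type*} [Field K] (f : MvPolynomial (Fin 2) K) : Prop :=
  Irreducible (MvPolynomial.map (algebraMap K (AlgebraicClosure K)) f)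

/-- `F ∈ K[X₀,X₁,X₂]` is the degree-`d` homogenization of `f ∈ K[T,X]`
(so `F` is homogeneous of degree `d` with `F(1,T,X) = f(T,X)`) and the projective
plane curve `F = 0` is smooth: `F` and its three partial derivatives have no common
zero `≠ (0,0,0)` with coordinates in an algebraic closure of `K`. -/
def IsSmoothHomogenization {K : Type*} [Field K] (F : MvPolynomial (Fin 3) K)
    (f : MvPolynomial (Fin 2) K) (d : ℕ) : Prop :=
  F.IsHomogeneous d ∧
  MvPolynomial.aeval ![1, MvPolynomial.X 0, MvPolynomial.X 1] F = f ∧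
  ∀ x : Fin 3 → AlgebraicClosure K, x ≠ 0 →
    MvPolynomial.eval x (F.map (algebraMap K (AlgebraicClosure K))) = 0 →
    ∃ j : Fin 3, MvPolynomial.eval x ((MvPolynomial.pderiv j F).map
      (algebraMap K (AlgebraicClosure K))) ≠ 0

section Place

variable {k E Γ : Type*} [Field k] [Field E] [Algebra k E] [LinearOrderedCommGroupWithZero Γ]

lemma exists_place [IsAlgClosed k] (x : E) (hx : ∀ c : k, algebraMap k E c ≠ x) :
    ∃ V : ValuationSubring E, (∀ c : k, c ≠ 0 → V.valuation (algebraMap k E c) = 1) ∧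
      1 < V.valuation x := by
  let R : Subring E := (algebraMap k E).range
  have hR : IsIntegrallyClosedIn R E := by
    rw [Subring.isIntegrallyClosedIn_iff]
    intro y hy
    obtain ⟨p, hp, hpy⟩ := hy
    have hInt : IsIntegral k y := by
      let e : k →+* R := (algebraMap k E).rangeRestrict
      have hs : Function.Surjective e := (algebraMap k E).rangeRestrict_surjective
      obtain ⟨p', hp'⟩ := Polynomial.map_surjective e hs p
      have hinj : Function.Injective e := e.injective
      refine ⟨p', ?_, ?_⟩
      · exact Polynomial.monic_of_injective hinj (hp' ▸ hp)
      · rw [← hp', Polynomial.eval₂_map] at hpy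
        exact hpy
    exact minpoly.mem_range_of_degree_eq_one k y
      (IsAlgClosed.degree_eq_one_of_irreducible k (minpoly.irreducible hInt))
  obtain ⟨V, hV, hxV⟩ := Subring.exists_le_valuationSubring_of_isIntegrallyClosedIn
    (R := R) (x := x) (fun ⟨c, hc⟩ => hx c hc)
  have h1 : ∀ c : k, V.valuation (algebraMap k E c) ≤ 1 := fun c =>
    (V.valuation_le_one_iff _).2 (hV ⟨c, rfl⟩)
  refine ⟨V, fun c hc => le_antisymm (h1 c) ?_, ?_⟩
  · have h2 := h1 c⁻¹
    rw [map_inv₀, map_inv₀] at h2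
    have h3 : 0 < V.valuation (algebraMap k E c) := by
      rw [Valuation.pos_iff]; simpa using hc
    exact (inv_le_one₀ h3).1 h2
  · rw [← not_le, V.valuation_le_one_iff]
    exact hxV

variable {v : Valuation E Γ}

lemma val_const_le (hv : ∀ c : k, c ≠ 0 → v (algebraMap k E c) = 1) (c : k) : v (algebraMap k E c) ≤ 1 := by
  by_cases h : c = 0
  · simp [h]
  · exact (hv c h).le

lemma val_aeval_le (hv : ∀ c : k, c ≠ 0 → v (algebraMap k E c) = 1) {σ : Type*} (w : σ → E) (γ : Γ) (hγ : 1 ≤ γ) (hw : ∀ i, v (w i) ≤ γ)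
    (G : MvPolynomial σ k) (e : ℕ) (hG : G.totalDegree ≤ e) : v (aeval w G) ≤ γ ^ e := by
  rw [MvPolynomial.aeval_def, MvPolynomial.eval₂_eq]
  apply Valuation.map_sum_le
  intro s hs
  rw [map_mul, map_prod]
  have h1 : ∏ i ∈ s.support, v (w i ^ s i) ≤ ∏ i ∈ s.support, γ ^ s i := by
    apply Finset.prod_le_prod' 
    intro i _
    rw [map_pow]
    exact pow_le_pow_left' (hw i) _
  rw [Finset.prod_pow_eq_pow_sum] at h1
  calc v (algebraMap k E (coeff s G)) * ∏ i ∈ s.support, v (w i ^ s i)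
      ≤ 1 * γ ^ (∑ i ∈ s.support, s i) := mul_le_mul' (val_const_le hv _) h1
    _ ≤ γ ^ e := by
        rw [one_mul]
        exact pow_le_pow_right' hγ ((MvPolynomial.le_totalDegree hs).trans hG)

lemma val_poly_le_one (hv : ∀ c : k, c ≠ 0 → v (algebraMap k E c) = 1) (s : E) (hs : v s ≤ 1) (P : Polynomial k) : v (Polynomial.aeval s P) ≤ 1 := by
  rw [Polynomial.aeval_eq_sum_range]
  apply Valuation.map_sum_le
  intro i _
  rw [Algebra.smul_def, map_mul, map_pow]
  exact mul_le_one' (val_const_le hv _) (pow_le_one' hs _)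

lemma val_poly (hv : ∀ c : k, c ≠ 0 → v (algebraMap k E c) = 1) (x : E) (hx : 1 < v x) (P : Polynomial k) (hP : P ≠ 0) :
    v (Polynomial.aeval x P) = v x ^ P.natDegree := by
  rw [Polynomial.aeval_eq_sum_range, Finset.sum_range_succ, add_comm]
  have h0 : v (P.coeff P.natDegree • x ^ P.natDegree) = v x ^ P.natDegree := by
    rw [Algebra.smul_def, map_mul, map_pow, hv _ (by simpa using hP), one_mul]
  rw [← h0]
  apply Valuation.map_add_eq_of_lt_left
  rw [h0]
  apply Valuation.map_sum_lt
  · exact pow_ne_zero _ (zero_lt_one.trans hx).ne'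
  · intro i hi
    rw [Algebra.smul_def, map_mul, map_pow]
    calc v (algebraMap k E (P.coeff i)) * v x ^ i ≤ 1 * v x ^ i :=
          mul_le_mul_left (val_const_le hv _) _
      _ = v x ^ i := one_mul _
      _ < v x ^ P.natDegree := pow_lt_pow_right₀ hx (Finset.mem_range.1 hi)

lemma natDegree_le_of_val (hv : ∀ c : k, c ≠ 0 → v (algebraMap k E c) = 1) (x : E) (hx : 1 < v x) (P : Polynomial k) (e : ℕ)
    (h : v (Polynomial.aeval x P) ≤ v x ^ e) : P.natDegree ≤ e := by
  by_cases hP : P = 0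
  · simp [hP]
  rw [val_poly hv x hx P hP] at h
  exact (pow_le_pow_iff_right₀ hx).1 h

lemma natDegree_eq_of_val (hv : ∀ c : k, c ≠ 0 → v (algebraMap k E c) = 1) (x : E) (hx : 1 < v x) (P : Polynomial k) (e : ℕ)
    (h : v (Polynomial.aeval x P) = v x ^ e) : P ≠ 0 ∧ P.natDegree = e := by
  have hP : P ≠ 0 := by
    rintro rfl
    simp at h
    exact (pow_ne_zero e (zero_lt_one.trans hx).ne') h.symm
  rw [val_poly hv x hx P hP] at h
  exact ⟨hP, (pow_right_injective₀ (zero_lt_one.trans hx) hx.ne') h⟩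

end Place

section Slice

variable {k : Type*} [Field k] {L : Type*} [CommRing L] [Algebra k L]

/-- the polynomial `f(T,x)` in `T` -/
noncomputable def slc (f : MvPolynomial (Fin 2) k) (x : L) : Polynomial L :=
  aeval ![Polynomial.X, Polynomial.C x] f

lemma eval_slc (f : MvPolynomial (Fin 2) k) (x t : L) :
    (slc f x).eval t = aeval ![t, x] f := by
  have h : ((Polynomial.aeval t : Polynomial L →ₐ[L] L).restrictScalars k).comp
      (aeval ![Polynomial.X, Polynomial.C x]) = (aeval ![t, x] : MvPolynomial (Fin 2) k →ₐ[k] L) := by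
    apply MvPolynomial.algHom_ext
    intro i
    fin_cases i <;> simp
  have := congrArg (fun g => g f) h
  simpa [slc, Polynomial.aeval_def] using this

lemma map_slc {L' : Type*} [CommRing L'] [Algebra k L'] (g : L →ₐ[k] L')
    (f : MvPolynomial (Fin 2) k) (x : L) :
    (slc f x).map (g : L →+* L') = slc f (g x) := by
  have h : (Polynomial.mapAlgHom g).comp
      (aeval ![Polynomial.X, Polynomial.C x]) =
      (aeval ![Polynomial.X, Polynomial.C (g x)] : MvPolynomial (Fin 2) k →ₐ[k] Polynomial L') := by
    apply MvPolynomial.algHom_ext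
    intro i
    fin_cases i <;> simp
  exact congrArg (fun g => g f) h

lemma derivative_slc (f : MvPolynomial (Fin 2) k) (x : L) :
    Polynomial.derivative (slc f x) = slc (pderiv 0 f) x := by
  induction f using MvPolynomial.induction_on with
  | C a => simp [slc, Polynomial.algebraMap_apply]
  | add p q hp hq => simp only [slc, map_add] at *; rw [hp, hq]
  | mul_X p i hp =>
    simp only [slc, map_mul, aeval_X, Polynomial.derivative_mul, Derivation.leibniz, map_add,
      smul_eq_mul] at *
    rw [hp]
    fin_cases i <;> simp [pderiv_X] <;> ring

lemma slc_add (f g : MvPolynomial (Fin 2) k) (x : L) : slc (f + g) x = slc f x + slc g x := by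
  simp [slc]

lemma slc_natDegree_lt (f : MvPolynomial (Fin 2) k) (d : ℕ) (hd : 0 < d) (hf : f.totalDegree ≤ d)
    (hc : coeff (Finsupp.single 0 d) f = 0) (x : L) : (slc f x).degree < d := by
  rw [slc, aeval_def, eval₂_eq]
  refine (Polynomial.degree_sum_le _ _).trans_lt ?_
  rw [Finset.sup_lt_iff (by simp)]
  intro s hs
  have h1 : s 0 + s 1 ≤ d := by
    have := (MvPolynomial.le_totalDegree hs).trans hf
    rw [Finsupp.sum_fintype _ _ (by simp)] at this
    simpa [Fin.sum_univ_two] using this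
  have h2 : s 0 < d := by
    by_contra h
    have : s = Finsupp.single 0 d := by
      ext i
      fin_cases i <;> simp <;> omega
    rw [MvPolynomial.mem_support_iff, this] at hs
    exact hs hc
  have h3 : ∏ i ∈ s.support, (![Polynomial.X, Polynomial.C x] : Fin 2 → Polynomial L) i ^ s i =
      Polynomial.X ^ s 0 * Polynomial.C x ^ s 1 := by
    rw [Finset.prod_subset (Finset.subset_univ _)]
    · simp [Fin.prod_univ_two]
    · intro i _ hi
      simp [Finsupp.notMem_support_iff.1 hi]
  rw [h3, Polynomial.algebraMap_apply, ← Polynomial.C_pow, mul_comm (Polynomial.X ^ _), ← mul_assoc, 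
    ← Polynomial.C_mul]
  refine (Polynomial.degree_C_mul_X_pow_le _ _).trans_lt ?_
  exact_mod_cast h2

lemma slc_eq_monic (f : MvPolynomial (Fin 2) k) (d : ℕ) (hd : 0 < d) (hf : f.totalDegree ≤ d)
    (hc : coeff (Finsupp.single 0 d) f = 1) (x : L) :
    ∃ g : Polynomial L, g.degree < d ∧ slc f x = Polynomial.X ^ d + g := by
  refine ⟨slc (f - monomial (Finsupp.single 0 d) 1) x, ?_, ?_⟩
  · apply slc_natDegree_lt _ _ hd
    · refine (totalDegree_sub _ _).trans (max_le hf ?_)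
      refine (totalDegree_monomial_le _ _).trans ?_
      simp
    · simp [hc]
  · conv_lhs => rw [← add_sub_cancel (monomial (Finsupp.single (0 : Fin 2) d) (1:k)) f, slc_add]
    congr 1
    simp [slc, aeval_monomial]

lemma slc_monic (f : MvPolynomial (Fin 2) k) (d : ℕ) (hd : 0 < d) (hf : f.totalDegree ≤ d)
    (hc : coeff (Finsupp.single 0 d) f = 1) (x : L) : (slc f x).Monic := by
  obtain ⟨g, hg, h⟩ := slc_eq_monic f d hd hf hc x
  rw [h]
  exact Polynomial.monic_X_pow_add hg

lemma slc_natDegree [Nontrivial L] (f : MvPolynomial (Fin 2) k) (d : ℕ) (hd : 0 < d) 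
    (hf : f.totalDegree ≤ d)
    (hc : coeff (Finsupp.single 0 d) f = 1) (x : L) : (slc f x).natDegree = d := by
  obtain ⟨g, hg, h⟩ := slc_eq_monic f d hd hf hc x
  rw [h, Polynomial.natDegree_eq_of_degree_eq_some]
  rw [Polynomial.degree_add_eq_left_of_degree_lt] <;> simp [hg]

lemma slc_natDegree_le (f : MvPolynomial (Fin 2) k) (d : ℕ) (hf : f.totalDegree ≤ d) (x : L) :
    (slc f x).natDegree ≤ d := by
  have := slc_natDegree_lt f (d+1) (by omega) (by omega) (by
    apply coeff_eq_zero_of_totalDegree_lt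
    rw [Finsupp.support_single _ (by omega)]
    simp only [Finset.sum_singleton, Finsupp.single_eq_same]
    omega) x
  rw [Polynomial.natDegree_le_iff_degree_le]
  rw [Polynomial.degree_le_iff_coeff_zero]
  rw [Polynomial.degree_lt_iff_coeff_zero] at this
  intro n hn
  exact this n (by exact_mod_cast hn)

end Slice

/-- Affine plane curve of degree `d`, monic in `T`, smooth, transversal to the line at infinity. -/
structure Crv {k : Type*} [Field k] (d : ℕ) (f : MvPolynomial (Fin 2) k) : Prop where
  two_le : 2 ≤ d
  deg : f.totalDegree ≤ d
  monic : coeff (Finsupp.single 0 d) f = 1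
  smooth : ∀ P : Fin 2 → k, eval P f = 0 → eval P (pderiv 0 f) ≠ 0 ∨ eval P (pderiv 1 f) ≠ 0
  inf : ∀ P : Fin 2 → k, P ≠ 0 → eval P (homogeneousComponent d f) = 0 →
    eval P (pderiv 0 (homogeneousComponent d f)) ≠ 0 ∨
    eval P (pderiv 1 (homogeneousComponent d f)) ≠ 0

section

variable {k : Type*} [Field k] {d : ℕ} {f : MvPolynomial (Fin 2) k}

lemma totalDegree_pderiv_le {σ : Type*} (i : σ) (G : MvPolynomial σ k) (e : ℕ)
    (he : G.totalDegree ≤ e) :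
    (pderiv i G).totalDegree ≤ e - 1 := by
  classical
  rw [totalDegree, Finset.sup_le_iff]
  intro s hs
  rw [mem_support_iff, coeff_pderiv] at hs
  have h2 : coeff (s + Finsupp.single i 1) G ≠ 0 := left_ne_zero_of_mul hs
  have h3 := (le_totalDegree (mem_support_iff.2 h2)).trans he
  rw [Finsupp.sum_add_index' (by simp) (by simp), Finsupp.sum_single_index rfl] at h3
  omega

lemma pderiv_eq_zero_of_deg {σ : Type*} (i : σ) (G : MvPolynomial σ k)
    (he : G.totalDegree ≤ 0) : pderiv i G = 0 := by
  have : G = C (coeff 0 G) := totalDegree_eq_zero_iff_eq_C.1 (by omega)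
  rw [this, pderiv_C]

lemma totalDegree_sub_top {σ : Type*} (G : MvPolynomial σ k) (e : ℕ) (he : G.totalDegree ≤ e) :
    (G - homogeneousComponent e G).totalDegree ≤ e - 1 := by
  classical
  rw [totalDegree, Finset.sup_le_iff]
  intro s hs
  rw [mem_support_iff, coeff_sub, coeff_homogeneousComponent] at hs
  split_ifs at hs with h
  · simp at hs
  · rw [sub_zero] at hs
    have := (le_totalDegree (mem_support_iff.2 hs)).trans he
    change s.degree ≤ e at this
    change s.degree ≤ e - 1
    omega

lemma aeval_homog {σ L : Type*} [CommRing L] [Algebra k L] {n : ℕ} {G : MvPolynomial σ k}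
    (hG : G.IsHomogeneous n) (c : L) (w : σ → L) :
    aeval (fun i => c * w i) G = c ^ n * aeval w G := by
  rw [aeval_def, aeval_def, eval₂_eq, eval₂_eq, Finset.mul_sum]
  refine Finset.sum_congr rfl fun s hs => ?_
  simp_rw [mul_pow]
  rw [Finset.prod_mul_distrib, Finset.prod_pow_eq_pow_sum, ← hG.degree_eq_sum_deg_support hs]
  ring


/-- Dehomogenized top form. -/
lemma top_coprime [IsAlgClosed k] (hf : Crv d f) :
    IsCoprime (slc (homogeneousComponent d f) (1 : k))
      (slc (pderiv 0 (homogeneousComponent d f)) (1 : k)) := by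
  rw [Polynomial.isCoprime_iff_aeval_ne_zero_of_isAlgClosed k k]
  intro θ
  by_contra h
  push Not at h
  obtain ⟨h1, h2⟩ := h
  rw [Polynomial.coe_aeval_eq_eval, eval_slc, aeval_eq_eval] at h1 h2
  have hE := congrArg (eval ![θ, 1])
    (homogeneousComponent_isHomogeneous d f).sum_X_mul_pderiv
  simp only [Fin.sum_univ_two, map_add, map_mul, eval_X, map_nsmul, Matrix.cons_val_zero,
    Matrix.cons_val_one] at hE
  change eval ![θ, 1] _ = 0 at h1 h2
  rw [h1, h2] at hE
  simp only [mul_zero, one_mul, zero_add, smul_zero] at hE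
  rcases hf.inf ![θ, 1] (fun h => by simpa using congrFun h 1) h1 with h | h
  · exact h h2
  · exact h hE

section
variable {E Γ : Type*} [Field E] [Algebra k E] [LinearOrderedCommGroupWithZero Γ]
  {v : Valuation E Γ}

lemma val_root_le (hv : ∀ c : k, c ≠ 0 → v (algebraMap k E c) = 1) {x t : E} (hx : 1 < v x)
    (hd : 0 < d) (hdeg : f.totalDegree ≤ d) (hm : coeff (Finsupp.single 0 d) f = 1)
    (ht : aeval ![t, x] f = 0) : v t ≤ v x := by
  by_contra hlt
  push Not at hlt
  set g := f - monomial (Finsupp.single 0 d) 1 with hg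
  have h1 : t ^ d = - aeval ![t, x] g := by
    rw [hg, map_sub, ht, aeval_monomial]
    simp
  have h2 : v (aeval ![t, x] g) < v t ^ d := by
    rw [aeval_def, eval₂_eq]
    apply Valuation.map_sum_lt
    · exact pow_ne_zero _ (zero_lt_one.trans (hx.trans hlt)).ne'
    intro s hs
    have hsf : s ≠ Finsupp.single 0 d := by
      rintro rfl
      rw [mem_support_iff, hg, coeff_sub, hm, coeff_monomial] at hs
      simp at hs
    have hs2 : coeff s f ≠ 0 := by
      rw [mem_support_iff, hg, coeff_sub, coeff_monomial, if_neg (Ne.symm hsf), sub_zero] at hs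
      exact hs
    have h1 : s 0 + s 1 ≤ d := by
      have := (MvPolynomial.le_totalDegree (mem_support_iff.2 hs2)).trans hdeg
      rw [Finsupp.sum_fintype _ _ (by simp)] at this
      simpa [Fin.sum_univ_two] using this
    have h3 : ∏ i ∈ s.support, (![t, x] : Fin 2 → E) i ^ s i = t ^ s 0 * x ^ s 1 := by
      rw [Finset.prod_subset (Finset.subset_univ _)]
      · simp [Fin.prod_univ_two]
      · intro i _ hi
        simp [Finsupp.notMem_support_iff.1 hi]
    have ht1 : 1 < v t := hx.trans hlt
    rw [h3, map_mul, map_mul, map_pow, map_pow]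
    have h4 : v t ^ s 0 * v x ^ s 1 < v t ^ d := by
      by_cases hs1 : s 1 = 0
      · rw [hs1, pow_zero, mul_one]
        apply pow_lt_pow_right₀ ht1
        rcases (show s 0 ≤ d by omega).lt_or_eq with h | h
        · exact h
        · exfalso
          apply hsf
          ext i
          fin_cases i <;> simp [h, hs1]
      · calc v t ^ s 0 * v x ^ s 1 < v t ^ s 0 * v t ^ s 1 := by
              apply mul_lt_mul_of_pos_left
              · exact pow_lt_pow_left₀ hlt zero_le hs1
              · exact pow_pos (zero_lt_one.trans ht1) _
          _ ≤ v t ^ d := by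
              rw [← pow_add]
              exact pow_le_pow_right₀ ht1.le h1
    calc _ ≤ 1 * (v t ^ s 0 * v x ^ s 1) := mul_le_mul_left (val_const_le hv _) _
      _ < _ := by rwa [one_mul]
  have h3 := congrArg v h1
  rw [map_pow, Valuation.map_neg] at h3
  exact h2.ne h3.symm

lemma val_fT [IsAlgClosed k] (hv : ∀ c : k, c ≠ 0 → v (algebraMap k E c) = 1) {x t : E}
    (hx : 1 < v x) (hf : Crv d f) (ht : aeval ![t, x] f = 0) :
    v (aeval ![t, x] (pderiv 0 f)) = v x ^ (d - 1) := by
  have hd := hf.two_le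
  have htx := val_root_le hv hx (by omega) hf.deg hf.monic ht
  have hx0 : x ≠ 0 := by rintro rfl; simp at hx
  have hvx0 : v x ≠ 0 := (zero_lt_one.trans hx).ne'
  set fd := homogeneousComponent d f with hfd
  set s := t / x with hs
  have hts : (![t, x] : Fin 2 → E) = fun i => x * (![s, 1] : Fin 2 → E) i := by
    ext i
    fin_cases i
    · simp [hs, mul_div_cancel₀ _ hx0]
    · simp
  have hvs : v s ≤ 1 := by
    rw [hs, map_div₀]
    exact div_le_one_of_le₀ htx zero_le
  have hw : ∀ i, v ((![t, x] : Fin 2 → E) i) ≤ v x := by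
    intro i
    fin_cases i
    · simpa using htx
    · simp
  set P := slc fd (1 : k) with hP
  set P' := slc (pderiv 0 fd) (1 : k) with hP'
  have key : ∀ G : MvPolynomial (Fin 2) k,
      Polynomial.aeval s (slc G (1 : k)) = aeval ![s, 1] G := by
    intro G
    have h1 := map_slc (Algebra.ofId k E) G (1 : k)
    rw [map_one] at h1
    rw [← eval_slc, ← h1, Polynomial.eval_map]
    rfl
  have e1 : aeval ![t, x] fd = x ^ d * Polynomial.aeval s P := by
    rw [key, hts, aeval_homog (homogeneousComponent_isHomogeneous d f)]
  have e2 : aeval ![t, x] (pderiv 0 fd) = x ^ (d - 1) * Polynomial.aeval s P' := by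
    rw [key, hts, aeval_homog (homogeneousComponent_isHomogeneous d f).pderiv]
  have b1 : v (aeval ![t, x] fd) ≤ v x ^ (d - 1) := by
    have : aeval ![t, x] fd = - aeval ![t, x] (f - fd) := by rw [map_sub, ht]; ring
    rw [this, Valuation.map_neg]
    exact val_aeval_le hv _ _ hx.le hw _ _ (totalDegree_sub_top f d hf.deg)
  have b2 : v (Polynomial.aeval s P) < 1 := by
    by_contra hcon
    push Not at hcon
    rw [e1, map_mul, map_pow] at b1
    have : v x ^ d ≤ v x ^ (d - 1) := by
      calc v x ^ d = v x ^ d * 1 := (mul_one _).symm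
        _ ≤ v x ^ d * v (Polynomial.aeval s P) := mul_le_mul_right hcon _
        _ ≤ _ := b1
    have := (pow_le_pow_iff_right₀ hx).1 this
    omega
  have b3 : v (Polynomial.aeval s P') = 1 := by
    refine le_antisymm (val_poly_le_one hv s hvs _) ?_
    obtain ⟨a, b, hab⟩ := top_coprime hf
    have h := congrArg (Polynomial.aeval s) hab
    rw [map_add, map_mul, map_mul, map_one] at h
    by_contra hlt
    push Not at hlt
    have h2 : v (Polynomial.aeval s a * Polynomial.aeval s P +
        Polynomial.aeval s b * Polynomial.aeval s P') < 1 := by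
      apply Valuation.map_add_lt
      · rw [map_mul]
        exact (mul_le_of_le_one_left' (val_poly_le_one hv s hvs _)).trans_lt b2
      · rw [map_mul]
        exact (mul_le_of_le_one_left' (val_poly_le_one hv s hvs _)).trans_lt hlt
    rw [h, map_one] at h2
    exact lt_irrefl _ h2
  have e3 : aeval ![t, x] (pderiv 0 f) = aeval ![t, x] (pderiv 0 fd) +
      aeval ![t, x] (pderiv 0 (f - fd)) := by
    rw [← map_add, ← map_add]; simp
  have e4 : v (aeval ![t, x] (pderiv 0 fd)) = v x ^ (d - 1) := by
    rw [e2, map_mul, map_pow, b3, mul_one]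
  rw [e3, ← e4]
  apply Valuation.map_add_eq_of_lt_left
  rw [e4]
  have := val_aeval_le hv _ _ hx.le hw (pderiv 0 (f - fd)) _
    (totalDegree_pderiv_le 0 _ _ (totalDegree_sub_top f d hf.deg))
  exact this.trans_lt (pow_lt_pow_right₀ hx (by omega))

/-- roots in a field where the slice splits -/
lemma eval_fT_prod {L : Type*} [CommRing L] [Algebra k L] {ι : Type*} [Fintype ι] [DecidableEq ι]
    {x : L} {t : ι → L}
    (h : slc f x = ∏ j, (Polynomial.X - Polynomial.C (t j))) (j : ι) :
    aeval ![t j, x] (pderiv 0 f) = ∏ l ∈ Finset.univ.erase j, (t j - t l) := by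
  rw [← eval_slc, ← derivative_slc, h, Polynomial.derivative_prod_finset, Polynomial.eval_finset_sum,
    Finset.sum_eq_single j]
  · simp [Polynomial.eval_prod]
  · intro b _ hb
    simp only [Polynomial.derivative_X_sub_C, mul_one, Polynomial.eval_prod]
    exact Finset.prod_eq_zero (Finset.mem_erase.2 ⟨hb.symm, Finset.mem_univ j⟩) (by simp)
  · simp

lemma root_of_split {L : Type*} [CommRing L] [Algebra k L] {ι : Type*} [Fintype ι]
    {x : L} {t : ι → L}
    (h : slc f x = ∏ j, (Polynomial.X - Polynomial.C (t j))) (j : ι) : aeval ![t j, x] f = 0 := by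
  rw [← eval_slc, h, Polynomial.eval_prod]
  exact Finset.prod_eq_zero (Finset.mem_univ j) (by simp)

lemma val_diff [IsAlgClosed k] (hv : ∀ c : k, c ≠ 0 → v (algebraMap k E c) = 1) {x : E}
    {t : Fin d → E} (hx : 1 < v x) (hf : Crv d f)
    (h : slc f x = ∏ j, (Polynomial.X - Polynomial.C (t j))) (j l : Fin d) (hjl : l ≠ j) :
    v (t j - t l) = v x := by
  have h1 := val_fT hv hx hf (root_of_split h j)
  have hr : ∀ i, v (t i) ≤ v x := fun i =>
    val_root_le hv hx (by have := hf.two_le; omega) hf.deg hf.monic (root_of_split h i)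
  have hle : ∀ i, v (t j - t i) ≤ v x := fun i =>
    (v.map_sub _ _).trans (max_le (hr j) (hr i))
  rw [eval_fT_prod h, map_prod] at h1
  refine le_antisymm (hle l) ?_
  by_contra hlt
  push Not at hlt
  have hpos : ∀ i ∈ Finset.univ.erase j, 0 < v (t j - t i) := by
    intro i hi
    rw [zero_lt_iff]
    intro h0
    rw [Finset.prod_eq_zero hi h0] at h1
    exact (pow_ne_zero _ (zero_lt_one.trans hx).ne') h1.symm
  have : ∏ i ∈ Finset.univ.erase j, v (t j - t i) < ∏ i ∈ Finset.univ.erase j, v x := by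
    apply Finset.prod_lt_prod hpos (fun i _ => hle i)
    exact ⟨l, Finset.mem_erase.2 ⟨hjl, Finset.mem_univ _⟩, hlt⟩
  rw [h1] at this
  simp [Finset.card_erase_of_mem] at this

end

/-- the norm of `G` along `f`, as a polynomial in `x` -/
noncomputable def nrm (f G : MvPolynomial (Fin 2) k) (d e : ℕ) : Polynomial k :=
  Polynomial.resultant (slc f (Polynomial.X : Polynomial k)) (slc G (Polynomial.X : Polynomial k)) d e

lemma nrm_spec {L : Type*} [CommRing L] [IsDomain L] [Algebra k L] (G : MvPolynomial (Fin 2) k)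
    {e : ℕ} (hG : G.totalDegree ≤ e) {x : L} {t : Fin d → L}
    (h : slc f x = ∏ j, (Polynomial.X - Polynomial.C (t j))) :
    Polynomial.aeval x (nrm f G d e) = ∏ j, aeval ![t j, x] G := by
  have h1 : ∀ G : MvPolynomial (Fin 2) k, (slc G (Polynomial.X : Polynomial k)).map
      ((Polynomial.aeval x : Polynomial k →ₐ[k] L) : Polynomial k →+* L) = slc G x := by
    intro G
    rw [map_slc, Polynomial.aeval_X]
  have h2 := Polynomial.resultant_map_map (slc f (Polynomial.X : Polynomial k))
    (slc G (Polynomial.X : Polynomial k)) d e ((Polynomial.aeval x : Polynomial k →ₐ[k] L) : Polynomial k →+* L)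
  rw [h1, h1] at h2
  change _ = Polynomial.aeval x (nrm f G d e) at h2
  rw [← h2]
  have hd : (∏ j, (Polynomial.X - Polynomial.C (t j))).natDegree = d := by
    rw [Polynomial.natDegree_prod_of_monic _ _ (fun i _ => Polynomial.monic_X_sub_C _)]
    simp
  have h3 := Polynomial.resultant_prod_left Finset.univ (fun j => Polynomial.X - Polynomial.C (t j))
    (slc G x) e (by simp) (slc_natDegree_le G e hG x)
  rw [hd, ← h] at h3
  rw [h3]
  refine Finset.prod_congr rfl fun j _ => ?_
  rw [Polynomial.natDegree_X_sub_C, Polynomial.resultant_X_sub_C_left _ _ _ (slc_natDegree_le G e hG x),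
    eval_slc]

lemma exists_split {L : Type*} [Field L] [IsAlgClosed L] [Algebra k L] (hd : 0 < d)
    (hdeg : f.totalDegree ≤ d) (hm : coeff (Finsupp.single 0 d) f = 1) (x : L) :
    ∃ t : Fin d → L, slc f x = ∏ j, (Polynomial.X - Polynomial.C (t j)) := by
  have hs := IsAlgClosed.splits (slc f x)
  have hmon := slc_monic f d hd hdeg hm x
  have h1 := hs.eq_prod_roots_of_monic hmon
  have h2 : (slc f x).roots.card = d := by
    rw [← slc_natDegree f d hd hdeg hm x]
    exact (Polynomial.splits_iff_card_roots.1 hs)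
  obtain ⟨l, hl⟩ := Quot.exists_rep (slc f x).roots
  change (l : Multiset L) = _ at hl
  rw [← hl] at h1 h2
  simp only [Multiset.coe_card] at h2
  subst h2
  refine ⟨fun j => l.get j, ?_⟩
  rw [h1]
  simp only [Multiset.map_coe, Multiset.prod_coe]
  conv_lhs => rw [← List.ofFn_get l, List.map_ofFn, List.prod_ofFn]
  rfl

lemma exists_generic (k : Type*) [Field k] [IsAlgClosed k] :
    ∃ V : ValuationSubring (AlgebraicClosure (RatFunc k)), 
      (∀ c : k, c ≠ 0 → V.valuation (algebraMap k (AlgebraicClosure (RatFunc k)) c) = 1) ∧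
      1 < V.valuation (algebraMap (RatFunc k) (AlgebraicClosure (RatFunc k)) RatFunc.X) := by
  apply exists_place
  intro c hc
  rw [IsScalarTower.algebraMap_apply k (RatFunc k)] at hc
  have := (algebraMap (RatFunc k) (AlgebraicClosure (RatFunc k))).injective hc
  rw [← RatFunc.algebraMap_X, IsScalarTower.algebraMap_apply k (Polynomial k) (RatFunc k)] at this
  have := RatFunc.algebraMap_injective k this
  exact Polynomial.X_ne_C c this.symm

lemma nrm_natDegree_le [IsAlgClosed k] (hd : 0 < d) (hdeg : f.totalDegree ≤ d) 
    (hm : coeff (Finsupp.single 0 d) f = 1) (G : MvPolynomial (Fin 2) k)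
    {e : ℕ} (hG : G.totalDegree ≤ e) : (nrm f G d e).natDegree ≤ d * e := by
  obtain ⟨V, hv, hx⟩ := exists_generic k
  obtain ⟨t, ht⟩ := exists_split hd hdeg hm
    (algebraMap (RatFunc k) (AlgebraicClosure (RatFunc k)) RatFunc.X)
  apply natDegree_le_of_val hv _ hx
  rw [nrm_spec G hG ht, map_prod, mul_comm, pow_mul]
  calc _ ≤ ∏ j : Fin d, V.valuation (algebraMap (RatFunc k) (AlgebraicClosure (RatFunc k)) RatFunc.X) ^ e := by
        apply Finset.prod_le_prod'
        intro j _
        apply val_aeval_le hv _ _ hx.le _ _ _ hG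
        intro i
        fin_cases i
        · exact val_root_le hv hx hd hdeg hm (root_of_split ht j)
        · exact le_rfl
    _ = _ := by simp

lemma nrm_fT_natDegree [IsAlgClosed k] (hf : Crv d f) : 
    nrm f (pderiv 0 f) d (d - 1) ≠ 0 ∧ (nrm f (pderiv 0 f) d (d - 1)).natDegree = d * (d - 1) := by
  obtain ⟨V, hv, hx⟩ := exists_generic k
  obtain ⟨t, ht⟩ := exists_split (by have := hf.two_le; omega) hf.deg hf.monic
    (algebraMap (RatFunc k) (AlgebraicClosure (RatFunc k)) RatFunc.X)
  apply natDegree_eq_of_val hv _ hx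
  rw [nrm_spec _ (totalDegree_pderiv_le 0 f d hf.deg) ht, map_prod, 
    Finset.prod_congr rfl (fun j _ => val_fT hv hx hf (root_of_split ht j))]
  simp [← pow_mul, mul_comm]

end

section

lemma deriv_aeval {k σ L : Type*} [Field k] [CommRing L] [Algebra k L] [Fintype σ]
    (D : Derivation k L L) (w : σ → L) (f : MvPolynomial σ k) :
    D (aeval w f) = ∑ i, aeval w (pderiv i f) * D (w i) := by
  classical
  induction f using MvPolynomial.induction_on with
  | C a => simp
  | add p q hp hq => simp only [map_add, hp, hq, add_mul, Finset.sum_add_distrib]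
  | mul_X p i hp =>
    simp only [map_mul, aeval_X, Derivation.leibniz, hp, map_add, smul_eq_mul, add_mul,
      Finset.sum_add_distrib, pderiv_X]
    congr 1
    · rw [Finset.sum_eq_single i]
      · simp
      · intro j _ hj
        simp [Pi.single_apply, hj.symm]
      · simp
    · rw [Finset.mul_sum]
      exact Finset.sum_congr rfl fun j _ => by ring

variable {k : Type*} [Field k] {d : ℕ} {f : MvPolynomial (Fin 2) k}

/-- Evaluate a bivariate polynomial, given as polynomial in `T` over `k[x]`. -/
lemma Crv.irr [IsAlgClosed k] (hf : Crv d f) : Irreducible (slc f (Polynomial.X : Polynomial k)) := by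
  have hd := hf.two_le
  have hd0 : 0 < d := by omega
  have hmon := slc_monic f d hd0 hf.deg hf.monic (Polynomial.X : Polynomial k)
  have hnd := slc_natDegree f d hd0 hf.deg hf.monic (Polynomial.X : Polynomial k)
  rw [hmon.irreducible_iff_natDegree]
  refine ⟨fun h => by rw [h] at hnd; simp at hnd; omega, ?_⟩
  intro u w hu hw huw
  by_contra hcon
  push Not at hcon
  obtain ⟨hu0, hw0⟩ := hcon
  obtain ⟨V, hv, hx⟩ := exists_generic k
  set E := AlgebraicClosure (RatFunc k)
  set x := algebraMap (RatFunc k) E RatFunc.X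
  set v := V.valuation
  obtain ⟨t, ht⟩ := exists_split hd0 hf.deg hf.monic x
  let φ : Polynomial k →ₐ[k] E := Polynomial.aeval x
  have hφ : (slc f (Polynomial.X : Polynomial k)).map (φ : Polynomial k →+* E) = slc f x := by
    rw [map_slc]; simp [φ]
  set uE := u.map (φ : Polynomial k →+* E)
  set wE := w.map (φ : Polynomial k →+* E)
  have huE : uE.Monic := hu.map _
  have hwE : wE.Monic := hw.map _
  have hE : uE * wE = slc f x := by rw [← hφ, ← huw, Polynomial.map_mul]
  have htinj : Function.Injective t := by
    intro j l hjl
    by_contra hne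
    have := val_diff hv hx hf ht j l (Ne.symm hne)
    rw [hjl, sub_self, map_zero] at this
    exact (zero_lt_one.trans hx).ne this
  have hroots : uE.roots + wE.roots = Finset.univ.val.map t := by
    rw [← Polynomial.roots_mul (by rw [hE]; exact (slc_monic f d hd0 hf.deg hf.monic x).ne_zero), hE, ht]
    exact Polynomial.roots_multiset_prod_X_sub_C (Finset.univ.val.map t) |> fun h => by
      rw [Multiset.map_map] at h; exact h
  have hnodup : (uE.roots + wE.roots).Nodup := by
    rw [hroots]; exact (Multiset.nodup_map_iff_of_injective htinj).2 Finset.univ.nodup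
  have hval : ∀ a ∈ uE.roots, ∀ b ∈ wE.roots, v (a - b) = v x := by
    intro a ha b hb
    have ha' : a ∈ uE.roots + wE.roots := Multiset.mem_add.2 (Or.inl ha)
    have hb' : b ∈ uE.roots + wE.roots := Multiset.mem_add.2 (Or.inr hb)
    rw [hroots] at ha' hb'
    obtain ⟨j, -, rfl⟩ := Multiset.mem_map.1 ha'
    obtain ⟨l, -, rfl⟩ := Multiset.mem_map.1 hb'
    apply val_diff hv hx hf ht
    rintro rfl
    exact (Multiset.disjoint_left.1 (Multiset.nodup_add.1 hnodup).2.2) ha hb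
  have hres : v (φ (u.resultant w)) = v x ^ (u.natDegree * w.natDegree) := by
    have h1 := Polynomial.resultant_map_map u w u.natDegree w.natDegree (φ : Polynomial k →+* E)
    change _ = φ _ at h1
    rw [← h1]
    have e1 : uE.natDegree = u.natDegree := hu.natDegree_map _
    have e2 : wE.natDegree = w.natDegree := hw.natDegree_map _
    have h2 := Polynomial.resultant_eq_prod_roots_sub uE wE huE hwE (IsAlgClosed.splits _)
      (IsAlgClosed.splits _)
    rw [e1, e2] at h2
    rw [h2, map_multiset_prod, Multiset.map_map]
    rw [Multiset.map_congr rfl (g := fun _ => v x) (by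
      rintro ⟨a, b⟩ hab
      rw [Multiset.mem_product] at hab
      exact hval a hab.1 b hab.2)]
    rw [Multiset.map_const', Multiset.prod_replicate, Multiset.card_product,
      ← (IsAlgClosed.splits uE).natDegree_eq_card_roots,
      ← (IsAlgClosed.splits wE).natDegree_eq_card_roots, e1, e2]
  obtain ⟨hne, hdeg⟩ := natDegree_eq_of_val hv x hx (u.resultant w) _ hres
  obtain ⟨x₀, hx₀⟩ := IsAlgClosed.exists_root (u.resultant w) (by
    rw [Polynomial.degree_eq_natDegree hne, hdeg]
    exact_mod_cast (Nat.mul_ne_zero hu0 hw0))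
  have h0 : (u.map (Polynomial.evalRingHom x₀)).resultant (w.map (Polynomial.evalRingHom x₀)) = 0 := by
    have h1 := Polynomial.resultant_map_map u w u.natDegree w.natDegree (Polynomial.evalRingHom x₀)
    rw [hu.natDegree_map, hw.natDegree_map, h1]
    exact hx₀
  rw [Polynomial.resultant_eq_zero_iff, Polynomial.isCoprime_iff_aeval_ne_zero_of_isAlgClosed k k] at h0
  have h3 := h0.2
  push Not at h3
  obtain ⟨θ, hθu, hθw⟩ := h3
  rw [Polynomial.coe_aeval_eq_eval, Polynomial.eval_map] at hθu hθw
  -- evaluate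
  set U := u.eval (Polynomial.C θ) with hU
  set W := w.eval (Polynomial.C θ) with hW
  have conv : ∀ g : Polynomial (Polynomial k), Polynomial.eval₂ (Polynomial.evalRingHom x₀) θ g =
      (g.eval (Polynomial.C θ)).eval x₀ := by
    intro g
    have := Polynomial.hom_eval₂ g (RingHom.id _) (Polynomial.evalRingHom x₀) (Polynomial.C θ)
    simp at this
    rw [← this]
  rw [conv] at hθu hθw
  have hUW : U * W = aeval ![Polynomial.C θ, Polynomial.X] f := by
    rw [← eval_slc, ← huw, Polynomial.eval_mul]
  have c1 : ∀ G : MvPolynomial (Fin 2) k, (aeval ![Polynomial.C θ, Polynomial.X] G).eval x₀ =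
      eval ![θ, x₀] G := by
    intro G
    have : ((Polynomial.aeval x₀ : Polynomial k →ₐ[k] k)).comp (aeval ![Polynomial.C θ, Polynomial.X]) =
      (aeval ![θ, x₀] : MvPolynomial (Fin 2) k →ₐ[k] k) := by
      apply MvPolynomial.algHom_ext
      intro i
      fin_cases i <;> simp
    have := congrArg (fun g => g G) this
    simpa [aeval_eq_eval] using this
  have f0 : eval ![θ, x₀] f = 0 := by
    rw [← c1, ← hUW, Polynomial.eval_mul, hθu, zero_mul]
  rcases hf.smooth _ f0 with h | h
  · apply h
    have h4 : slc (pderiv 0 f) (Polynomial.X : Polynomial k) =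
        Polynomial.derivative u * w + u * Polynomial.derivative w := by
      rw [← derivative_slc, ← huw, Polynomial.derivative_mul]
    rw [← c1, ← eval_slc, h4]
    simp only [Polynomial.eval_add, Polynomial.eval_mul]
    rw [← hU, ← hW, hθu, hθw]
    simp
  · apply h
    have h5 := deriv_aeval (Polynomial.derivative' (R := k)) ![Polynomial.C θ, Polynomial.X] f
    rw [← hUW] at h5
    simp only [Fin.sum_univ_two, Derivation.leibniz, smul_eq_mul, Polynomial.derivative'_apply] at h5
    simp at h5
    rw [← c1, ← h5]
    rw [Polynomial.eval_add, Polynomial.eval_mul, Polynomial.eval_mul, hθu, hθw]; simp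

/-- vanishing at a generic point implies divisibility -/
lemma Crv.dvd_of_generic [IsAlgClosed k] (hf : Crv d f) {L : Type*} [CommRing L] [IsDomain L]
    [Algebra k L] (x : L) (hx : Function.Injective (Polynomial.aeval x : Polynomial k →ₐ[k] L))
    (τ : L) (hτ : aeval ![τ, x] f = 0) (G : MvPolynomial (Fin 2) k) (hG : aeval ![τ, x] G = 0) :
    slc f (Polynomial.X : Polynomial k) ∣ slc G (Polynomial.X : Polynomial k) := by
  let φ : Polynomial k →ₐ[k] L := Polynomial.aeval x
  letI : Algebra (Polynomial k) L := (φ : Polynomial k →+* L).toAlgebra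
  have hinj : Function.Injective (algebraMap (Polynomial k) L) := hx
  haveI : Module.IsTorsionFree (Polynomial k) L := by
    rw [Module.isTorsionFree_iff_algebraMap_injective]
    exact hinj
  have key : ∀ G : MvPolynomial (Fin 2) k,
      Polynomial.aeval τ (slc G (Polynomial.X : Polynomial k)) = aeval ![τ, x] G := by
    intro G
    have h1 := map_slc φ G (Polynomial.X : Polynomial k)
    rw [show φ Polynomial.X = x from Polynomial.aeval_X x] at h1
    rw [← eval_slc, ← h1, Polynomial.eval_map]
    rfl
  have hd := hf.two_le
  have hmon := slc_monic f d (by omega) hf.deg hf.monic (Polynomial.X : Polynomial k)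
  have hInt : IsIntegral (Polynomial k) τ := ⟨_, hmon, by
    have := key f
    rw [hτ] at this
    exact this⟩
  have h1 : minpoly (Polynomial k) τ ∣ slc f (Polynomial.X : Polynomial k) :=
    minpoly.isIntegrallyClosed_dvd hInt (by rw [key, hτ])
  have h2 : minpoly (Polynomial k) τ ∣ slc G (Polynomial.X : Polynomial k) :=
    minpoly.isIntegrallyClosed_dvd hInt (by rw [key, hG])
  exact ((hf.irr.dvd_iff.1 h1).resolve_left (minpoly.not_isUnit _ _)).dvd.trans h2

lemma vanish_of_dvd {G : MvPolynomial (Fin 2) k} {L : Type*} [CommRing L] [Algebra k L]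
    (h : slc f (Polynomial.X : Polynomial k) ∣ slc G (Polynomial.X : Polynomial k))
    (τ x : L) (hτ : aeval ![τ, x] f = 0) : aeval ![τ, x] G = 0 := by
  obtain ⟨H, hH⟩ := h
  have h1 := congrArg (Polynomial.map ((Polynomial.aeval x : Polynomial k →ₐ[k] L) : Polynomial k →+* L)) hH
  rw [Polynomial.map_mul, map_slc, map_slc, Polynomial.aeval_X] at h1
  have h2 := congrArg (Polynomial.eval τ) h1
  rw [Polynomial.eval_mul, eval_slc, eval_slc, hτ, zero_mul] at h2
  exact h2

end

section PS

variable {k : Type*} [Field k] {d : ℕ} {f : MvPolynomial (Fin 2) k}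

/-- the point `a + s` -/
noncomputable def sx (a : k) : PowerSeries k := PowerSeries.C a + PowerSeries.X

lemma sx_inj (a : k) : Function.Injective (Polynomial.aeval (sx a) : Polynomial k →ₐ[k] PowerSeries k) := by
  rw [injective_iff_map_eq_zero]
  intro P hP
  have h1 : Polynomial.aeval (sx a) P =
      (((Polynomial.taylor a P : Polynomial k)) : PowerSeries k) := by
    have h : (Polynomial.aeval (sx a) : Polynomial k →ₐ[k] PowerSeries k) =
      (Polynomial.coeToPowerSeries.algHom k).comp (Polynomial.taylorAlgHom a) := by
      apply Polynomial.algHom_ext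
      simp [sx, Polynomial.coeToPowerSeries.algHom_apply, add_comm]
    rw [h]
    simp [Polynomial.coeToPowerSeries.algHom_apply]
  rw [h1] at hP
  have h2 : Polynomial.taylor a P = 0 := by exact_mod_cast hP
  exact (Polynomial.taylor_injective a) (by simpa using h2)

/-- constant coefficient as an algebra map -/
noncomputable def cc (k : Type*) [Field k] : PowerSeries k →ₐ[k] k :=
  { PowerSeries.constantCoeff (R := k) with commutes' := fun c => by simp }

lemma cc_apply (u : PowerSeries k) : cc k u = PowerSeries.constantCoeff u := rfl

lemma cc_sx (a : k) : cc k (sx a) = a := by simp [cc_apply, sx]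

lemma aeval_cc {σ : Type*} (w : σ → PowerSeries k) (G : MvPolynomial σ k) :
    cc k (aeval w G) = eval (fun i => cc k (w i)) G := by
  rw [← aeval_eq_eval]
  exact DFunLike.congr_fun (comp_aeval w (cc k)) G

lemma ps_hensel (hd : 0 < d) (hdeg : f.totalDegree ≤ d) (hm : coeff (Finsupp.single 0 d) f = 1)
    (a θ : k) (h0 : eval ![θ, a] f = 0) (h1 : eval ![θ, a] (pderiv 0 f) ≠ 0) :
    ∃ τ : PowerSeries k, aeval ![τ, sx a] f = 0 ∧ cc k τ = θ := by
  have hmon := slc_monic f d hd hdeg hm (sx a)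
  have hev : ∀ G : MvPolynomial (Fin 2) k,
      cc k ((slc G (sx a)).eval (PowerSeries.C θ)) = eval ![θ, a] G := by
    intro G
    rw [eval_slc, aeval_cc]
    congr 1
    congr 1
    ext i
    fin_cases i <;> simp [sx, cc_apply]
  obtain ⟨τ, h2, h3⟩ := HenselianRing.is_henselian (I := Ideal.span {(PowerSeries.X : PowerSeries k)})
    (slc f (sx a)) hmon (PowerSeries.C θ)
    (by
      rw [Ideal.mem_span_singleton, PowerSeries.X_dvd_iff]
      rw [← cc_apply, hev, h0])
    (by
      apply IsUnit.map
      rw [PowerSeries.isUnit_iff_constantCoeff, ← cc_apply, derivative_slc, hev]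
      exact isUnit_iff_ne_zero.2 h1)
  refine ⟨τ, by rw [← eval_slc]; exact h2, ?_⟩
  rw [Ideal.mem_span_singleton, PowerSeries.X_dvd_iff, ← cc_apply, map_sub, sub_eq_zero] at h3
  rw [h3, cc_apply]
  simp

lemma split_of_roots {L : Type*} [CommRing L] [IsDomain L] [Algebra k L] (hd : 0 < d) (hdeg : f.totalDegree ≤ d)
    (hm : coeff (Finsupp.single 0 d) f = 1) (x : L) (t : Fin d → L) (ht : Function.Injective t)
    (hr : ∀ j, aeval ![t j, x] f = 0) : slc f x = ∏ j, (Polynomial.X - Polynomial.C (t j)) := by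
  have hmon := slc_monic f d hd hdeg hm x
  have hdv : (∏ j, (Polynomial.X - Polynomial.C (t j))) ∣ slc f x := by
    have : (Finset.univ.val.map t) ≤ (slc f x).roots := by
      rw [Multiset.le_iff_subset ((Multiset.nodup_map_iff_of_injective ht).2 Finset.univ.nodup)]
      intro y hy
      obtain ⟨j, -, rfl⟩ := Multiset.mem_map.1 hy
      rw [Polynomial.mem_roots hmon.ne_zero, Polynomial.IsRoot, eval_slc, hr]
    have h2 := (Multiset.prod_X_sub_C_dvd_iff_le_roots hmon.ne_zero _).2 this
    rw [Multiset.map_map] at h2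
    exact h2
  refine (Polynomial.eq_of_monic_of_dvd_of_natDegree_le
    (Polynomial.monic_prod_of_monic _ _ fun j _ => Polynomial.monic_X_sub_C _) hmon hdv ?_)
  rw [slc_natDegree f d hd hdeg hm x, Polynomial.natDegree_finset_prod_X_sub_C_eq_card]
  simp

lemma ps_split [IsAlgClosed k] (hd : 0 < d) (hdeg : f.totalDegree ≤ d) (hm : coeff (Finsupp.single 0 d) f = 1)
    (a : k) (θ : Fin d → k) (hθ : Function.Injective θ)
    (h : slc f a = ∏ j, (Polynomial.X - Polynomial.C (θ j))) :
    ∃ τ : Fin d → PowerSeries k, slc f (sx a) = ∏ j, (Polynomial.X - Polynomial.C (τ j)) ∧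
      ∀ j, cc k (τ j) = θ j := by
  have h1 : ∀ j, eval ![θ j, a] (pderiv 0 f) ≠ 0 := by
    intro j
    rw [← aeval_eq_eval]
    change aeval ![θ j, a] (pderiv 0 f) ≠ 0
    rw [eval_fT_prod h, Finset.prod_ne_zero_iff]
    intro l hl
    rw [sub_ne_zero]
    exact fun e => (Finset.ne_of_mem_erase hl) (hθ e).symm
  choose τ hτ1 hτ2 using fun j => ps_hensel hd hdeg hm a (θ j)
    (by rw [← aeval_eq_eval]; exact root_of_split h j) (h1 j)
  refine ⟨τ, split_of_roots hd hdeg hm _ _ ?_ hτ1, hτ2⟩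
  intro j l hjl
  apply hθ
  rw [← hτ2, ← hτ2, hjl]

lemma eval_nrm (G : MvPolynomial (Fin 2) k) {e : ℕ} (hG : G.totalDegree ≤ e) {a : k} {θ : Fin d → k}
    (h : slc f a = ∏ j, (Polynomial.X - Polynomial.C (θ j))) :
    (nrm f G d e).eval a = ∏ j, eval ![θ j, a] G := by
  have := nrm_spec G hG h
  simpa [aeval_eq_eval] using this

/-- a base point where everything is unramified -/
lemma exists_good [IsAlgClosed k] (hf : Crv d f) : ∃ (a : k) (θ : Fin d → k), Function.Injective θ ∧
    slc f a = ∏ j, (Polynomial.X - Polynomial.C (θ j)) := by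
  have hd := hf.two_le
  obtain ⟨a, ha⟩ : ∃ a : k, (nrm f (pderiv 0 f) d (d - 1)).eval a ≠ 0 := by
    by_contra h
    push Not at h
    exact (nrm_fT_natDegree hf).1 (Polynomial.funext (by simpa using h))
  obtain ⟨θ, hθ⟩ := exists_split (by omega) hf.deg hf.monic a
  refine ⟨a, θ, ?_, hθ⟩
  intro j l hjl
  by_contra hne
  apply ha
  rw [eval_nrm _ (totalDegree_pderiv_le 0 f d hf.deg) hθ]
  apply Finset.prod_eq_zero (Finset.mem_univ j)
  have := eval_fT_prod hθ j
  rw [aeval_eq_eval] at this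
  refine Eq.trans this ?_
  exact Finset.prod_eq_zero (Finset.mem_erase.2 ⟨Ne.symm hne, Finset.mem_univ l⟩) (by simp [hjl])

lemma exists_ps [IsAlgClosed k] (hf : Crv d f) : ∃ (a : k) (τ : Fin d → PowerSeries k),
    slc f (sx a) = ∏ j, (Polynomial.X - Polynomial.C (τ j)) ∧
    ∀ j, IsUnit (aeval ![τ j, sx a] (pderiv 0 f)) := by
  have hd := hf.two_le
  obtain ⟨a, θ, hθ, h⟩ := exists_good hf
  obtain ⟨τ, h1, h2⟩ := ps_split (by omega) hf.deg hf.monic a θ hθ h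
  refine ⟨a, τ, h1, fun j => ?_⟩
  rw [eval_fT_prod h1, PowerSeries.isUnit_iff_constantCoeff, ← cc_apply, map_prod]
  simp only [map_sub, h2]
  rw [isUnit_iff_ne_zero, Finset.prod_ne_zero_iff]
  intro l hl
  rw [sub_ne_zero]
  exact fun e => (Finset.ne_of_mem_erase hl) (hθ e).symm

end PS

section LemmaH

variable {k : Type*} [Field k] {d : ℕ} {f : MvPolynomial (Fin 2) k}

/-- the flex polynomial -/
noncomputable def flx (f : MvPolynomial (Fin 2) k) : MvPolynomial (Fin 2) k :=
  pderiv 0 (pderiv 0 f) * (pderiv 1 f) ^ 2 - 2 * pderiv 1 (pderiv 0 f) * pderiv 0 f * pderiv 1 f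
    + pderiv 1 (pderiv 1 f) * (pderiv 0 f) ^ 2

lemma pderiv_comm' {σ : Type*} (i j : σ) (f : MvPolynomial σ k) :
    pderiv i (pderiv j f) = pderiv j (pderiv i f) := by
  classical
  induction f using MvPolynomial.induction_on with
  | C a => simp
  | add p q hp hq => simp [hp, hq]
  | mul_X p l hp =>
    simp only [Derivation.leibniz, map_add, smul_eq_mul, pderiv_X, hp, Pi.single_apply]
    split_ifs <;> simp <;> ring

lemma deriv_prod_ratio {L ι : Type*} [CommRing L] [Algebra k L] (D : Derivation k L L)
    (s : Finset ι) (u v : ι → L) (h : ∀ j ∈ s, u j * D (v j) = v j * D (u j)) :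
    (∏ j ∈ s, u j) * D (∏ j ∈ s, v j) = (∏ j ∈ s, v j) * D (∏ j ∈ s, u j) := by
  classical
  induction s using Finset.induction_on with
  | empty => simp
  | insert a s ha ih =>
    rw [Finset.prod_insert ha, Finset.prod_insert ha]
    simp only [Derivation.leibniz, smul_eq_mul]
    have h1 := ih fun j hj => h j (Finset.mem_insert_of_mem hj)
    have h2 := h a (Finset.mem_insert_self _ _)
    linear_combination (u a * v a) * h1 + (∏ j ∈ s, u j) * (∏ j ∈ s, v j) * h2

/-- the derivation `d/ds` -/
noncomputable abbrev ds (k : Type*) [Field k] : Derivation k (PowerSeries k) (PowerSeries k) :=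
  PowerSeries.derivative k

lemma ds_sx (a : k) : ds k (sx a) = 1 := by
  simp [sx]

lemma ds_aeval (a : k) (t : PowerSeries k) (G : MvPolynomial (Fin 2) k) :
    ds k (aeval ![t, sx a] G) = aeval ![t, sx a] (pderiv 0 G) * ds k t
      + aeval ![t, sx a] (pderiv 1 G) := by
  rw [deriv_aeval]
  simp [Fin.sum_univ_two, ds_sx]

lemma flx_spec (a : k) (t : PowerSeries k) (h : aeval ![t, sx a] f = 0) :
    aeval ![t, sx a] (pderiv 0 f) * (aeval ![t, sx a] (pderiv 0 f) * ds k (aeval ![t, sx a] (pderiv 1 f))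
      - aeval ![t, sx a] (pderiv 1 f) * ds k (aeval ![t, sx a] (pderiv 0 f))) =
      aeval ![t, sx a] (flx f) := by
  have h0 := ds_aeval a t f
  rw [h, map_zero] at h0
  rw [ds_aeval, ds_aeval, pderiv_comm' 0 1]
  simp only [flx, map_add, map_sub, map_mul, map_pow, map_ofNat]
  set u := aeval ![t, sx a] (pderiv 0 f)
  set w := aeval ![t, sx a] (pderiv 1 f)
  set A := aeval ![t, sx a] (pderiv 0 (pderiv 0 f))
  set B := aeval ![t, sx a] (pderiv 1 (pderiv 0 f))
  set C := aeval ![t, sx a] (pderiv 1 (pderiv 1 f))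
  linear_combination (w * A - B * u) * h0

lemma lemmaH [IsAlgClosed k] (hf : Crv d f) (hp : ((d * (d - 1) : ℕ) : k) ≠ 0) :
    ¬ slc f (Polynomial.X : Polynomial k) ∣ slc (flx f) (Polynomial.X : Polynomial k) := by
  classical
  intro hdvd
  have hd := hf.two_le
  obtain ⟨a, τ, hτ, hu⟩ := exists_ps hf
  set D := nrm f (pderiv 0 f) d (d - 1) with hD
  obtain ⟨hD0, hDdeg⟩ := nrm_fT_natDegree hf
  rw [← hD] at hD0 hDdeg
  -- choose c
  let bad : Finset k := D.roots.toFinset.biUnion fun x₀ => (slc f x₀).roots.toFinset.image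
    fun θ => - eval ![θ, x₀] (pderiv 1 f) / eval ![θ, x₀] (pderiv 0 f)
  obtain ⟨c, hc⟩ := Infinite.exists_notMem_finset bad
  set g := pderiv 1 f + C c * pderiv 0 f with hg
  have hgdeg : g.totalDegree ≤ d - 1 := by
    refine (totalDegree_add _ _).trans (max_le (totalDegree_pderiv_le 1 f d hf.deg) ?_)
    refine (totalDegree_mul _ _).trans ?_
    simpa using totalDegree_pderiv_le 0 f d hf.deg
  set N := nrm f g d (d - 1) with hN
  have hcop : IsCoprime D N := by
    rw [Polynomial.isCoprime_iff_aeval_ne_zero_of_isAlgClosed k k]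
    intro x₀
    by_contra hcon
    push Not at hcon
    simp only [Polynomial.coe_aeval_eq_eval] at hcon
    obtain ⟨θ, hθ⟩ := exists_split (by omega) hf.deg hf.monic x₀
    have h2 := hcon.2
    rw [hN, eval_nrm g hgdeg hθ, Finset.prod_eq_zero_iff] at h2
    obtain ⟨j, -, hj⟩ := h2
    simp only [hg, map_add, map_mul, eval_C] at hj
    have hfj : eval ![θ j, x₀] f = 0 := by rw [← aeval_eq_eval]; exact root_of_split hθ j
    by_cases h0 : eval ![θ j, x₀] (pderiv 0 f) = 0
    · rw [h0, mul_zero, add_zero] at hj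
      rcases hf.smooth _ hfj with h | h
      · exact h h0
      · exact h hj
    · apply hc
      simp only [bad, Finset.mem_biUnion, Finset.mem_image, Multiset.mem_toFinset]
      refine ⟨x₀, (Polynomial.mem_roots hD0).2 hcon.1, θ j, ?_, ?_⟩
      · rw [Polynomial.mem_roots (slc_monic f d (by omega) hf.deg hf.monic x₀).ne_zero,
          Polynomial.IsRoot, eval_slc]
        exact root_of_split hθ j
      · field_simp
        linear_combination -hj
  have hDx := nrm_spec (pderiv 0 f) (totalDegree_pderiv_le 0 f d hf.deg) hτ
  have hNx := nrm_spec g hgdeg hτ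
  rw [← hD] at hDx
  rw [← hN] at hNx
  have hder : ∀ P : Polynomial k, ds k (Polynomial.aeval (sx a) P) =
      Polynomial.aeval (sx a) (Polynomial.derivative P) := by
    intro P
    rw [Derivation.map_aeval, ds_sx]
    simp
  have key : D * Polynomial.derivative N = N * Polynomial.derivative D := by
    apply sx_inj a
    rw [map_mul, map_mul, ← hder, ← hder, hDx, hNx]
    apply deriv_prod_ratio
    intro j _
    have h1 := flx_spec a (τ j) (root_of_split hτ j)
    rw [vanish_of_dvd hdvd _ _ (root_of_split hτ j)] at h1
    have h2 := ((hu j).mul_right_eq_zero).1 h1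
    have e : aeval ![τ j, sx a] g = aeval ![τ j, sx a] (pderiv 1 f) +
      algebraMap k (PowerSeries k) c * aeval ![τ j, sx a] (pderiv 0 f) := by
      rw [hg, map_add, map_mul, aeval_C]
    rw [e]
    simp only [map_add, Derivation.leibniz, Derivation.map_algebraMap, smul_eq_mul]
    linear_combination h2
  have hdv : D ∣ Polynomial.derivative D :=
    hcop.dvd_of_dvd_mul_left ⟨_, key.symm⟩
  have hpos : 0 < D.natDegree := by
    rw [hDdeg]; exact Nat.mul_pos (by omega) (by omega)
  have hz : Polynomial.derivative D = 0 := by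
    by_contra hne
    have := Polynomial.natDegree_le_of_dvd hdv hne
    have h3 := Polynomial.natDegree_derivative_lt (p := D) (by omega)
    omega
  have h4 := Polynomial.coeff_derivative D (D.natDegree - 1)
  rw [hz, Nat.sub_add_cancel hpos, Polynomial.coeff_zero] at h4
  have h5 : ((D.natDegree - 1 : ℕ) : k) + 1 = (D.natDegree : k) := by
    exact_mod_cast congrArg (Nat.cast (R := k)) (Nat.sub_add_cancel hpos)
  rw [h5, hDdeg] at h4
  rcases mul_eq_zero.1 h4.symm with h | h
  · rw [← hDdeg, Polynomial.coeff_natDegree, Polynomial.leadingCoeff_eq_zero] at h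
    exact hD0 h
  · exact hp h

/-- f_X does not vanish on the curve -/
lemma fX_ndvd [IsAlgClosed k] (hf : Crv d f) (hp : ((d * (d - 1) : ℕ) : k) ≠ 0) :
    ¬ slc f (Polynomial.X : Polynomial k) ∣ slc (pderiv 1 f) (Polynomial.X : Polynomial k) := by
  intro hdvd
  have hd := hf.two_le
  obtain ⟨a, τ, hτ, hu⟩ := exists_ps hf
  apply lemmaH hf hp
  have hr := root_of_split hτ ⟨0, by omega⟩
  apply hf.dvd_of_generic _ (sx_inj a) (τ ⟨0, by omega⟩) hr
  rw [← flx_spec _ _ hr, vanish_of_dvd hdvd _ _ hr]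
  simp

lemma nrm_ne_zero [IsAlgClosed k] (hf : Crv d f) {G : MvPolynomial (Fin 2) k} {e : ℕ}
    (he : G.totalDegree ≤ e)
    (hG : ¬ slc f (Polynomial.X : Polynomial k) ∣ slc G (Polynomial.X : Polynomial k)) :
    nrm f G d e ≠ 0 := by
  intro h
  obtain ⟨a, τ, hτ, hu⟩ := exists_ps hf
  have := nrm_spec G he hτ
  rw [h, map_zero, eq_comm, Finset.prod_eq_zero_iff] at this
  obtain ⟨j, -, hj⟩ := this
  exact hG (hf.dvd_of_generic _ (sx_inj a) _ (root_of_split hτ j) _ hj)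

/-- a power series point where both partial derivatives are units -/
lemma exists_ps_pt [IsAlgClosed k] (hf : Crv d f) (hp : ((d * (d - 1) : ℕ) : k) ≠ 0) :
    ∃ (a : k) (t : PowerSeries k), aeval ![t, sx a] f = 0 ∧
      IsUnit (aeval ![t, sx a] (pderiv 0 f)) ∧ IsUnit (aeval ![t, sx a] (pderiv 1 f)) := by
  have hd := hf.two_le
  have hT : ¬ slc f (Polynomial.X : Polynomial k) ∣ slc (pderiv 0 f) (Polynomial.X : Polynomial k) := by
    intro h
    obtain ⟨a, τ, hτ, hu⟩ := exists_ps hf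
    have := hu ⟨0, by omega⟩
    rw [vanish_of_dvd h _ _ (root_of_split hτ _)] at this
    exact not_isUnit_zero this
  have h0 := mul_ne_zero (nrm_ne_zero hf (totalDegree_pderiv_le 0 f d hf.deg) hT)
    (nrm_ne_zero hf (totalDegree_pderiv_le 1 f d hf.deg) (fX_ndvd hf hp))
  obtain ⟨a, ha⟩ : ∃ a : k, (nrm f (pderiv 0 f) d (d - 1) * nrm f (pderiv 1 f) d (d-1)).eval a ≠ 0 := by
    by_contra h
    push Not at h
    exact h0 (Polynomial.funext (by simpa using h))
  rw [Polynomial.eval_mul] at ha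
  obtain ⟨θ, hθ⟩ := exists_split (by omega) hf.deg hf.monic a
  rw [eval_nrm _ (totalDegree_pderiv_le 0 f d hf.deg) hθ,
    eval_nrm _ (totalDegree_pderiv_le 1 f d hf.deg) hθ] at ha
  have h1 := Finset.prod_ne_zero_iff.1 (left_ne_zero_of_mul ha) ⟨0, by omega⟩ (Finset.mem_univ _)
  have h2 := Finset.prod_ne_zero_iff.1 (right_ne_zero_of_mul ha) ⟨0, by omega⟩ (Finset.mem_univ _)
  obtain ⟨t, ht, hc⟩ := ps_hensel (by omega) hf.deg hf.monic a (θ ⟨0, by omega⟩)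
    (by rw [← aeval_eq_eval]; exact root_of_split hθ _) h1
  have hev : ∀ G : MvPolynomial (Fin 2) k,
      cc k (aeval ![t, sx a] G) = eval ![θ ⟨0, by omega⟩, a] G := by
    intro G
    rw [aeval_cc]
    congr 1
    congr 1
    ext i
    fin_cases i
    · exact hc
    · exact cc_sx a
  refine ⟨a, t, ht, ?_, ?_⟩ <;>
    rw [PowerSeries.isUnit_iff_constantCoeff, ← cc_apply, hev, isUnit_iff_ne_zero]
  · exact h1
  · exact h2

end LemmaH

section Dual

variable {k : Type*} [Field k] {d : ℕ} {f : MvPolynomial (Fin 2) k}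

/-- restriction of `f` to the line `X = α T + ξ` -/
noncomputable def lnp {L : Type*} [CommRing L] [Algebra k L] (f : MvPolynomial (Fin 2) k) (α ξ : L) :
    Polynomial L := aeval ![Polynomial.X, Polynomial.C α * Polynomial.X + Polynomial.C ξ] f

lemma map_lnp {L L' : Type*} [CommRing L] [Algebra k L] [CommRing L'] [Algebra k L'] (g : L →ₐ[k] L')
    (f : MvPolynomial (Fin 2) k) (α ξ : L) :
    (lnp f α ξ).map (g : L →+* L') = lnp f (g α) (g ξ) := by
  have h : (Polynomial.mapAlgHom g).comp
      (aeval ![Polynomial.X, Polynomial.C α * Polynomial.X + Polynomial.C ξ]) =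
      (aeval ![Polynomial.X, Polynomial.C (g α) * Polynomial.X + Polynomial.C (g ξ)] :
        MvPolynomial (Fin 2) k →ₐ[k] Polynomial L') := by
    apply MvPolynomial.algHom_ext
    intro i
    fin_cases i <;> simp
  exact congrArg (fun g => g f) h

lemma eval_lnp {L : Type*} [CommRing L] [Algebra k L] (f : MvPolynomial (Fin 2) k) (α ξ t : L) :
    (lnp f α ξ).eval t = aeval ![t, α * t + ξ] f := by
  have h : ((Polynomial.aeval t : Polynomial L →ₐ[L] L).restrictScalars k).comp
      (aeval ![Polynomial.X, Polynomial.C α * Polynomial.X + Polynomial.C ξ]) =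
      (aeval ![t, α * t + ξ] : MvPolynomial (Fin 2) k →ₐ[k] L) := by
    apply MvPolynomial.algHom_ext
    intro i
    fin_cases i <;> simp
  have := congrArg (fun g => g f) h
  simpa [lnp, Polynomial.aeval_def] using this

lemma derivative_lnp {L : Type*} [CommRing L] [Algebra k L] (f : MvPolynomial (Fin 2) k) (α ξ : L) :
    Polynomial.derivative (lnp f α ξ) = lnp (pderiv 0 f) α ξ + Polynomial.C α * lnp (pderiv 1 f) α ξ := by
  have := deriv_aeval ((Polynomial.derivative' (R := L)).restrictScalars k)
    ![Polynomial.X, Polynomial.C α * Polynomial.X + Polynomial.C ξ] f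
  simp [Fin.sum_univ_two] at this
  rw [lnp, this, lnp, lnp]
  ring

lemma lnp_natDegree_le {L : Type*} [CommRing L] [Algebra k L] (f : MvPolynomial (Fin 2) k) (e : ℕ)
    (hf : f.totalDegree ≤ e) (α ξ : L) : (lnp f α ξ).natDegree ≤ e := by
  rw [lnp, aeval_def, eval₂_eq]
  apply Polynomial.natDegree_sum_le_of_forall_le
  intro s hs
  have h1 := (MvPolynomial.le_totalDegree hs).trans hf
  refine (Polynomial.natDegree_mul_le).trans ?_
  rw [Polynomial.algebraMap_apply, Polynomial.natDegree_C, zero_add]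
  refine (Polynomial.natDegree_prod_le _ _).trans (le_trans (Finset.sum_le_sum ?_) h1)
  intro i _
  refine Polynomial.natDegree_pow_le.trans ?_
  have : (![Polynomial.X, Polynomial.C α * Polynomial.X + Polynomial.C ξ] i : Polynomial L).natDegree ≤ 1 := by
    fin_cases i
    · exact Polynomial.natDegree_X_le
    · exact Polynomial.natDegree_linear_le
  nlinarith

/-- coefficientwise degree bound -/
def CB {σ : Type*} (e : ℕ) (P : Polynomial (MvPolynomial σ k)) : Prop := ∀ n, (P.coeff n).totalDegree ≤ e

lemma CB.mul {σ : Type*} {e e' : ℕ} {P Q : Polynomial (MvPolynomial σ k)} (hP : CB e P) (hQ : CB e' Q) :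
    CB (e + e') (P * Q) := by
  intro n
  rw [Polynomial.coeff_mul]
  apply totalDegree_finsetSum_le
  intro x _
  exact (totalDegree_mul _ _).trans (add_le_add (hP _) (hQ _))

lemma CB.pow {σ : Type*} {e : ℕ} {P : Polynomial (MvPolynomial σ k)} (hP : CB e P) (n : ℕ) :
    CB (n * e) (P ^ n) := by
  induction n with
  | zero =>
    intro n
    rw [pow_zero, Polynomial.coeff_one]
    split_ifs <;> simp
  | succ n ih =>
    rw [pow_succ, add_mul, one_mul]
    exact ih.mul hP

lemma CB.prod {σ ι : Type*} {e : ι → ℕ} {P : ι → Polynomial (MvPolynomial σ k)} (s : Finset ι)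
    (h : ∀ i, CB (e i) (P i)) : CB (∑ i ∈ s, e i) (∏ i ∈ s, P i) := by
  classical
  induction s using Finset.induction_on with
  | empty =>
    intro n
    rw [Finset.prod_empty, Polynomial.coeff_one]
    split_ifs <;> simp
  | insert a s ha ih =>
    rw [Finset.prod_insert ha, Finset.sum_insert ha]
    exact (h a).mul ih

lemma lnp_CB (f : MvPolynomial (Fin 2) k) (e : ℕ) (hf : f.totalDegree ≤ e) :
    CB e (lnp f (X 0 : MvPolynomial (Fin 2) k) (X 1)) := by
  rw [lnp, aeval_def, eval₂_eq]
  intro n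
  rw [Polynomial.finset_sum_coeff]
  apply totalDegree_finsetSum_le
  intro s hs
  have h1 := (MvPolynomial.le_totalDegree hs).trans hf
  rw [Polynomial.algebraMap_apply, Polynomial.coeff_C_mul]
  refine (totalDegree_mul _ _).trans ?_
  rw [MvPolynomial.algebraMap_eq, totalDegree_C, zero_add]
  refine le_trans ?_ h1
  refine CB.prod (e := fun i => s i) s.support (fun i => ?_) n
  have : CB 1 (![Polynomial.X, Polynomial.C (X 0) * Polynomial.X + Polynomial.C (X 1)] i :
      Polynomial (MvPolynomial (Fin 2) k)) := by
    intro n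
    fin_cases i
    · simp only [Fin.zero_eta, Matrix.cons_val_zero, Polynomial.coeff_X]
      split_ifs <;> simp
    · simp only [Fin.mk_one, Matrix.cons_val_one, Matrix.cons_val_zero, Polynomial.coeff_add,
        Polynomial.coeff_C_mul, Polynomial.coeff_X, Polynomial.coeff_C]
      refine (totalDegree_add _ _).trans (max_le ?_ ?_) <;> split_ifs <;> simp
  simpa using this.pow (s i)

/-- the discriminant of the restriction to a general line -/
noncomputable def dsc (f : MvPolynomial (Fin 2) k) (d : ℕ) : MvPolynomial (Fin 2) k :=
  Polynomial.resultant (lnp f (X 0 : MvPolynomial (Fin 2) k) (X 1))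
    (Polynomial.derivative (lnp f (X 0 : MvPolynomial (Fin 2) k) (X 1))) d (d - 1)

lemma dsc_deg (hf : f.totalDegree ≤ d) : (dsc f d).totalDegree ≤ (d + (d - 1)) * d := by
  rw [dsc, Polynomial.resultant, Matrix.det_apply]
  apply totalDegree_finsetSum_le
  intro σ _
  have hsm : ∀ (u : ℤˣ) (P : MvPolynomial (Fin 2) k), (u • P).totalDegree ≤ P.totalDegree := by
    intro u P
    rcases Int.units_eq_one_or u with rfl | rfl <;> simp
  refine (hsm _ _).trans ?_
  refine (totalDegree_finsetProd _ _).trans ?_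
  refine (Finset.sum_le_card_nsmul _ _ d ?_).trans (by simp)
  intro i _
  have hc := lnp_CB f d hf
  rw [Polynomial.sylvester, Matrix.of_apply]
  induction i using Fin.addCases with
  | left j =>
    rw [Fin.addCases_left]
    split_ifs
    · rw [Polynomial.coeff_derivative]
      refine (totalDegree_mul _ _).trans ?_
      refine (add_le_add (hc _) (le_of_eq ?_)).trans (add_zero d).le
      have := totalDegree_C (σ := Fin 2) ((((σ (Fin.castAdd (d-1) j) : Fin _) : ℕ) - (j:ℕ) : ℕ) + 1 : k)
      simpa using this
    · simp
  | right j =>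
    rw [Fin.addCases_right]
    split_ifs
    · exact hc _
    · simp

lemma dsc_ne_zero [IsAlgClosed k] (hf : Crv d f) : dsc f d ≠ 0 := by
  intro h
  apply (nrm_fT_natDegree hf).1
  let φ : MvPolynomial (Fin 2) k →ₐ[k] Polynomial k := aeval ![0, Polynomial.X]
  have h1 := Polynomial.resultant_map_map (lnp f (X 0 : MvPolynomial (Fin 2) k) (X 1))
    (Polynomial.derivative (lnp f (X 0 : MvPolynomial (Fin 2) k) (X 1))) d (d - 1)
    (φ : MvPolynomial (Fin 2) k →+* Polynomial k)
  change _ = φ (dsc f d) at h1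
  rw [h, map_zero, ← Polynomial.derivative_map, map_lnp] at h1
  have h2 : lnp f (φ (X 0)) (φ (X 1)) = slc f (Polynomial.X : Polynomial k) := by
    simp [lnp, slc, φ]
  rw [h2, derivative_slc] at h1
  exact h1

lemma dsc_vanish {L : Type*} [CommRing L] [Algebra k L] (hd : 2 ≤ d) (hf : f.totalDegree ≤ d) (t x α : L)
    (h0 : aeval ![t, x] f = 0) (h1 : aeval ![t, x] (pderiv 0 f) + α * aeval ![t, x] (pderiv 1 f) = 0) :
    aeval ![α, x - α * t] (dsc f d) = 0 := by
  have hn := lnp_natDegree_le f d hf (X 0 : MvPolynomial (Fin 2) k) (X 1)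
  obtain ⟨p, q, -, -, e⟩ := Polynomial.exists_mul_add_mul_eq_C_resultant
    (lnp f (X 0 : MvPolynomial (Fin 2) k) (X 1))
    (Polynomial.derivative (lnp f (X 0 : MvPolynomial (Fin 2) k) (X 1))) (m := d) (n := d - 1) hn
    ((Polynomial.natDegree_derivative_le _).trans (by omega)) (by omega)
  let φ : MvPolynomial (Fin 2) k →ₐ[k] L := aeval ![α, x - α * t]
  have e2 := congrArg (Polynomial.eval t) (congrArg (Polynomial.map (φ : MvPolynomial (Fin 2) k →+* L)) e)
  rw [Polynomial.map_add, Polynomial.map_mul, Polynomial.map_mul, ← Polynomial.derivative_map,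
    map_lnp, Polynomial.map_C, Polynomial.eval_C, Polynomial.eval_add, Polynomial.eval_mul, 
    Polynomial.eval_mul, derivative_lnp, Polynomial.eval_add, Polynomial.eval_mul, Polynomial.eval_C,
    eval_lnp, eval_lnp, eval_lnp] at e2
  have h3 : φ (X 0) * t + φ (X 1) = x := by simp [φ]
  have h4 : φ (X 0) = α := by simp [φ]
  rw [h3, h4, h0, h1] at e2
  simp only [zero_mul, add_zero] at e2
  exact e2.symm

/-- clearing denominators -/
noncomputable def hat (f : MvPolynomial (Fin 2) k) (e : ℕ) (G : MvPolynomial (Fin 2) k) :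
    MvPolynomial (Fin 2) k :=
  ∑ s ∈ G.support, C (coeff s G) * ((- pderiv 0 f) ^ (s 0) *
    (X 1 * pderiv 1 f + X 0 * pderiv 0 f) ^ (s 1) * (pderiv 1 f) ^ (e - s 0 - s 1))

lemma supp_le {G : MvPolynomial (Fin 2) k} {e : ℕ} (hG : G.totalDegree ≤ e) {s : Fin 2 →₀ ℕ}
    (hs : s ∈ G.support) : s 0 + s 1 ≤ e := by
  have := (MvPolynomial.le_totalDegree hs).trans hG
  rw [Finsupp.sum_fintype _ _ (by simp)] at this
  simpa [Fin.sum_univ_two] using this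

lemma hat_deg (hd : 1 ≤ d) (hf : f.totalDegree ≤ d) {G : MvPolynomial (Fin 2) k} {e : ℕ} (hG : G.totalDegree ≤ e) :
    (hat f e G).totalDegree ≤ e * d := by
  apply totalDegree_finsetSum_le
  intro s hs
  have h1 := supp_le hG hs
  have a0 := totalDegree_pderiv_le 0 f d hf
  have a1 := totalDegree_pderiv_le 1 f d hf
  refine (totalDegree_mul _ _).trans ?_
  rw [totalDegree_C, zero_add]
  have b0 : (- pderiv 0 f).totalDegree ≤ d := by rw [totalDegree_neg]; omega
  have b1 : (X 1 * pderiv 1 f + X 0 * pderiv 0 f).totalDegree ≤ d := by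
    refine (totalDegree_add _ _).trans (max_le ?_ ?_) <;>
    · refine (totalDegree_mul _ _).trans ?_
      rw [totalDegree_X]
      omega
  have c0 := (totalDegree_pow (- pderiv 0 f) (s 0)).trans (Nat.mul_le_mul_left _ b0)
  have c1 := (totalDegree_pow (X 1 * pderiv 1 f + X 0 * pderiv 0 f) (s 1)).trans (Nat.mul_le_mul_left _ b1)
  have c2 := (totalDegree_pow (pderiv 1 f) (e - s 0 - s 1)).trans (Nat.mul_le_mul_left _ (a1.trans (Nat.sub_le d 1)))
  refine (totalDegree_mul _ _).trans ?_
  refine (add_le_add ((totalDegree_mul _ _).trans (add_le_add c0 c1)) c2).trans ?_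
  rw [← add_mul, ← add_mul]
  exact Nat.mul_le_mul_right _ (by omega)

lemma hat_spec {L : Type*} [CommRing L] [Algebra k L] {G : MvPolynomial (Fin 2) k} {e : ℕ}
    (hG : G.totalDegree ≤ e) (t x α : L)
    (h1 : aeval ![t, x] (pderiv 0 f) + α * aeval ![t, x] (pderiv 1 f) = 0) :
    aeval ![t, x] (hat f e G) = (aeval ![t, x] (pderiv 1 f)) ^ e * aeval ![α, x - α * t] G := by
  rw [hat, map_sum, aeval_def ![α, x - α * t], eval₂_eq', Finset.mul_sum]
  refine Finset.sum_congr rfl fun s hs => ?_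
  have h2 := supp_le hG hs
  simp only [map_mul, map_pow, map_neg, map_add, aeval_C, aeval_X, Fin.prod_univ_two,
    Matrix.cons_val_zero, Matrix.cons_val_one]
  set u := aeval ![t, x] (pderiv 0 f)
  set w := aeval ![t, x] (pderiv 1 f)
  have h3 : -u = α * w := by linear_combination -h1
  have h4 : x * w + t * u = (x - α * t) * w := by linear_combination t * h1
  rw [h3, h4, mul_pow, mul_pow]
  have h5 : w ^ e = w ^ (s 0) * w ^ (s 1) * w ^ (e - s 0 - s 1) := by
    rw [← pow_add, ← pow_add]; congr 1; omega
  rw [h5]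
  ring

end Dual

section Dual2

variable {k : Type*} [Field k] {d : ℕ} {f : MvPolynomial (Fin 2) k}

lemma gen_pt [IsAlgClosed k] (hf : Crv d f) (hp : ((d * (d - 1) : ℕ) : k) ≠ 0) :
    ∃ (a : k) (t α : PowerSeries k), aeval ![t, sx a] f = 0 ∧
      aeval ![t, sx a] (pderiv 0 f) + α * aeval ![t, sx a] (pderiv 1 f) = 0 ∧
      aeval ![t, sx a] (pderiv 1 f) ≠ 0 ∧
      ds k α ≠ 0 ∧ ds k (sx a - α * t) = - (t * ds k α) := by
  obtain ⟨a, t, h0, hu, hw⟩ := exists_ps_pt hf hp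
  obtain ⟨w', hw'⟩ := hw.exists_right_inv
  have hfl : aeval ![t, sx a] (flx f) ≠ 0 := fun h =>
    lemmaH hf hp (hf.dvd_of_generic _ (sx_inj a) t h0 _ h)
  rw [← flx_spec a t h0] at hfl
  have hd0 := ds_aeval a t f
  rw [h0, map_zero] at hd0
  set u := aeval ![t, sx a] (pderiv 0 f)
  set w := aeval ![t, sx a] (pderiv 1 f)
  have e1 : u + (-(u * w')) * w = 0 := by linear_combination (-u) * hw'
  refine ⟨a, t, - (u * w'), h0, e1, hw.ne_zero, ?_, ?_⟩
  · intro h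
    apply hfl
    have e2 := congrArg (ds k) e1
    rw [map_add, Derivation.leibniz, h, map_zero] at e2
    simp only [smul_eq_mul] at e2
    linear_combination (-u * w) * e2 + u * ds k w * e1
  · have e3 : -(u * w') * ds k t = 1 := by linear_combination w' * hd0 + hw'
    rw [map_sub, ds_sx, Derivation.leibniz]
    simp only [smul_eq_mul]
    linear_combination -e3

lemma dual_rel [IsAlgClosed k] (hf : Crv d f) (hp : ((d * (d - 1) : ℕ) : k) ≠ 0)
    {g : MvPolynomial (Fin 2) k} {e : ℕ} (hg : g.totalDegree ≤ e)
    (h : slc f (Polynomial.X : Polynomial k) ∣ slc (hat f e g) (Polynomial.X : Polynomial k)) :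
    slc f (Polynomial.X : Polynomial k) ∣
      slc (hat f e (pderiv 0 g) - X 0 * hat f e (pderiv 1 g)) (Polynomial.X : Polynomial k) := by
  obtain ⟨a, t, α, h0, h1, hw, hα, hξ⟩ := gen_pt hf hp
  apply hf.dvd_of_generic _ (sx_inj a) t h0
  have g0 := (totalDegree_pderiv_le 0 g e hg).trans (Nat.sub_le e 1)
  have g1 := (totalDegree_pderiv_le 1 g e hg).trans (Nat.sub_le e 1)
  have h2 := vanish_of_dvd h _ _ h0
  rw [hat_spec hg _ _ α h1] at h2
  have h3 := (mul_eq_zero.1 h2).resolve_left (pow_ne_zero _ hw)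
  have h4 := congrArg (ds k) h3
  rw [deriv_aeval, map_zero, Fin.sum_univ_two] at h4
  simp only [Matrix.cons_val_zero, Matrix.cons_val_one, hξ] at h4
  rw [map_sub, map_mul, aeval_X, hat_spec g0 _ _ α h1, hat_spec g1 _ _ α h1]
  simp only [Matrix.cons_val_zero]
  set A := aeval ![α, sx a - α * t] (pderiv 0 g)
  set B := aeval ![α, sx a - α * t] (pderiv 1 g)
  have h5 : (A - t * B) * ds k α = 0 := by linear_combination h4
  have h6 := (mul_eq_zero.1 h5).resolve_right hα
  linear_combination (aeval ![t, sx a] (pderiv 1 f)) ^ e * h6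

lemma totalDegree_pow_eq {σ : Type*} (r : MvPolynomial σ k) (hr : r ≠ 0) (n : ℕ) :
    (r ^ n).totalDegree = n * r.totalDegree := by
  induction n with
  | zero => simp
  | succ n ih =>
    rw [pow_succ, totalDegree_mul_of_isDomain (pow_ne_zero _ hr) hr, ih]
    ring

lemma exists_pth_root {p : ℕ} [Fact p.Prime] [CharP k p] [IsAlgClosed k] {σ : Type*} (g : MvPolynomial σ k)
    (hg : ∀ i, pderiv i g = 0) : ∃ r : MvPolynomial σ k, g = r ^ p := by
  classical
  have hp0 : p ≠ 0 := (Fact.out : p.Prime).ne_zero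
  have hdv : ∀ s ∈ g.support, ∀ i, p ∣ s i := by
    intro s hs i
    by_cases hsi : s i = 0
    · simp [hsi]
    have h1 := coeff_pderiv (i := i) g (s - Finsupp.single i 1)
    rw [hg i, coeff_zero] at h1
    have h2 : s - Finsupp.single i 1 + Finsupp.single i 1 = s := by
      ext j
      by_cases hj : i = j
      · subst hj; simp; omega
      · simp [Finsupp.single_apply, hj]
    have h3 : (((s - Finsupp.single i 1 : σ →₀ ℕ) i : ℕ) : k) + 1 = (s i : k) := by
      have : (s - Finsupp.single i 1 : σ →₀ ℕ) i + 1 = s i := by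
        simp; omega
      rw [← this]; push_cast; ring
    rw [h2, h3] at h1
    have h4 := (mul_eq_zero.1 h1.symm).resolve_left (mem_support_iff.1 hs)
    exact (CharP.cast_eq_zero_iff k p _).1 h4
  choose c hc using fun x : k => IsAlgClosed.exists_pow_nat_eq x (Nat.pos_of_ne_zero hp0)
  refine ⟨∑ s ∈ g.support, monomial (s.mapRange (fun n => n / p) (by simp)) (c (coeff s g)), ?_⟩
  rw [sum_pow_char]
  conv_lhs => rw [g.as_sum]
  refine Finset.sum_congr rfl fun s hs => ?_
  rw [monomial_pow, hc]
  have : s = p • s.mapRange (fun n => n / p) (by simp) := by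
    ext i
    simp [Nat.mul_div_cancel' (hdv s hs i)]
  rw [← this]

lemma exists_dual {p : ℕ} [Fact p.Prime] [CharP k p] [IsAlgClosed k] (hf : Crv d f)
    (hp : ((d * (d - 1) : ℕ) : k) ≠ 0) :
    ∃ g : MvPolynomial (Fin 2) k, g.totalDegree ≤ (d + (d - 1)) * d ∧
      slc f (Polynomial.X : Polynomial k) ∣ slc (hat f ((d + (d - 1)) * d) g) (Polynomial.X : Polynomial k) ∧
      ¬ slc f (Polynomial.X : Polynomial k) ∣
        slc (hat f ((d + (d - 1)) * d) (pderiv 1 g)) (Polynomial.X : Polynomial k) := by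
  classical
  set e := (d + (d - 1)) * d with he
  obtain ⟨a, t, α, h0, h1, hw, hα, hξ⟩ := gen_pt hf hp
  let φ : MvPolynomial (Fin 2) k →ₐ[k] PowerSeries k := aeval ![α, sx a - α * t]
  let S : Set ℕ := {n | ∃ g : MvPolynomial (Fin 2) k, g ≠ 0 ∧ φ g = 0 ∧ g.totalDegree = n}
  have hS : ∃ n, n ∈ S := ⟨_, dsc f d, dsc_ne_zero hf, dsc_vanish hf.two_le hf.deg _ _ _ h0 h1, rfl⟩
  obtain ⟨g, hg0, hgφ, hgn⟩ := Nat.find_spec hS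
  have hmin : ∀ r : MvPolynomial (Fin 2) k, φ r = 0 → r.totalDegree < g.totalDegree → r = 0 := by
    intro r hr hlt
    by_contra hne
    exact Nat.find_min hS (hgn ▸ hlt) ⟨r, hne, hr, rfl⟩
  have hge : g.totalDegree ≤ e := by
    rw [hgn]
    exact (Nat.find_min' hS ⟨dsc f d, dsc_ne_zero hf, dsc_vanish hf.two_le hf.deg _ _ _ h0 h1, rfl⟩).trans
      (dsc_deg hf.deg)
  have hpos : 0 < g.totalDegree := by
    rw [Nat.pos_iff_ne_zero]
    intro h
    have hC := totalDegree_eq_zero_iff_eq_C.1 h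
    rw [hC] at hgφ hg0
    have : φ (C (coeff 0 g)) = algebraMap k _ (coeff 0 g) := aeval_C _ _
    rw [this] at hgφ
    apply hg0
    have h5 : coeff 0 g = 0 := (algebraMap k (PowerSeries k)).injective (by simpa using hgφ)
    rw [h5, map_zero]
  have hdvd : slc f (Polynomial.X : Polynomial k) ∣ slc (hat f e g) (Polynomial.X : Polynomial k) := by
    apply hf.dvd_of_generic _ (sx_inj a) t h0
    rw [hat_spec hge _ _ α h1]
    change _ * φ g = 0
    rw [hgφ, mul_zero]
  refine ⟨g, hge, hdvd, fun hcon => ?_⟩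
  have g1 := (totalDegree_pderiv_le 1 g e hge).trans (Nat.sub_le e 1)
  have g0 := (totalDegree_pderiv_le 0 g e hge).trans (Nat.sub_le e 1)
  have k1 := vanish_of_dvd hcon _ _ h0
  have k0 := vanish_of_dvd (dual_rel hf hp hge hdvd) _ _ h0
  rw [map_sub, map_mul, k1, mul_zero, sub_zero, hat_spec g0 _ _ α h1] at k0
  rw [hat_spec g1 _ _ α h1] at k1
  have l1 : φ (pderiv 1 g) = 0 := (mul_eq_zero.1 k1).resolve_left (pow_ne_zero _ hw)
  have l0 : φ (pderiv 0 g) = 0 := (mul_eq_zero.1 k0).resolve_left (pow_ne_zero _ hw)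
  have m1 := hmin _ l1 (by have := totalDegree_pderiv_le 1 g _ le_rfl; omega)
  have m0 := hmin _ l0 (by have := totalDegree_pderiv_le 0 g _ le_rfl; omega)
  obtain ⟨r, hr⟩ := exists_pth_root (p := p) g (by intro i; fin_cases i; exacts [m0, m1])
  have hp2 := (Fact.out : p.Prime).two_le
  have hr0 : r ≠ 0 := by
    rintro rfl
    rw [zero_pow (by omega)] at hr
    exact hg0 hr
  have hrd : g.totalDegree = p * r.totalDegree := by
    rw [hr, totalDegree_pow_eq r hr0]
  apply hr0
  apply hmin
  · rw [hr, map_pow] at hgφ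
    exact pow_eq_zero_iff (by omega) |>.1 hgφ
  · nlinarith [Nat.pos_of_ne_zero (n := r.totalDegree) (by intro h; rw [h] at hrd; omega)]

end Dual2

section Slope

variable {k : Type*} [Field k] {d : ℕ} {f : MvPolynomial (Fin 2) k}

/-- tangency of the line of slope `α` at `(t,x)` -/
def Tan (f : MvPolynomial (Fin 2) k) (α t x : k) : Prop :=
  eval ![t, x] f = 0 ∧ eval ![t, x] (pderiv 0 f) + α * eval ![t, x] (pderiv 1 f) = 0

lemma Tan.fX (hf : Crv d f) {α t x : k} (h : Tan f α t x) : eval ![t, x] (pderiv 1 f) ≠ 0 := by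
  intro h1
  have h2 := h.2
  rw [h1, mul_zero, add_zero] at h2
  rcases hf.smooth _ h.1 with h3 | h3
  · exact h3 h2
  · exact h3 h1

lemma bad_of [IsAlgClosed k] (hf : Crv d f) {G : MvPolynomial (Fin 2) k} {e : ℕ} (he : G.totalDegree ≤ e)
    (hG : ¬ slc f (Polynomial.X : Polynomial k) ∣ slc G (Polynomial.X : Polynomial k)) :
    ∃ B : Finset k, B.card ≤ d * e * d ∧ ∀ t x α, Tan f α t x → eval ![t, x] G = 0 → α ∈ B := by
  classical
  have hd := hf.two_le
  have hn := nrm_ne_zero hf he hG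
  refine ⟨(nrm f G d e).roots.toFinset.biUnion fun x => (slc f x).roots.toFinset.image
    fun t => - eval ![t, x] (pderiv 0 f) / eval ![t, x] (pderiv 1 f), ?_, ?_⟩
  · refine (Finset.card_biUnion_le_card_mul _ _ d ?_).trans ?_
    · intro x _
      refine Finset.card_image_le.trans ((Multiset.toFinset_card_le _).trans ?_)
      refine (Polynomial.card_roots' _).trans ?_
      rw [slc_natDegree f d (by omega) hf.deg hf.monic x]
    · refine Nat.mul_le_mul_right _ ((Multiset.toFinset_card_le _).trans ?_)
      exact (Polynomial.card_roots' _).trans (nrm_natDegree_le (by omega) hf.deg hf.monic G he)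
  · intro t x α hT h
    simp only [Finset.mem_biUnion, Finset.mem_image, Multiset.mem_toFinset]
    have hmon := (slc_monic f d (by omega) hf.deg hf.monic x)
    have ht : (slc f x).IsRoot t := by
      rw [Polynomial.IsRoot, eval_slc]; exact hT.1
    refine ⟨x, ?_, t, (Polynomial.mem_roots hmon.ne_zero).2 ht, ?_⟩
    · rw [Polynomial.mem_roots hn, Polynomial.IsRoot]
      obtain ⟨θ, hθ⟩ := exists_split (by omega) hf.deg hf.monic x
      rw [eval_nrm G he hθ]
      rw [hθ, Polynomial.IsRoot, Polynomial.eval_prod, Finset.prod_eq_zero_iff] at ht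
      obtain ⟨j, hj, hj'⟩ := ht
      have : t = θ j := by simpa [sub_eq_zero] using hj'
      exact Finset.prod_eq_zero hj (this ▸ h)
    · have := hT.fX hf
      have h2 := hT.2
      field_simp
      linear_combination -h2

lemma bad_of' [IsAlgClosed k] (hf : Crv d f) {G : MvPolynomial (Fin 2) k} {e M : ℕ} (he : G.totalDegree ≤ e)
    (hM : d * e * d ≤ M) :
    ∃ B : Finset k, B.card ≤ M ∧
      (¬ slc f (Polynomial.X : Polynomial k) ∣ slc G (Polynomial.X : Polynomial k) →
      ∀ t x α, Tan f α t x → eval ![t, x] G = 0 → α ∈ B) := by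
  by_cases h : slc f (Polynomial.X : Polynomial k) ∣ slc G (Polynomial.X : Polynomial k)
  · exact ⟨∅, by simp, fun h' => absurd h h'⟩
  · obtain ⟨B, h1, h2⟩ := bad_of hf he h
    exact ⟨B, h1.trans hM, fun _ => h2⟩

lemma flx_deg (hf : f.totalDegree ≤ d) : (flx f).totalDegree ≤ 3 * d := by
  have a0 := (totalDegree_pderiv_le 0 f d hf).trans (Nat.sub_le d 1)
  have a1 := (totalDegree_pderiv_le 1 f d hf).trans (Nat.sub_le d 1)
  have a00 := (totalDegree_pderiv_le 0 _ d a0).trans (Nat.sub_le d 1)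
  have a10 := (totalDegree_pderiv_le 1 _ d a0).trans (Nat.sub_le d 1)
  have a11 := (totalDegree_pderiv_le 1 _ d a1).trans (Nat.sub_le d 1)
  have hm : ∀ {A B : MvPolynomial (Fin 2) k} {a b : ℕ}, A.totalDegree ≤ a → B.totalDegree ≤ b →
      (A * B).totalDegree ≤ a + b := fun h1 h2 => (totalDegree_mul _ _).trans (add_le_add h1 h2)
  have h2 : (2 : MvPolynomial (Fin 2) k).totalDegree ≤ 0 := by
    rw [show (2 : MvPolynomial (Fin 2) k) = C 2 from (map_ofNat C 2).symm, totalDegree_C]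
  rw [flx, pow_two, pow_two]
  refine (totalDegree_add _ _).trans (max_le ((totalDegree_sub _ _).trans (max_le ?_ ?_)) ?_)
  · exact (hm a00 (hm a1 a1)).trans (by omega)
  · exact (hm (hm (hm h2 a10) a0) a1).trans (by omega)
  · exact (hm a11 (hm a0 a0)).trans (by omega)

lemma bad_inf [IsAlgClosed k] (hf : Crv d f) : ∃ B : Finset k, B.card ≤ d ∧
    ∀ α, eval ![1, α] (homogeneousComponent d f) = 0 → α ∈ B := by
  classical
  have hd := hf.two_le
  let φ : MvPolynomial (Fin 2) k →ₐ[k] Polynomial k := aeval ![1, Polynomial.X]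
  set P := φ (homogeneousComponent d f) with hP
  have hev : ∀ α, P.eval α = eval ![1, α] (homogeneousComponent d f) := by
    intro α
    have : ((Polynomial.aeval α : Polynomial k →ₐ[k] k)).comp φ =
      (aeval ![1, α] : MvPolynomial (Fin 2) k →ₐ[k] k) := by
      apply MvPolynomial.algHom_ext
      intro i
      fin_cases i <;> simp [φ]
    have := congrArg (fun g => g (homogeneousComponent d f)) this
    simpa [aeval_eq_eval] using this
  have h0 : P.eval 0 = 1 := by
    rw [hev, eval_eq']
    rw [Finset.sum_eq_single (Finsupp.single 0 d)]
    · rw [coeff_homogeneousComponent]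
      simp [hf.monic]
    · intro s hs hne
      have h1 : s 1 ≠ 0 := by
        intro h1
        have h3 : s.degree = d := by
          by_contra h3
          rw [mem_support_iff, coeff_homogeneousComponent, if_neg h3] at hs
          exact hs rfl
        rw [Finsupp.degree_eq_sum, Fin.sum_univ_two, h1, add_zero] at h3
        apply hne
        ext i
        fin_cases i
        · simpa using h3
        · simpa using h1
      simp [Fin.prod_univ_two, h1]
    · intro h
      rw [notMem_support_iff] at h
      rw [h, zero_mul]
  have hP0 : P ≠ 0 := by rintro h; rw [h] at h0; simp at h0
  have hdeg : P.natDegree ≤ d := by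
    rw [hP]
    simp only [φ]
    rw [aeval_def, eval₂_eq']
    apply Polynomial.natDegree_sum_le_of_forall_le
    intro s hs
    have h1 := supp_le (homogeneousComponent_isHomogeneous d f).totalDegree_le hs
    simp only [Fin.prod_univ_two, Matrix.cons_val_zero, Matrix.cons_val_one, one_pow, one_mul]
    refine Polynomial.natDegree_mul_le.trans ?_
    rw [Polynomial.algebraMap_apply, Polynomial.natDegree_C, zero_add, Polynomial.natDegree_X_pow]
    omega
  refine ⟨P.roots.toFinset, (Multiset.toFinset_card_le _).trans ((Polynomial.card_roots' _).trans hdeg), ?_⟩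
  intro α h
  rw [Multiset.mem_toFinset, Polynomial.mem_roots hP0, Polynomial.IsRoot, hev, h]

/-- bound for the number of bad slopes -/
def badBound (m : ℕ) : ℕ := m * (m + m * (3 * m) * m + m * (2 * m * m * m) * m) +
  m * (m * (m * (2 * m * m * m) * m + m * m * m))

lemma good_slope {p : ℕ} [Fact p.Prime] [CharP k p] [IsAlgClosed k] {r m : ℕ} (d : Fin r → ℕ)
    (f : Fin r → MvPolynomial (Fin 2) k) (hf : ∀ i, Crv (d i) (f i))
    (hp : ∀ i, ((d i * (d i - 1) : ℕ) : k) ≠ 0)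
    (hne : ∀ i j, i ≠ j →
      ¬ slc (f i) (Polynomial.X : Polynomial k) ∣ slc (f j) (Polynomial.X : Polynomial k))
    (hm : ∑ i, d i ≤ m) :
    ∃ B : Finset k, B.card ≤ badBound m ∧ ∀ α, α ∉ B →
      (∀ i, eval ![1, α] (homogeneousComponent (d i) (f i)) ≠ 0) ∧
      (∀ i t x, Tan (f i) α t x → eval ![t, x] (flx (f i)) ≠ 0) ∧
      (∀ i j t x t' x', Tan (f i) α t x → Tan (f j) α t' x' → x - α * t = x' - α * t' →
        i = j ∧ t = t') := by
  classical
  have hdm : ∀ i, d i ≤ m := fun i =>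
    (Finset.single_le_sum (f := d) (fun _ _ => Nat.zero_le _) (Finset.mem_univ i)).trans hm
  have hrm : r ≤ m := by
    refine le_trans ?_ hm
    calc r = ∑ i : Fin r, 1 := by simp
      _ ≤ ∑ i, d i := Finset.sum_le_sum fun i _ => by have := (hf i).two_le; omega
  choose g hg1 hg2 hg3 using fun i => exists_dual (hf i) (hp i)
  let e : Fin r → ℕ := fun j => (d j + (d j - 1)) * d j
  have hem : ∀ j, e j ≤ 2 * m * m := fun j =>
    Nat.mul_le_mul (by have := hdm j; omega) (hdm j)
  have hhat : ∀ i j, e j * d i ≤ 2 * m * m * m := fun i j => Nat.mul_le_mul (hem j) (hdm i)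
  have hbd : ∀ i e' M, e' ≤ M → d i * e' * d i ≤ m * M * m := fun i e' M h =>
    Nat.mul_le_mul (Nat.mul_le_mul (hdm i) h) (hdm i)
  choose B1 hB1 hB1' using fun i => bad_inf (hf i)
  choose B2 hB2 hB2' using fun i => bad_of' (hf i) (flx_deg (hf i).deg)
    (hbd i _ (3 * m) (by have := hdm i; omega))
  have hgY : ∀ j, (pderiv 1 (g j)).totalDegree ≤ e j := fun j =>
    (totalDegree_pderiv_le 1 (g j) _ (hg1 j)).trans (Nat.sub_le _ 1)
  have hgA : ∀ j, (pderiv 0 (g j)).totalDegree ≤ e j := fun j =>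
    (totalDegree_pderiv_le 0 (g j) _ (hg1 j)).trans (Nat.sub_le _ 1)
  have hd1 : ∀ i, 1 ≤ d i := fun i => by have := (hf i).two_le; omega
  choose B3 hB3 hB3' using fun i => bad_of' (hf i) (hat_deg (hd1 i) (hf i).deg (hgY i))
    (hbd i _ _ (hhat i i))
  choose B4 hB4 hB4' using fun i j => bad_of' (hf i) (hat_deg (hd1 i) (hf i).deg (hg1 j))
    (hbd i _ _ (hhat i j))
  choose B5 hB5 hB5' using fun i j => bad_of' (hf i) (hf j).deg (hbd i _ _ (hdm j))
  refine ⟨(Finset.univ.biUnion fun i => B1 i ∪ B2 i ∪ B3 i) ∪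
    Finset.univ.biUnion fun i => Finset.univ.biUnion fun j => B4 i j ∪ B5 i j, ?_, ?_⟩
  · refine (Finset.card_union_le _ _).trans (add_le_add ?_ ?_)
    · refine (Finset.card_biUnion_le_card_mul _ _ _ fun i _ => ?_).trans
        (Nat.mul_le_mul_right _ (by simpa using hrm))
      refine (Finset.card_union_le _ _).trans (add_le_add ((Finset.card_union_le _ _).trans 
        (add_le_add ((hB1 i).trans (hdm i)) (hB2 i))) (hB3 i))
    · refine (Finset.card_biUnion_le_card_mul _ _ _ fun i _ => ?_).trans
        (Nat.mul_le_mul_right _ (by simpa using hrm))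
      refine (Finset.card_biUnion_le_card_mul _ _ _ fun j _ => ?_).trans
        (Nat.mul_le_mul_right _ (by simpa using hrm))
      exact (Finset.card_union_le _ _).trans (add_le_add (hB4 i j) (hB5 i j))
  · intro α hα
    have n1 : ∀ i, α ∉ B1 i := fun i h => hα (Finset.mem_union_left _ (Finset.mem_biUnion.2
      ⟨i, Finset.mem_univ i, Finset.mem_union_left _ (Finset.mem_union_left _ h)⟩))
    have n2 : ∀ i, α ∉ B2 i := fun i h => hα (Finset.mem_union_left _ (Finset.mem_biUnion.2
      ⟨i, Finset.mem_univ i, Finset.mem_union_left _ (Finset.mem_union_right _ h)⟩))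
    have n3 : ∀ i, α ∉ B3 i := fun i h => hα (Finset.mem_union_left _ (Finset.mem_biUnion.2
      ⟨i, Finset.mem_univ i, Finset.mem_union_right _ h⟩))
    have n4 : ∀ i j, α ∉ B4 i j := fun i j h => hα (Finset.mem_union_right _ (Finset.mem_biUnion.2
      ⟨i, Finset.mem_univ i, Finset.mem_biUnion.2 ⟨j, Finset.mem_univ j, Finset.mem_union_left _ h⟩⟩))
    have n5 : ∀ i j, α ∉ B5 i j := fun i j h => hα (Finset.mem_union_right _ (Finset.mem_biUnion.2
      ⟨i, Finset.mem_univ i, Finset.mem_biUnion.2 ⟨j, Finset.mem_univ j, Finset.mem_union_right _ h⟩⟩))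
    refine ⟨fun i h => n1 i (hB1' i α h), fun i t x hT h => n2 i (hB2' i (lemmaH (hf i) (hp i)) t x α hT h), ?_⟩
    intro i j t x t' x' hT hT' hξ
    -- relation at the points
    have hrel : ∀ (i : Fin r) (t x : k), Tan (f i) α t x →
        slc (f i) (Polynomial.X : Polynomial k) ∣ slc (hat (f i) (e j) (g j)) (Polynomial.X : Polynomial k) →
        eval ![α, x - α * t] (pderiv 0 (g j)) = t * eval ![α, x - α * t] (pderiv 1 (g j)) := by
      intro i t x hT hdv
      have hv := vanish_of_dvd (dual_rel (hf i) (hp i) (hg1 j) hdv) t x hT.1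
      rw [map_sub, map_mul, aeval_X, hat_spec (hgA j) t x α hT.2, hat_spec (hgY j) t x α hT.2] at hv
      simp only [aeval_eq_eval, Matrix.cons_val_zero] at hv
      have hw := hT.fX (hf i)
      have : (eval ![t, x] (pderiv 1 (f i))) ^ e j * (eval ![α, x - α * t] (pderiv 0 (g j)) -
        t * eval ![α, x - α * t] (pderiv 1 (g j))) = 0 := by
        rw [mul_sub]
        refine Eq.trans ?_ hv
        ring_nf
      have := (mul_eq_zero.1 this).resolve_left (pow_ne_zero _ hw)
      exact sub_eq_zero.1 this
    have hgj : eval ![α, x' - α * t'] (g j) = 0 := by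
      have hv := vanish_of_dvd (hg2 j) t' x' hT'.1
      rw [hat_spec (hg1 j) t' x' α hT'.2] at hv
      exact (mul_eq_zero.1 hv).resolve_left (pow_ne_zero _ (hT'.fX (hf j)))
    have hgjY : eval ![α, x' - α * t'] (pderiv 1 (g j)) ≠ 0 := by
      intro h
      apply n3 j
      refine hB3' j (hg3 j) t' x' α hT' ?_
      have := hat_spec (hgY j) t' x' α hT'.2
      refine Eq.trans this ?_
      have h' : aeval ![α, x' - α * t'] (pderiv 1 (g j)) = 0 := h
      rw [h', mul_zero]
    have hdv : slc (f i) (Polynomial.X : Polynomial k) ∣ slc (hat (f i) (e j) (g j)) (Polynomial.X : Polynomial k) := by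
      by_contra hnd
      apply n4 i j
      refine hB4' i j hnd t x α hT ?_
      have := hat_spec (hg1 j) t x α hT.2
      refine Eq.trans this ?_
      have h' : aeval ![α, x - α * t] (g j) = 0 := by rw [hξ]; exact hgj
      rw [h', mul_zero]
    have r1 := hrel i t x hT hdv
    have r2 := hrel j t' x' hT' (hg2 j)
    rw [hξ, r2] at r1
    have htt : t = t' := (mul_right_cancel₀ hgjY r1).symm
    refine ⟨?_, htt⟩
    by_contra hij
    apply n5 i j
    refine hB5' i j (hne i j hij) t x α hT ?_
    have hxx : x = x' := by rw [htt] at hξ; exact sub_left_injective hξ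
    rw [htt, hxx]
    exact hT'.1

end Slope

section Shear

variable {k : Type*} [Field k] {d : ℕ} {f : MvPolynomial (Fin 2) k}

/-- the shear `f(T, αT + X)` -/
noncomputable def sh (α : k) : MvPolynomial (Fin 2) k →ₐ[k] MvPolynomial (Fin 2) k :=
  aeval ![X 0, C α * X 0 + X 1]

lemma eval_sh (α : k) (P : Fin 2 → k) (f : MvPolynomial (Fin 2) k) :
    eval P (sh α f) = eval ![P 0, α * P 0 + P 1] f := by
  have : (aeval P).comp (sh α) = (aeval ![P 0, α * P 0 + P 1] : MvPolynomial (Fin 2) k →ₐ[k] k) := by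
    apply MvPolynomial.algHom_ext
    intro i
    fin_cases i <;> simp [sh]
  exact congrArg (fun g => g f) this

lemma pderiv0_sh (α : k) (f : MvPolynomial (Fin 2) k) :
    pderiv 0 (sh α f) = sh α (pderiv 0 f + C α * pderiv 1 f) := by
  rw [sh, deriv_aeval, Fin.sum_univ_two]
  simp [pderiv_X, mul_comm]

lemma pderiv1_sh (α : k) (f : MvPolynomial (Fin 2) k) :
    pderiv 1 (sh α f) = sh α (pderiv 1 f) := by
  rw [sh, deriv_aeval, Fin.sum_univ_two]
  simp [pderiv_X]

lemma sh_homog (α : k) {G : MvPolynomial (Fin 2) k} {n : ℕ} (hG : G.IsHomogeneous n) :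
    (sh α G).IsHomogeneous n := by
  have := hG.aeval (![X 0, C α * X 0 + X 1] : Fin 2 → MvPolynomial (Fin 2) k) (n := 1) (by
    intro i
    fin_cases i
    · exact isHomogeneous_X _ _
    · exact (isHomogeneous_C_mul_X _ _).add (isHomogeneous_X _ _))
  simpa [sh] using this

lemma sh_hc (α : k) (G : MvPolynomial (Fin 2) k) (n : ℕ) :
    homogeneousComponent n (sh α G) = sh α (homogeneousComponent n G) := by
  conv_lhs => rw [← sum_homogeneousComponent G]
  rw [map_sum, map_sum]
  have : ∀ i, homogeneousComponent n (sh α (homogeneousComponent i G)) =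
      if n = i then sh α (homogeneousComponent i G) else 0 := fun i =>
    homogeneousComponent_of_mem (sh_homog α (homogeneousComponent_isHomogeneous i G))
  simp_rw [this]
  rw [Finset.sum_ite_eq]
  split_ifs with h
  · rfl
  · rw [homogeneousComponent_eq_zero, map_zero]
    simpa using h

lemma eval_one_zero {G : MvPolynomial (Fin 2) k} {n : ℕ} (hG : G.IsHomogeneous n) :
    eval ![1, 0] G = coeff (Finsupp.single 0 n) G := by
  classical
  rw [eval_eq', Finset.sum_eq_single (Finsupp.single 0 n)]
  · simp
  · intro s hs hne
    have h1 := hG (mem_support_iff.1 hs)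
    rw [Finsupp.weight_apply, Finsupp.sum_fintype _ _ (by simp), Fin.sum_univ_two] at h1
    have h2 : s 1 ≠ 0 := by
      intro h0
      apply hne
      ext i
      fin_cases i
      · simpa [h0] using h1
      · simp [h0]
    simp [h2]
  · intro h
    rw [notMem_support_iff.1 h, zero_mul]

lemma coeff_sh_top (α : k) (G : MvPolynomial (Fin 2) k) (n : ℕ) :
    coeff (Finsupp.single 0 n) (sh α G) = eval ![1, α] (homogeneousComponent n G) := by
  have h1 : coeff (Finsupp.single 0 n) (sh α G) =
      coeff (Finsupp.single 0 n) (homogeneousComponent n (sh α G)) := by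
    rw [coeff_homogeneousComponent]; simp
  rw [h1, ← eval_one_zero (homogeneousComponent_isHomogeneous _ _), sh_hc, eval_sh]
  simp

lemma sh_deg (α : k) {G : MvPolynomial (Fin 2) k} {n : ℕ} (hG : G.totalDegree ≤ n) :
    (sh α G).totalDegree ≤ n := by
  rw [← sum_homogeneousComponent G, map_sum]
  refine totalDegree_finsetSum_le fun i hi => ?_
  refine (sh_homog α (homogeneousComponent_isHomogeneous i G)).totalDegree_le.trans ?_
  simp at hi; omega

/-- the normalized sheared polynomial -/
noncomputable def shn (d : ℕ) (α : k) (f : MvPolynomial (Fin 2) k) : MvPolynomial (Fin 2) k :=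
  C (eval ![1, α] (homogeneousComponent d f))⁻¹ * sh α f

/-- a family of curves with only simple branching over the `X`-line -/
structure Smp {ι : Type*} (d : ι → ℕ) (h : ι → MvPolynomial (Fin 2) k) : Prop where
  crv : ∀ i, Crv (d i) (h i)
  nd : ∀ i t x, eval ![t, x] (h i) = 0 → eval ![t, x] (pderiv 0 (h i)) = 0 →
    eval ![t, x] (pderiv 0 (pderiv 0 (h i))) ≠ 0
  uniq : ∀ i j t t' x, eval ![t, x] (h i) = 0 → eval ![t, x] (pderiv 0 (h i)) = 0 →
    eval ![t', x] (h j) = 0 → eval ![t', x] (pderiv 0 (h j)) = 0 → i = j ∧ t = t'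

lemma shn_crv (hf : Crv d f) {α : k} (hα : eval ![1, α] (homogeneousComponent d f) ≠ 0) :
    Crv d (shn d α f) := by
  have hc := inv_ne_zero hα
  have key : ∀ (G : MvPolynomial (Fin 2) k) (P : Fin 2 → k),
      (eval ![P 0, α * P 0 + P 1] G = 0 → eval ![P 0, α * P 0 + P 1] (pderiv 0 G) ≠ 0 ∨
        eval ![P 0, α * P 0 + P 1] (pderiv 1 G) ≠ 0) →
      eval P (C (eval ![1, α] (homogeneousComponent d f))⁻¹ * sh α G) = 0 →
      eval P (pderiv 0 (C (eval ![1, α] (homogeneousComponent d f))⁻¹ * sh α G)) ≠ 0 ∨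
      eval P (pderiv 1 (C (eval ![1, α] (homogeneousComponent d f))⁻¹ * sh α G)) ≠ 0 := by
    intro G P h h1
    rw [pderiv_C_mul, pderiv_C_mul, pderiv0_sh, pderiv1_sh]
    rw [map_mul, eval_C, eval_sh] at h1
    simp only [map_mul, eval_C, eval_sh, map_add, ne_eq, mul_eq_zero, hc, false_or]
    have := h ((mul_eq_zero.1 h1).resolve_left hc)
    by_contra hcon
    push Not at hcon
    obtain ⟨hc1, hc2⟩ := hcon
    rw [hc2, mul_zero, add_zero] at hc1
    rcases this with h2 | h2
    · exact h2 hc1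
    · exact h2 hc2
  refine ⟨hf.two_le, ?_, ?_, ?_, ?_⟩
  · refine (totalDegree_mul _ _).trans ?_
    rw [totalDegree_C, zero_add]
    exact sh_deg α hf.deg
  · rw [shn, coeff_C_mul, coeff_sh_top, inv_mul_cancel₀ hα]
  · intro P
    exact key f P (hf.smooth _)
  · intro P hP
    rw [shn, homogeneousComponent_C_mul, sh_hc]
    refine key _ P (hf.inf _ ?_)
    intro h0
    apply hP
    have h1 := congrFun h0 0
    have h2 := congrFun h0 1
    simp at h1 h2
    ext i
    fin_cases i
    · simpa using h1
    · simpa [h1] using h2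

lemma shn_tan {α : k} (hα : eval ![1, α] (homogeneousComponent d f) ≠ 0) {t x : k}
    (h0 : eval ![t, x] (shn d α f) = 0) (h1 : eval ![t, x] (pderiv 0 (shn d α f)) = 0) :
    Tan f α t (α * t + x) := by
  have hc := inv_ne_zero hα
  rw [shn, map_mul, eval_C, eval_sh] at h0
  rw [shn, pderiv_C_mul, map_mul, eval_C, pderiv0_sh, eval_sh] at h1
  have h0' := (mul_eq_zero.1 h0).resolve_left hc
  have h1' := (mul_eq_zero.1 h1).resolve_left hc
  simp only [map_add, map_mul, eval_C, Matrix.cons_val_zero, Matrix.cons_val_one] at h0' h1'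
  exact ⟨h0', h1'⟩

lemma shn_smp {ι : Type*} {d : ι → ℕ} {f : ι → MvPolynomial (Fin 2) k} {α : k}
    (hf : ∀ i, Crv (d i) (f i))
    (h1 : ∀ i, eval ![1, α] (homogeneousComponent (d i) (f i)) ≠ 0)
    (h2 : ∀ i t x, Tan (f i) α t x → eval ![t, x] (flx (f i)) ≠ 0)
    (h3 : ∀ i j t x t' x', Tan (f i) α t x → Tan (f j) α t' x' →
      x - α * t = x' - α * t' → i = j ∧ t = t') :
    Smp d (fun i => shn (d i) α (f i)) := by
  refine ⟨fun i => shn_crv (hf i) (h1 i), ?_, ?_⟩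
  · intro i t x ha hb hc
    have hT := shn_tan (h1 i) ha hb
    apply h2 i _ _ hT
    have hc' := inv_ne_zero (h1 i)
    rw [shn, pderiv_C_mul, pderiv0_sh, pderiv_C_mul, pderiv0_sh, map_mul, eval_C, eval_sh] at hc
    have hc2 := (mul_eq_zero.1 hc).resolve_left hc'
    simp only [map_add, pderiv_C_mul, map_mul, eval_C, Matrix.cons_val_zero, Matrix.cons_val_one] at hc2
    rw [pderiv_comm' 0 1] at hc2
    have hT2 := hT.2
    simp only [flx, map_add, map_sub, map_mul, map_pow, map_ofNat]
    rw [eq_neg_of_add_eq_zero_left hT2]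
    linear_combination (eval ![t, α * t + x] (pderiv 1 (f i))) ^ 2 * hc2
  · intro i j t t' x ha hb ha' hb'
    have hT := shn_tan (h1 i) ha hb
    have hT' := shn_tan (h1 j) ha' hb'
    exact h3 i j _ _ _ _ hT hT' (by ring)

end Shear

section Sys

variable {k E : Type*} [Field k] [Field E] [Algebra k E] {ι : Type*} {d : ι → ℕ}
  {h : ι → MvPolynomial (Fin 2) k}

/-- a splitting system over the `x`-line with group `G` -/
structure Sys (d : ι → ℕ) (h : ι → MvPolynomial (Fin 2) k) (x : E) (t : (Σ i, Fin (d i)) → E)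
    (G : Subgroup (E ≃ₐ[k] E)) : Prop where
  smp : Smp d h
  split : ∀ i, slc (h i) x = ∏ j, (Polynomial.X - Polynomial.C (t ⟨i, j⟩))
  trans : Function.Injective (Polynomial.aeval x : Polynomial k →ₐ[k] E)
  fix : ∀ σ ∈ G, σ x = x
  gen : ∀ σ ∈ G, (∀ s, σ (t s) = t s) → σ = 1
  inv : ∀ b : E, (∀ σ ∈ G, σ b = b) →
    (Polynomial.aeval x : Polynomial k →ₐ[k] E).toRingHom.IsIntegralElem b →
    ∃ P : Polynomial k, Polynomial.aeval x P = b

/-- evaluation point -/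
def opt {S A : Type*} (x : A) (t : S → A) : Option S → A := fun o => o.elim x t

@[simp] lemma opt_none {S A : Type*} (x : A) (t : S → A) : opt x t none = x := rfl
@[simp] lemma opt_some {S A : Type*} (x : A) (t : S → A) (s : S) : opt x t (some s) = t s := rfl

variable {x : E} {t : (Σ i, Fin (d i)) → E} {G : Subgroup (E ≃ₐ[k] E)}

lemma Sys.not_const (H : Sys d h x t G) (c : k) : algebraMap k E c ≠ x := by
  intro hc
  have h1 : (Polynomial.X - Polynomial.C c : Polynomial k) = 0 := H.trans (by simp [hc])
  exact Polynomial.X_sub_C_ne_zero c h1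

lemma Sys.root (H : Sys d h x t G) (s) : aeval ![t s, x] (h s.1) = 0 := root_of_split (H.split s.1) s.2

lemma Sys.ne [IsAlgClosed k] (H : Sys d h x t G) (i) (j l : Fin (d i)) (hjl : l ≠ j) :
    t ⟨i, j⟩ ≠ t ⟨i, l⟩ := by
  obtain ⟨V, hV, hx⟩ := exists_place x H.not_const
  intro h0
  have := val_diff hV hx (H.smp.crv i) (H.split i) j l hjl
  rw [h0, sub_self, map_zero] at this
  rw [← this] at hx
  exact absurd hx (by simp)

lemma Sys.perm [IsAlgClosed k] (H : Sys d h x t G) (σ) (hσ : σ ∈ G) :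
    ∃ π : ∀ i, Equiv.Perm (Fin (d i)), ∀ i j, σ (t ⟨i, j⟩) = t ⟨i, π i j⟩ := by
  have h1 : ∀ i j, ∃ l, σ (t ⟨i, j⟩) = t ⟨i, l⟩ := by
    intro i j
    have h2 : aeval ![σ (t ⟨i, j⟩), x] (h i) = 0 := by
      have h3 := congrArg σ (H.root ⟨i, j⟩)
      rw [map_zero] at h3
      rw [← h3]
      have : (aeval ![σ (t ⟨i, j⟩), x] : MvPolynomial (Fin 2) k →ₐ[k] E) =
          (σ : E →ₐ[k] E).comp (aeval ![t ⟨i, j⟩, x]) := by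
        apply MvPolynomial.algHom_ext
        intro i; fin_cases i <;> simp [H.fix σ hσ]
      rw [this]; rfl
    rw [← eval_slc, H.split, Polynomial.eval_prod, Finset.prod_eq_zero_iff] at h2
    obtain ⟨l, _, hl⟩ := h2
    exact ⟨l, by simpa [sub_eq_zero] using hl⟩
  choose π hπ using h1
  have hinj : ∀ i, Function.Injective (π i) := by
    intro i j l hjl
    by_contra hne
    apply H.ne i j l (fun h => hne h.symm)
    apply σ.injective
    rw [hπ, hπ, hjl]
  exact ⟨fun i => Equiv.ofBijective (π i) (Finite.injective_iff_bijective.1 (hinj i)),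
    fun i j => hπ i j⟩

/-- the permutation of the index set -/
def sgm (π : ∀ i, Equiv.Perm (Fin (d i))) : (Σ i, Fin (d i)) → (Σ i, Fin (d i)) :=
  fun s => ⟨s.1, π s.1 s.2⟩

lemma aeval_rename_opt {σ : E →ₐ[k] E} (hx : σ x = x) (g : (Σ i, Fin (d i)) → (Σ i, Fin (d i)))
    (ht : ∀ s, σ (t s) = t (g s)) (P : MvPolynomial (Option (Σ i, Fin (d i))) k) :
    σ (aeval (opt x t) P) = aeval (opt x t) (rename (Option.map g) P) := by
  have : σ.comp (aeval (opt x t)) = (aeval (opt x t)).comp (rename (Option.map g)) := by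
    apply MvPolynomial.algHom_ext
    intro o
    cases o with
    | none => simp [hx]
    | some s => simp [ht]
  exact congrArg (fun g => g P) this

lemma Sys.integral (H : Sys d h x t G) (P : MvPolynomial (Option (Σ i, Fin (d i))) k) :
    (Polynomial.aeval x : Polynomial k →ₐ[k] E).toRingHom.IsIntegralElem (aeval (opt x t) P) := by
  have hc : ∀ Q : Polynomial k, (Polynomial.aeval x : Polynomial k →ₐ[k] E).toRingHom.IsIntegralElem
      (Polynomial.aeval x Q) := fun Q =>
    RingHom.isIntegralElem_map (f := (Polynomial.aeval x : Polynomial k →ₐ[k] E).toRingHom) (x := Q)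
  induction P using MvPolynomial.induction_on with
  | C a => simpa using hc (Polynomial.C a)
  | add p q hp hq => rw [map_add]; exact RingHom.IsIntegralElem.add _ hp hq
  | mul_X p n hp =>
    rw [map_mul, aeval_X]
    refine RingHom.IsIntegralElem.mul _ hp ?_
    cases n with
    | none => simpa using hc Polynomial.X
    | some s =>
      have hs := H.smp.crv s.1
      have h2 := hs.two_le
      refine ⟨slc (h s.1) Polynomial.X, slc_monic _ (d s.1) (by omega) hs.deg hs.monic _, ?_⟩
      have h4 := H.root s
      rw [← Polynomial.eval_map]
      have h3 := map_slc (Polynomial.aeval x : Polynomial k →ₐ[k] E) (h s.1) (Polynomial.X)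
      have h5 : (Polynomial.aeval x : Polynomial k →ₐ[k] E) Polynomial.X = x := by simp
      rw [h5] at h3
      rw [opt_some, ← h4, ← eval_slc, ← h3]
      rfl

/-- a point over `x₀` -/
lemma Sys.exists_point [IsAlgClosed k] (H : Sys d h x t G) (x₀ : k) : ∃ θ : (Σ i, Fin (d i)) → k,
    ∀ P, aeval (opt x t) P = 0 → eval (opt x₀ θ) P = 0 := by
  have hne : x - algebraMap k E x₀ ≠ 0 := fun h => H.not_const x₀ (sub_eq_zero.1 h).symm
  obtain ⟨V, hV, hx⟩ := exists_place (k := k) (x - algebraMap k E x₀)⁻¹ (by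
    intro c hc
    by_cases h0 : c = 0
    · rw [h0, map_zero] at hc
      exact inv_ne_zero hne hc.symm
    · apply H.not_const (x₀ + c⁻¹)
      rw [map_add, map_inv₀, hc, inv_inv]
      ring)
  have hx1 : V.valuation (x - algebraMap k E x₀) < 1 := by
    rw [map_inv₀] at hx
    have := (one_lt_inv₀ (zero_lt_iff.2 (by simpa using hne))).1 hx
    exact this
  have hcon : ∀ c : k, V.valuation (algebraMap k E c) ≤ 1 := val_const_le hV
  have hxle : V.valuation x ≤ 1 := by
    have : x = (x - algebraMap k E x₀) + algebraMap k E x₀ := by ring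
    rw [this]
    exact (V.valuation.map_add _ _).trans (max_le hx1.le (hcon _))
  have hex : ∀ s : (Σ i, Fin (d i)), ∃ θ : k, V.valuation (t s - algebraMap k E θ) < 1 := by
    intro s
    have hs := H.smp.crv s.1
    have h2 := hs.two_le
    obtain ⟨θ, hθ⟩ := exists_split (by omega) hs.deg hs.monic x₀
    -- valuation of `t s` is at most one
    have hts : V.valuation (t s) ≤ 1 := by
      have hi := H.integral (X (some s))
      rw [aeval_X, opt_some] at hi
      let ψ : Polynomial k →+* V := (Polynomial.aeval x : Polynomial k →ₐ[k] E).toRingHom.codRestrict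
        V.toSubring (fun P => (V.valuation_le_one_iff _).1 (val_poly_le_one hV x hxle P))
      have h3 : (V.subtype.comp ψ).IsIntegralElem (t s) := hi
      have h4 : IsIntegral V (t s) := RingHom.IsIntegralElem.of_comp h3
      obtain ⟨y, hy⟩ := IsIntegrallyClosed.isIntegral_iff.1 h4
      rw [← hy]
      exact (V.valuation_le_one_iff _).2 y.2
    have hprod : V.valuation (∏ j, (t s - algebraMap k E (θ j))) < 1 := by
      have h5 : aeval ![t s, algebraMap k E x₀] (h s.1) = ∏ j, (t s - algebraMap k E (θ j)) := by
        rw [← eval_slc]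
        have h6 := map_slc (Algebra.ofId k E) (h s.1) x₀
        have h7 : Algebra.ofId k E x₀ = algebraMap k E x₀ := rfl
        rw [← h7, ← h6, hθ, Polynomial.map_prod, Polynomial.eval_prod]
        refine Finset.prod_congr rfl fun j _ => ?_
        simp
      have h8 : ∀ Q : MvPolynomial (Fin 2) k,
          V.valuation (aeval ![t s, algebraMap k E x₀] Q - aeval ![t s, x] Q) < 1 := by
        intro Q
        induction Q using MvPolynomial.induction_on with
        | C a => simp
        | add p q hp hq =>
          rw [map_add, map_add, add_sub_add_comm]
          exact (V.valuation.map_add _ _).trans_lt (max_lt hp hq)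
        | mul_X p n hp =>
          have h2 : V.valuation ((![t s, algebraMap k E x₀] : Fin 2 → E) n) ≤ 1 := by
            fin_cases n
            · exact hts
            · exact hcon _
          have h1 : V.valuation ((![t s, algebraMap k E x₀] : Fin 2 → E) n - (![t s, x] : Fin 2 → E) n) < 1 := by
            fin_cases n
            · simp
            · simp only [Fin.mk_one, Matrix.cons_val_one]
              rw [Valuation.map_sub_swap]; exact hx1
          have h3 : V.valuation (aeval ![t s, x] p) ≤ 1 := by
            have := val_aeval_le hV (![t s, x] : Fin 2 → E) 1 le_rfl
              (by intro i; fin_cases i; exacts [hts, hxle]) p p.totalDegree le_rfl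
            simpa using this
          have : aeval ![t s, algebraMap k E x₀] (p * X n) - aeval ![t s, x] (p * X n) =
            (aeval ![t s, algebraMap k E x₀] p - aeval ![t s, x] p) * (![t s, algebraMap k E x₀] : Fin 2 → E) n +
            aeval ![t s, x] p * ((![t s, algebraMap k E x₀] : Fin 2 → E) n - (![t s, x] : Fin 2 → E) n) := by
            rw [map_mul, map_mul, aeval_X, aeval_X]; ring
          rw [this]
          refine (V.valuation.map_add _ _).trans_lt (max_lt ?_ ?_)
          · rw [map_mul]; exact (mul_le_of_le_one_right' h2).trans_lt hp
          · rw [map_mul]; exact (mul_le_of_le_one_left' h3).trans_lt h1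
      rw [← h5]
      have := h8 (h s.1)
      rwa [H.root s, sub_zero] at this
    by_contra hcon2
    push Not at hcon2
    rw [map_prod] at hprod
    have : (1 : _) ≤ ∏ j, V.valuation (t s - algebraMap k E (θ j)) :=
      Finset.one_le_prod' fun j _ => hcon2 (θ j)
    exact absurd hprod (not_lt.2 this)
  choose θ hθ using hex
  refine ⟨θ, fun P hP => ?_⟩
  have key : ∀ P, V.valuation (aeval (opt x t) P - algebraMap k E (eval (opt x₀ θ) P)) < 1 := by
    intro P
    induction P using MvPolynomial.induction_on with
    | C a => simp
    | add p q hp hq =>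
      rw [map_add, map_add, map_add, add_sub_add_comm]
      exact (V.valuation.map_add _ _).trans_lt (max_lt hp hq)
    | mul_X p n hp =>
      have h1 : V.valuation (opt x t n - algebraMap k E (opt x₀ θ n)) < 1 := by
        cases n with
        | none => exact hx1
        | some s => exact hθ s
      have h2 : V.valuation (opt x t n) ≤ 1 := by
        have : opt x t n = (opt x t n - algebraMap k E (opt x₀ θ n)) + algebraMap k E (opt x₀ θ n) := by ring
        rw [this]
        exact (V.valuation.map_add _ _).trans (max_le h1.le (hcon _))
      have : aeval (opt x t) (p * X n) - algebraMap k E (eval (opt x₀ θ) (p * X n)) =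
        (aeval (opt x t) p - algebraMap k E (eval (opt x₀ θ) p)) * opt x t n +
        algebraMap k E (eval (opt x₀ θ) p) * (opt x t n - algebraMap k E (opt x₀ θ n)) := by
        simp; ring
      rw [this]
      refine (V.valuation.map_add _ _).trans_lt (max_lt ?_ ?_)
      · rw [map_mul]; exact (mul_le_of_le_one_right' h2).trans_lt hp
      · rw [map_mul]; exact (mul_le_of_le_one_left' (hcon _)).trans_lt h1
  have h1 := key P
  by_contra hne0
  rw [hP, zero_sub, Valuation.map_neg, hV _ hne0] at h1
  exact lt_irrefl _ h1

end Sys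

section Inertia

variable {k E : Type*} [Field k] [IsAlgClosed k] [Field E] [Algebra k E] {ι : Type*} {d : ι → ℕ}
  {h : ι → MvPolynomial (Fin 2) k}
  {x : E} {t : (Σ i, Fin (d i)) → E} {G : Subgroup (E ≃ₐ[k] E)}

/-- a homomorphism from the coordinate ring -/
lemma exists_chi (x : E) (t : (Σ i, Fin (d i)) → E) (x₀ : k) (θ : (Σ i, Fin (d i)) → k)
    (hθ : ∀ P, aeval (opt x t) P = 0 → eval (opt x₀ θ) P = 0) :
    ∃ χ : (aeval (opt x t) : MvPolynomial (Option (Σ i, Fin (d i))) k →ₐ[k] E).range →ₐ[k] k,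
      ∀ P, χ ((aeval (opt x t)).rangeRestrict P) = eval (opt x₀ θ) P := by
  set φ := (aeval (opt x t) : MvPolynomial (Option (Σ i, Fin (d i))) k →ₐ[k] E)
  have hs := φ.rangeRestrict_surjective
  refine ⟨AlgHom.liftOfSurjective φ.rangeRestrict hs (aeval (opt x₀ θ)) ?_, ?_⟩
  · intro P hP
    apply hθ P
    have := congrArg Subtype.val (show φ.rangeRestrict P = 0 from hP)
    exact this
  · intro P
    exact AlgHom.liftOfSurjective_apply φ.rangeRestrict hs (aeval (opt x₀ θ)) _ P

lemma Sys.inertia [Finite ι] [Finite G] (H : Sys d h x t G) (x₀ : k)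
    (φ : MvPolynomial (Option (Σ i, Fin (d i))) k →ₐ[k] E) (hφ : φ = aeval (opt x t))
    (χ : φ.range →ₐ[k] k)
    (h0 : χ (φ.rangeRestrict (X none)) = x₀)
    (h2 : φ.rangeRestrict (X none - C x₀) ∈ (RingHom.ker χ) ^ 2) :
    ∃ π : ∀ i, Equiv.Perm (Fin (d i)), (∃ σ ∈ G, σ ≠ 1 ∧ ∀ s, σ (t s) = t (sgm π s)) ∧
      ∀ s, χ (φ.rangeRestrict (X (some (sgm π s)))) = χ (φ.rangeRestrict (X (some s))) := by
  classical
  have := Fintype.ofFinite G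
  have hP : ∀ σ : G, ∃ π : ∀ i, Equiv.Perm (Fin (d i)), ∀ s, σ.1 (t s) = t (sgm π s) := by
    intro σ
    obtain ⟨π, hπ⟩ := H.perm σ.1 σ.2
    exact ⟨π, fun s => hπ s.1 s.2⟩
  choose π hπ using hP
  by_contra hcon
  have hcon' : ∀ σ : G, σ ≠ 1 → ∃ s, χ (φ.rangeRestrict (X (some (sgm (π σ) s)))) ≠
      χ (φ.rangeRestrict (X (some s))) := by
    intro σ hσ
    by_contra h
    push Not at h
    exact hcon ⟨π σ, ⟨σ.1, σ.2, fun h => hσ (Subtype.ext h), hπ σ⟩, h⟩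
  have hmem : ∀ (σ : G) (b : φ.range), σ.1 (b : E) ∈ φ.range := by
    rintro σ ⟨_, P, rfl⟩
    refine ⟨rename (Option.map (sgm (π σ))) P, ?_⟩
    rw [hφ]
    exact (aeval_rename_opt (σ := (σ.1 : E →ₐ[k] E)) (H.fix _ σ.2) _ (hπ σ) P).symm
  let S : G → (φ.range →ₐ[k] φ.range) := fun σ =>
    ((σ.1 : E →ₐ[k] E).comp φ.range.val).codRestrict φ.range (hmem σ)
  have hSt : ∀ σ s, S σ (φ.rangeRestrict (X (some s))) = φ.rangeRestrict (X (some (sgm (π σ) s))) := by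
    intro σ s
    apply Subtype.ext
    change σ.1 (φ (X (some s))) = φ (X (some (sgm (π σ) s)))
    simp [hφ, hπ]
  set 𝔓 := RingHom.ker χ with h𝔓
  let V : Submodule k φ.range := 𝔓.restrictScalars k
  let W : Option {σ : G // σ ≠ 1} → Submodule k V := fun o => match o with
    | none => ((𝔓 ^ 2).restrictScalars k).comap V.subtype
    | some σ => LinearMap.ker ((χ.comp (S σ.1)).toLinearMap.comp V.subtype)
  have hxne : φ.rangeRestrict (X none - C x₀) ≠ 0 := by
    intro h
    have := congrArg Subtype.val h
    apply H.not_const x₀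
    have h3 : φ (X none - C x₀) = 0 := this
    rw [hφ, map_sub, aeval_X, opt_none, sub_eq_zero] at h3
    rw [h3]; simp
  have hxm : φ.rangeRestrict (X none - C x₀) ∈ 𝔓 := Ideal.pow_le_self two_ne_zero h2
  have hW : ∀ o, W o ≠ ⊤ := by
    rintro (_ | ⟨σ, hσ⟩) htop
    · have hle : 𝔓 ≤ 𝔓 • 𝔓 := by
        intro b hb
        have : (⟨b, hb⟩ : V) ∈ W none := by rw [htop]; trivial
        have : b ∈ 𝔓 ^ 2 := this
        rwa [pow_two] at this
      have hN : IsNoetherianRing φ.range := by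
        have : Finite (Option (Σ i, Fin (d i))) := inferInstance
        exact isNoetherianRing_of_surjective _ _ φ.rangeRestrict.toRingHom φ.rangeRestrict_surjective
      obtain ⟨e, he, he2⟩ := Submodule.exists_sub_one_mem_and_smul_eq_zero_of_fg_of_le_smul 𝔓 𝔓
        (IsNoetherian.noetherian 𝔓) hle
      have h4 := he2 _ hxm
      rw [smul_eq_mul, mul_eq_zero] at h4
      rcases h4 with h4 | h4
      · rw [h4] at he
        have : χ (0 - 1) = 0 := he
        simp at this
      · exact hxne h4
    · obtain ⟨s, hs⟩ := hcon' σ hσ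
      have hm : φ.rangeRestrict (X (some s)) - algebraMap k _ (χ (φ.rangeRestrict (X (some s)))) ∈ 𝔓 := by
        rw [h𝔓, RingHom.mem_ker, map_sub, AlgHom.commutes]; simp
      have h5 : (⟨_, hm⟩ : V) ∈ W (some ⟨σ, hσ⟩) := by rw [htop]; trivial
      have h6 : χ (S σ (φ.rangeRestrict (X (some s)) - algebraMap k _ (χ (φ.rangeRestrict (X (some s)))))) = 0 := h5
      rw [map_sub, hSt, AlgHom.commutes, map_sub, AlgHom.commutes] at h6
      exact hs (by simpa [sub_eq_zero] using h6)
  have hex : ∃ v : V, ∀ o, v ∉ W o := by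
    by_contra hne
    push Not at hne
    obtain ⟨o, ho⟩ := Subspace.exists_eq_top_of_iUnion_eq_univ (p := W)
      (Set.eq_univ_of_forall fun v => Set.mem_iUnion.2 (hne v))
    exact hW o ho
  obtain ⟨⟨b, hb⟩, hv⟩ := hex
  have hb2 : b ∉ 𝔓 ^ 2 := hv none
  have hbσ : ∀ σ : G, σ ≠ 1 → χ (S σ b) ≠ 0 := fun σ hσ => hv (some ⟨σ, hσ⟩)
  have hS1 : S 1 b = b := Subtype.ext rfl
  -- the norm
  have hnorm : ∃ P : Polynomial k, Polynomial.aeval x P = ∏ σ : G, σ.1 (b : E) := by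
    apply H.inv
    · intro τ hτ
      rw [map_prod]
      exact Fintype.prod_equiv (Equiv.mulLeft (⟨τ, hτ⟩ : G)) _ _ (fun σ => rfl)
    · have h7 : (∏ σ : G, σ.1 (b : E)) ∈ φ.range := Subalgebra.prod_mem _ fun σ _ => hmem σ b
      obtain ⟨P, hP⟩ := h7
      rw [← hP, hφ]
      exact H.integral P
  obtain ⟨P, hP⟩ := hnorm
  have hPB : Polynomial.aeval (φ.rangeRestrict (X none)) P = ∏ σ : G, S σ b := by
    apply Subtype.ext
    have h8 : ((∏ σ : G, S σ b : φ.range) : E) = ∏ σ : G, σ.1 (b : E) := by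
      rw [SubmonoidClass.coe_finsetProd]
      rfl
    rw [h8, ← hP]
    have := (Polynomial.aeval_algHom_apply φ.range.val (φ.rangeRestrict (X none)) P).symm
    refine this.trans ?_
    congr 2
    change φ (X none) = x
    simp [hφ]
  rw [← Finset.mul_prod_erase _ _ (Finset.mem_univ (1 : G)), hS1] at hPB
  set u := ∏ σ ∈ Finset.univ.erase (1 : G), S σ b
  have hu : χ u ≠ 0 := by
    rw [map_prod, Finset.prod_ne_zero_iff]
    intro σ hσ
    exact hbσ σ (Finset.ne_of_mem_erase hσ)
  have hroot : P.IsRoot x₀ := by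
    have h9 := congrArg χ hPB
    rw [map_mul, (show χ b = 0 from hb), zero_mul, ← Polynomial.aeval_algHom_apply, h0] at h9
    simpa using h9
  obtain ⟨Q, hQ⟩ := Polynomial.dvd_iff_isRoot.2 hroot
  have hbu : b * u ∈ 𝔓 ^ 2 := by
    rw [← hPB, hQ, map_mul]
    refine Ideal.mul_mem_right _ _ ?_
    convert h2 using 1
    rw [map_sub, map_sub, Polynomial.aeval_X, Polynomial.aeval_C, algHom_C]
  apply hb2
  have h10 : b = algebraMap k _ (χ u)⁻¹ * (b * u) + b * (1 - algebraMap k _ (χ u)⁻¹ * u) := by ring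
  rw [h10]
  refine Ideal.add_mem _ (Ideal.mul_mem_left _ _ hbu) ?_
  rw [pow_two]
  refine Ideal.mul_mem_mul hb ?_
  rw [h𝔓, RingHom.mem_ker, map_sub, map_mul, AlgHom.commutes]
  simp [hu]

end Inertia

section Full

variable {k E : Type*} [Field k] [IsAlgClosed k] [Field E] [Algebra k E] {ι : Type*} {d : ι → ℕ}
  {h : ι → MvPolynomial (Fin 2) k}
  {x : E} {t : (Σ i, Fin (d i)) → E} {G : Subgroup (E ≃ₐ[k] E)}

lemma mem_sq_of {B : Type*} [CommRing B] [Algebra k B] (χ : B →ₐ[k] k) (b u : B)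
    (hb : χ b = 0) (hu : χ u ≠ 0) (hbu : b * u ∈ (RingHom.ker χ) ^ 2) : b ∈ (RingHom.ker χ) ^ 2 := by
  have h10 : b = algebraMap k _ (χ u)⁻¹ * (b * u) + b * (1 - algebraMap k _ (χ u)⁻¹ * u) := by ring
  rw [h10]
  refine Ideal.add_mem _ (Ideal.mul_mem_left _ _ hbu) ?_
  rw [pow_two]
  refine Ideal.mul_mem_mul hb ?_
  rw [RingHom.mem_ker, map_sub, map_mul, AlgHom.commutes]
  simp [hu]

/-- realized permutations -/
def Sys.rel (H : Sys d h x t G) : Subgroup (∀ i, Equiv.Perm (Fin (d i))) where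
  carrier := {π | ∃ σ ∈ G, ∀ s, σ (t s) = t (sgm π s)}
  mul_mem' := by
    rintro π₁ π₂ ⟨σ₁, h₁, h₁'⟩ ⟨σ₂, h₂, h₂'⟩
    exact ⟨σ₁ * σ₂, G.mul_mem h₁ h₂, fun s => by
      rw [AlgEquiv.mul_apply, h₂', h₁']; rfl⟩
  one_mem' := ⟨1, G.one_mem, fun s => rfl⟩
  inv_mem' := by
    rintro π ⟨σ, hσ, hσ'⟩
    refine ⟨σ⁻¹, G.inv_mem hσ, fun s => ?_⟩
    apply σ.injective
    rw [hσ']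
    have : sgm π (sgm π⁻¹ s) = s := by
      change (⟨s.1, π s.1 ((π s.1)⁻¹ s.2)⟩ : Σ i, Fin (d i)) = s
      rw [show π s.1 ((π s.1)⁻¹ s.2) = s.2 from Equiv.apply_symm_apply (π s.1) s.2]
    rw [this]
    exact AlgEquiv.apply_symm_apply σ _

lemma Sys.split_red (H : Sys d h x t G) {x₀ : k} {θ : (Σ i, Fin (d i)) → k}
    (hθ : ∀ P, aeval (opt x t) P = 0 → eval (opt x₀ θ) P = 0) (i : ι) :
    slc (h i) x₀ = ∏ j, (Polynomial.X - Polynomial.C (θ ⟨i, j⟩)) := by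
  apply Polynomial.funext
  intro c
  have h1 := hθ (∏ j, (C c - X (some ⟨i, j⟩)) - aeval ![C c, X none] (h i)) (by
    rw [map_sub, map_prod, sub_eq_zero]
    have h2 := congrArg (Polynomial.eval (algebraMap k E c)) (H.split i)
    rw [eval_slc, Polynomial.eval_prod] at h2
    have h3 : (aeval (opt x t)).comp (aeval ![C c, X none]) =
        (aeval ![algebraMap k E c, x] : MvPolynomial (Fin 2) k →ₐ[k] E) := by
      apply MvPolynomial.algHom_ext
      intro i; fin_cases i <;> simp
    have h4 := congrArg (fun g => g (h i)) h3
    simp only [AlgHom.comp_apply] at h4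
    rw [h4, h2]
    simp)
  rw [map_sub, map_prod, sub_eq_zero] at h1
  have h3 : (aeval (opt x₀ θ)).comp (aeval ![C c, X none]) =
      (aeval ![c, x₀] : MvPolynomial (Fin 2) k →ₐ[k] k) := by
    apply MvPolynomial.algHom_ext
    intro i; fin_cases i <;> simp
  have h4 := congrArg (fun g => g (h i)) h3
  simp only [AlgHom.comp_apply] at h4
  rw [eval_slc, ← h4]
  refine Eq.trans h1.symm ?_
  simp [Polynomial.eval_prod]

lemma third_root {n : ℕ} (θ : Fin n → k) (a j l : Fin n) (haj : a ≠ j) (hal : a ≠ l) (hjl : j ≠ l)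
    (h1 : θ a = θ j) (h2 : θ l = θ j) :
    (Polynomial.derivative (Polynomial.derivative
      (∏ i, (Polynomial.X - Polynomial.C (θ i))))).eval (θ j) = 0 := by
  classical
  have hd : ∏ i ∈ ({a, j, l} : Finset (Fin n)), (Polynomial.X - Polynomial.C (θ i)) ∣
      ∏ i, (Polynomial.X - Polynomial.C (θ i)) :=
    Finset.prod_dvd_prod_of_subset _ _ _ (Finset.subset_univ _)
  rw [Finset.prod_insert (by simp [haj, hal]), Finset.prod_insert (by simp [hjl]), Finset.prod_singleton,
    h1, h2] at hd
  obtain ⟨R, hR⟩ := hd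
  rw [hR]
  simp [Polynomial.derivative_mul]

set_option maxHeartbeats 1000000 in
lemma Sys.ram_mem (H : Sys d h x t G) {x₀ : k} {θ : (Σ i, Fin (d i)) → k}
    (φ : MvPolynomial (Option (Σ i, Fin (d i))) k →ₐ[k] E) (hφ : φ = aeval (opt x t))
    (χ : φ.range →ₐ[k] k) (hχ : ∀ P, χ (φ.rangeRestrict P) = eval (opt x₀ θ) P)
    (i : ι) (j l : Fin (d i)) (hjl : j ≠ l)
    (he : θ ⟨i, j⟩ = θ ⟨i, l⟩) (hr : eval ![θ ⟨i, j⟩, x₀] (h i) = 0)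
    (hb : eval ![θ ⟨i, j⟩, x₀] (pderiv 0 (h i)) = 0) :
    φ.rangeRestrict (X none - C x₀) ∈ (RingHom.ker χ) ^ 2 := by
  set P : Polynomial k := aeval ![Polynomial.C (θ ⟨i, j⟩), Polynomial.X] (h i) with hP
  have hPe : ∀ {A : Type _} [CommRing A] [Algebra k A] (y : A),
      Polynomial.aeval y P = aeval ![algebraMap k A (θ ⟨i, j⟩), y] (h i) := by
    intro A _ _ y
    have h3 : (Polynomial.aeval y).comp (aeval ![Polynomial.C (θ ⟨i, j⟩), Polynomial.X]) =
        (aeval ![algebraMap k A (θ ⟨i, j⟩), y] : MvPolynomial (Fin 2) k →ₐ[k] A) := by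
      apply MvPolynomial.algHom_ext
      intro i; fin_cases i <;> simp
    exact congrArg (fun g => g (h i)) h3
  have hPe0 : ∀ (Q : MvPolynomial (Fin 2) k) (y : k),
      Polynomial.eval y (aeval ![Polynomial.C (θ ⟨i, j⟩), Polynomial.X] Q) = eval ![θ ⟨i, j⟩, y] Q := by
    intro Q y
    have h3 : (Polynomial.aeval y).comp (aeval ![Polynomial.C (θ ⟨i, j⟩), Polynomial.X]) =
        (aeval ![θ ⟨i, j⟩, y] : MvPolynomial (Fin 2) k →ₐ[k] k) := by
      apply MvPolynomial.algHom_ext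
      intro i; fin_cases i <;> simp
    have := congrArg (fun g => g Q) h3
    rw [← Polynomial.coe_aeval_eq_eval]
    exact this
  have hP0 : P.IsRoot x₀ := by
    rw [Polynomial.IsRoot, hP, hPe0]; exact hr
  have hP1 : (Polynomial.derivative P).eval x₀ = eval ![θ ⟨i, j⟩, x₀] (pderiv 1 (h i)) := by
    rw [← hPe0]
    have := deriv_aeval (Polynomial.derivative' (R := k)) ![Polynomial.C (θ ⟨i, j⟩), Polynomial.X] (h i)
    rw [Fin.sum_univ_two] at this
    simp at this
    rw [hP, this]
  obtain ⟨U, hU⟩ := Polynomial.dvd_iff_isRoot.2 hP0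
  have hUx : U.eval x₀ ≠ 0 := by
    have h1 : (Polynomial.derivative P).eval x₀ = U.eval x₀ := by
      rw [hU]; simp [Polynomial.derivative_mul]
    rw [← h1, hP1]
    exact ((H.smp.crv i).smooth _ hr).resolve_left (fun h => h hb)
  have hx0 : χ (φ.rangeRestrict (X none)) = x₀ := by rw [hχ]; simp
  refine mem_sq_of χ _ (Polynomial.aeval (φ.rangeRestrict (X none)) U) ?_ ?_ ?_
  · rw [hχ]; simp
  · rw [← Polynomial.aeval_algHom_apply, hx0]
    simpa using hUx
  · have h1 : φ.rangeRestrict (X none - C x₀) *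
        (Polynomial.aeval (φ.rangeRestrict (X none)) U) =
        ∏ a, φ.rangeRestrict (C (θ ⟨i, j⟩) - X (some ⟨i, a⟩)) := by
      have h2 : φ.rangeRestrict (X none - C x₀) *
        (Polynomial.aeval (φ.rangeRestrict (X none)) U) =
        Polynomial.aeval (φ.rangeRestrict (X none)) P := by
        rw [hU, map_mul, map_sub, map_sub, Polynomial.aeval_X, Polynomial.aeval_C, algHom_C]
      rw [h2]
      apply Subtype.ext
      rw [SubmonoidClass.coe_finsetProd]
      have h3 : ((Polynomial.aeval (φ.rangeRestrict (X none)) P :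
          φ.range) : E) =
          Polynomial.aeval x P := by
        have := (Polynomial.aeval_algHom_apply φ.range.val
          (φ.rangeRestrict (X none)) P).symm
        refine this.trans ?_
        congr 2
        change φ (X none) = x
        simp [hφ]
      rw [h3, hPe, ← eval_slc, H.split, Polynomial.eval_prod]
      refine Finset.prod_congr rfl fun a _ => ?_
      change _ = φ (C (θ ⟨i, j⟩) - X (some ⟨i, a⟩))
      simp [hφ]
    rw [h1, ← Finset.mul_prod_erase _ _ (Finset.mem_univ j),
      ← Finset.mul_prod_erase _ _ (show l ∈ Finset.univ.erase j by simp [hjl.symm]), ← mul_assoc, pow_two]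
    refine Ideal.mul_mem_right _ _ (Ideal.mul_mem_mul ?_ ?_)
    · rw [RingHom.mem_ker, hχ]; simp
    · rw [RingHom.mem_ker, hχ]; simp [he]

lemma Sys.swap [Finite ι] [Finite G] [DecidableEq ι] (H : Sys d h x t G) {x₀ : k} {θ : (Σ i, Fin (d i)) → k}
    (hθ : ∀ P, aeval (opt x t) P = 0 → eval (opt x₀ θ) P = 0) (i : ι) (j l : Fin (d i)) (hjl : j ≠ l)
    (he : θ ⟨i, j⟩ = θ ⟨i, l⟩) : Pi.mulSingle i (Equiv.swap j l) ∈ H.rel := by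
  obtain ⟨χ, hχ⟩ := exists_chi x t x₀ θ hθ
  have hsp := H.split_red hθ
  have hroot : ∀ i a, eval ![θ ⟨i, a⟩, x₀] (h i) = 0 := fun i a => root_of_split (hsp i) a
  have hdbl : ∀ i a b, a ≠ b → θ ⟨i, a⟩ = θ ⟨i, b⟩ → eval ![θ ⟨i, a⟩, x₀] (pderiv 0 (h i)) = 0 := by
    intro i a b hab hb
    have := eval_fT_prod (hsp i) a
    refine this.trans (Finset.prod_eq_zero (i := b) (by simp [hab.symm]) ?_)
    simp [hb]
  have hmem := H.ram_mem _ rfl χ hχ i j l hjl he (hroot i j) (hdbl i j l hjl he)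
  obtain ⟨π, ⟨σ, hσ, hσ1, hσ'⟩, hπ⟩ := H.inertia x₀ _ rfl χ (by rw [hχ]; simp) hmem
  have hπ' : ∀ s, θ (sgm π s) = θ s := by
    intro s
    have := hπ s
    rw [hχ, hχ] at this
    simpa using this
  have hmv : ∀ i' a, π i' a ≠ a → i' = i ∧ θ ⟨i', a⟩ = θ ⟨i, j⟩ := by
    intro i' a ha
    have h1 : θ ⟨i', π i' a⟩ = θ ⟨i', a⟩ := hπ' ⟨i', a⟩
    exact H.smp.uniq _ _ _ _ _ (hroot i' a) (hdbl i' a _ ha.symm h1.symm) (hroot i j) (hdbl i j l hjl he)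
  have hfib : ∀ a, θ ⟨i, a⟩ = θ ⟨i, j⟩ → a = j ∨ a = l := by
    intro a ha
    by_contra hcon
    push Not at hcon
    apply H.smp.nd i _ _ (hroot i j) (hdbl i j l hjl he)
    have h3 := third_root (fun a => θ ⟨i, a⟩) a j l hcon.1 hcon.2 hjl ha he.symm
    rw [← hsp i, derivative_slc, derivative_slc, eval_slc] at h3
    exact h3
  have hπj : π i j = l := by
    have h1 : θ ⟨i, π i j⟩ = θ ⟨i, j⟩ := hπ' ⟨i, j⟩
    have h1l : θ ⟨i, π i l⟩ = θ ⟨i, l⟩ := hπ' ⟨i, l⟩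
    rcases hfib _ h1 with h2 | h2
    · exfalso
      have h3 : π i l = l := by
        rcases hfib _ (h1l.trans he.symm) with h4 | h4
        · exact absurd ((π i).injective (h4.trans h2.symm)) hjl.symm
        · exact h4
      apply hσ1
      apply H.gen σ hσ
      rintro ⟨i', a⟩
      rw [hσ']
      congr 1
      by_contra hne
      have hne' : π i' a ≠ a := fun h => hne (by simp [sgm, h])
      obtain ⟨rfl, h5⟩ := hmv i' a hne'
      rcases hfib a h5 with rfl | rfl
      · exact hne' h2
      · exact hne' h3
    · exact h2
  have hπl : π i l = j := by
    have h1l : θ ⟨i, π i l⟩ = θ ⟨i, l⟩ := hπ' ⟨i, l⟩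
    rcases hfib _ (h1l.trans he.symm) with h4 | h4
    · exact h4
    · exact absurd ((π i).injective (hπj.trans h4.symm)) hjl
  have hfin : Pi.mulSingle i (Equiv.swap j l) = π := by
    funext i'
    by_cases hi : i' = i
    · subst hi
      rw [Pi.mulSingle_eq_same]
      ext1 a
      by_cases haj : a = j
      · rw [haj, Equiv.swap_apply_left, hπj]
      by_cases hal : a = l
      · rw [hal, Equiv.swap_apply_right, hπl]
      rw [Equiv.swap_apply_of_ne_of_ne haj hal]
      by_contra hne
      rcases hfib a (hmv i' a (fun h => hne h.symm)).2 with h | h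
      · exact haj h
      · exact hal h
    · rw [Pi.mulSingle_eq_of_ne hi]
      ext1 a
      by_contra hne
      exact hi (hmv i' a (fun h => hne (by simp [h]))).1
  rw [hfin]
  exact ⟨σ, hσ, hσ'⟩

lemma Sys.swap_all [Finite ι] [Finite G] [DecidableEq ι] (H : Sys d h x t G) (i : ι) (j l : Fin (d i)) :
    Pi.mulSingle i (Equiv.swap j l) ∈ H.rel := by
  classical
  set R : Finset (Fin (d i) × Fin (d i)) := Finset.univ.filter fun p => p.1 ≠ p.2 ∧
    Pi.mulSingle i (Equiv.swap p.1 p.2) ∉ H.rel with hR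
  by_cases hjl : j = l
  · rw [hjl, Equiv.swap_self]
    have : (Equiv.refl (Fin (d i))) = 1 := rfl
    rw [this, Pi.mulSingle_one]
    exact H.rel.one_mem
  by_contra hno
  have hmemR : (j, l) ∈ R := by simp [hR, hjl, hno]
  set w : MvPolynomial (Option (Σ i, Fin (d i))) k :=
    ∏ p ∈ R, (X (some ⟨i, p.1⟩) - X (some ⟨i, p.2⟩)) with hw
  have hwE : aeval (opt x t) w = ∏ p ∈ R, (t ⟨i, p.1⟩ - t ⟨i, p.2⟩) := by
    rw [hw, map_prod]; simp
  obtain ⟨P, hP⟩ := H.inv (aeval (opt x t) w) (by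
    intro σ hσ
    obtain ⟨π, hπ⟩ := H.perm σ hσ
    have hrel : π ∈ H.rel := ⟨σ, hσ, fun s => hπ s.1 s.2⟩
    rw [hwE, map_prod]
    refine Finset.prod_bij (fun p _ => (π i p.1, π i p.2)) ?_ ?_ ?_ ?_
    · intro p hp
      simp only [hR, Finset.mem_filter, Finset.mem_univ, true_and] at hp ⊢
      refine ⟨fun h => hp.1 ((π i).injective h), fun h => hp.2 ?_⟩
      have h1 := H.rel.mul_mem (H.rel.mul_mem (H.rel.inv_mem hrel) h) hrel
      convert h1 using 1
      funext i'
      by_cases hi : i' = i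
      · subst hi
        simp only [Pi.mul_apply, Pi.inv_apply, Pi.mulSingle_eq_same]
        rw [Equiv.swap_apply_apply]
        group
      · simp [Pi.mulSingle_eq_of_ne hi]
    · intro p _ p' _ hpp
      simp only [Prod.mk.injEq] at hpp
      exact Prod.ext ((π i).injective hpp.1) ((π i).injective hpp.2)
    · intro p hp
      simp only [hR, Finset.mem_filter, Finset.mem_univ, true_and] at hp
      refine ⟨((π i)⁻¹ p.1, (π i)⁻¹ p.2), ?_, by simp⟩
      simp only [hR, Finset.mem_filter, Finset.mem_univ, true_and]
      refine ⟨fun h => hp.1 ((π i)⁻¹.injective h), fun h => hp.2 ?_⟩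
      have h1 := H.rel.mul_mem (H.rel.mul_mem hrel h) (H.rel.inv_mem hrel)
      convert h1 using 1
      funext i'
      by_cases hi : i' = i
      · subst hi
        simp only [Pi.mul_apply, Pi.inv_apply, Pi.mulSingle_eq_same]
        rw [Equiv.swap_apply_apply]
        group
      · simp [Pi.mulSingle_eq_of_ne hi]
    · intro p _
      rw [map_sub, hπ, hπ]) (H.integral w)
  have hdeg : P.natDegree = 0 := by
    by_contra hne
    obtain ⟨x₀, hx₀⟩ := IsAlgClosed.exists_root P (by
      intro h; exact hne (Polynomial.natDegree_eq_of_degree_eq_some h))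
    obtain ⟨θ, hθ⟩ := H.exists_point x₀
    have h1 := hθ (w - Polynomial.aeval (X none) P) (by
      rw [map_sub, ← Polynomial.aeval_algHom_apply, aeval_X, opt_none, hP, sub_self])
    have h2 : eval (opt x₀ θ) (Polynomial.aeval (X none) P) = P.eval x₀ := by
      have := (Polynomial.aeval_algHom_apply (aeval (opt x₀ θ)) (X none) P).symm
      refine this.trans ?_
      rw [aeval_X, opt_none]; simp
    rw [map_sub, h2, hx₀, sub_zero, hw, map_prod, Finset.prod_eq_zero_iff] at h1
    obtain ⟨p, hp, hp0⟩ := h1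
    simp only [hR, Finset.mem_filter, Finset.mem_univ, true_and] at hp
    simp only [map_sub, eval_X, opt_some, sub_eq_zero] at hp0
    exact hp.2 (H.swap hθ i p.1 p.2 hp.1 hp0)
  obtain ⟨V, hV, hx⟩ := exists_place x H.not_const
  rw [Polynomial.eq_C_of_natDegree_eq_zero hdeg, Polynomial.aeval_C, hwE] at hP
  have h3 := val_const_le hV (P.coeff 0)
  rw [hP, map_prod, Finset.prod_congr rfl (g := fun _ => V.valuation x), Finset.prod_const] at h3
  · have : (R.card) ≠ 0 := Finset.card_ne_zero_of_mem hmemR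
    exact absurd h3 (not_le.2 (one_lt_pow₀ hx this))
  · intro p hp
    simp only [hR, Finset.mem_filter, Finset.mem_univ, true_and] at hp
    exact val_diff hV hx (H.smp.crv i) (H.split i) p.1 p.2 (fun h => hp.1 h.symm)

lemma Sys.full [Finite ι] [Finite G] (H : Sys d h x t G) (π : ∀ i, Equiv.Perm (Fin (d i))) :
    ∃ σ ∈ G, ∀ s, σ (t s) = t (sgm π s) := by
  classical
  have : π ∈ H.rel := by
    refine Subgroup.pi_mem_of_mulSingle_mem _ fun i => ?_
    induction π i using Equiv.Perm.swap_induction_on with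
    | one => rw [Pi.mulSingle_one]; exact H.rel.one_mem
    | swap_mul f a b hab ih =>
      rw [Pi.mulSingle_mul]
      exact H.rel.mul_mem (H.swap_all i a b) ih
  exact this

end Full

section ExSys

universe u
variable {k : Type u} [Field k]

lemma exists_split_of {L : Type*} [Field L] [Algebra k L] {f : MvPolynomial (Fin 2) k} {d : ℕ} (hd : 0 < d)
    (hdeg : f.totalDegree ≤ d) (hm : coeff (Finsupp.single 0 d) f = 1) (x : L)
    (hs : (slc f x).Splits) :
    ∃ t : Fin d → L, slc f x = ∏ j, (Polynomial.X - Polynomial.C (t j)) := by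
  have hmon := slc_monic f d hd hdeg hm x
  have h1 := hs.eq_prod_roots_of_monic hmon
  have h2 : (slc f x).roots.card = d := by
    rw [← slc_natDegree f d hd hdeg hm x]
    exact (Polynomial.splits_iff_card_roots.1 hs)
  obtain ⟨l, hl⟩ := Quot.exists_rep (slc f x).roots
  change (l : Multiset L) = _ at hl
  rw [← hl] at h1 h2
  simp only [Multiset.coe_card] at h2
  subst h2
  refine ⟨fun j => l.get j, ?_⟩
  rw [h1]
  simp only [Multiset.map_coe, Multiset.prod_coe]
  conv_lhs => rw [← List.ofFn_get l, List.map_ofFn, List.prod_ofFn]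
  rfl

/-- a formal point -/
def IsPt {ι : Type*} {d : ι → ℕ} (h : ι → MvPolynomial (Fin 2) k) (a : k)
    (τ : (Σ i, Fin (d i)) → PowerSeries k) : Prop :=
  ∀ i, slc (h i) (sx a) = ∏ j, (Polynomial.X - Polynomial.C (τ ⟨i, j⟩))

variable [IsAlgClosed k] {ι : Type*} {d : ι → ℕ} {h : ι → MvPolynomial (Fin 2) k}

lemma exists_sys [Fintype ι] (hS : Smp d h) :
    ∃ (E : Type u) (_ : Field E) (_ : Algebra k E) (x : E) (t : (Σ i, Fin (d i)) → E)
      (G : Subgroup (E ≃ₐ[k] E)), Finite G ∧ Sys d h x t G ∧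
      ∀ (a : k) (τ : (Σ i, Fin (d i)) → PowerSeries k), IsPt h a τ →
        ∃ ψ : E →ₐ[k] FractionRing (PowerSeries k), ψ x = algebraMap _ _ (sx a) := by
  classical
  let F := RatFunc k
  let P0 : Polynomial F := ∏ i, slc (h i) (RatFunc.X : F)
  let E := P0.SplittingField
  have hd : ∀ i, 0 < d i := fun i => by have := (hS.crv i).two_le; omega
  have hmon : ∀ i, (slc (h i) (RatFunc.X : F)).Monic := fun i =>
    slc_monic (h i) (d i) (hd i) (hS.crv i).deg (hS.crv i).monic _
  have hP0 : P0 ≠ 0 := (Polynomial.monic_prod_of_monic _ _ fun i _ => hmon i).ne_zero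
  let x : E := algebraMap F E RatFunc.X
  have hmapx : ∀ i, (slc (h i) (RatFunc.X : F)).map (algebraMap F E) = slc (h i) x := by
    intro i
    exact map_slc (IsScalarTower.toAlgHom k F E) (h i) RatFunc.X
  have hspl : ∀ i, (slc (h i) x).Splits := by
    intro i
    have h1 := Polynomial.IsSplittingField.splits E P0
    rw [← hmapx]
    refine h1.of_dvd (Polynomial.map_ne_zero hP0) ?_
    exact Polynomial.map_dvd _ (Finset.dvd_prod_of_mem _ (Finset.mem_univ i))
  have ht := fun i => exists_split_of (hd i) (hS.crv i).deg (hS.crv i).monic x (hspl i)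
  choose t' ht' using ht
  let t : (Σ i, Fin (d i)) → E := fun s => t' s.1 s.2
  have htrans : Function.Injective (Polynomial.aeval x : Polynomial k →ₐ[k] E) := by
    have h1 : (Polynomial.aeval x : Polynomial k →ₐ[k] E) =
        (IsScalarTower.toAlgHom k F E).comp (IsScalarTower.toAlgHom k (Polynomial k) F) := by
      apply Polynomial.algHom_ext
      simp [x]
      exact RatFunc.algebraMap_X.symm
    rw [h1]
    exact (algebraMap F E).injective.comp (RatFunc.algebraMap_injective k)
  have hnc : ∀ c : k, algebraMap k E c ≠ x := by
    intro c hc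
    have h1 : (Polynomial.X - Polynomial.C c : Polynomial k) = 0 := htrans (by simp [hc])
    exact Polynomial.X_sub_C_ne_zero c h1
  have hinj : ∀ i, Function.Injective (t' i) := by
    intro i j l hjl
    by_contra hne
    obtain ⟨V, hV, hx⟩ := exists_place x hnc
    have := val_diff hV hx (hS.crv i) (ht' i) j l (fun h => hne h.symm)
    rw [hjl, sub_self, map_zero] at this
    rw [← this] at hx
    exact absurd hx (by simp)
  have hroots : P0.rootSet E ⊆ Set.range t := by
    intro b hb
    rw [Polynomial.mem_rootSet] at hb
    have h2 := hb.2
    rw [← Polynomial.eval_map_algebraMap, Polynomial.map_prod, Polynomial.eval_prod, Finset.prod_eq_zero_iff] at h2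
    obtain ⟨i, _, hi⟩ := h2
    rw [hmapx, ht' i, Polynomial.eval_prod, Finset.prod_eq_zero_iff] at hi
    obtain ⟨j, _, hj⟩ := hi
    exact ⟨⟨i, j⟩, by simpa [sub_eq_zero, eq_comm] using hj⟩
  have hadj : Algebra.adjoin F (Set.range t) = ⊤ := by
    rw [eq_top_iff, ← Polynomial.IsSplittingField.adjoin_rootSet E P0]
    exact Algebra.adjoin_mono hroots
  have hnorm : Normal F E := Normal.of_isSplittingField P0
  have hfd : FiniteDimensional F E := Polynomial.IsSplittingField.finiteDimensional E P0
  have hsep : Algebra.IsSeparable F E := by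
    have h1 : Algebra.IsSeparable F (IntermediateField.adjoin F (Set.range t)) := by
      rw [IntermediateField.isSeparable_adjoin_iff_isSeparable]
      rintro _ ⟨⟨i, j⟩, rfl⟩
      have h3 : (slc (h i) (RatFunc.X : F)).Separable := by
        rw [← Polynomial.separable_map (algebraMap F E), hmapx, ht',
          Polynomial.separable_prod_X_sub_C_iff]
        exact hinj i
      refine h3.of_dvd (minpoly.dvd _ _ ?_)
      rw [← Polynomial.eval_map_algebraMap, hmapx, ht', Polynomial.eval_prod]
      exact Finset.prod_eq_zero (Finset.mem_univ j) (by simp [t])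
    have h2 : IntermediateField.adjoin F (Set.range t) = ⊤ := by
      rw [eq_top_iff]
      intro b _
      have : b ∈ Algebra.adjoin F (Set.range t) := by rw [hadj]; trivial
      exact IntermediateField.algebra_adjoin_le_adjoin F _ this
    rw [h2] at h1
    exact (AlgEquiv.Algebra.isSeparable_iff IntermediateField.topEquiv).1 h1
  have hgal : IsGalois F E := {}
  let G : Subgroup (E ≃ₐ[k] E) := (AlgEquiv.restrictScalarsHom k : (E ≃ₐ[F] E) →* (E ≃ₐ[k] E)).range
  refine ⟨E, inferInstance, inferInstance, x, t, G, ?_, ?_, ?_⟩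
  · have : Finite (E ≃ₐ[F] E) := inferInstance
    exact Set.finite_range _
  · refine ⟨hS, ht', htrans, ?_, ?_, ?_⟩
    · rintro _ ⟨σ, rfl⟩
      exact σ.commutes _
    · rintro _ ⟨σ, rfl⟩ hσ
      have h1 : (σ : E →ₐ[F] E) = AlgHom.id F E := by
        apply AlgHom.ext_of_adjoin_eq_top hadj
        rintro _ ⟨s, rfl⟩
        exact hσ s
      ext b
      exact congrArg (fun g => g b) h1
    · intro b hb hInt
      obtain ⟨c, hc⟩ := (IsGalois.mem_range_algebraMap_iff_fixed (F := F) b).2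
        (fun σ => hb _ ⟨σ, rfl⟩)
      have h1 : IsIntegral (Polynomial k) c := by
        obtain ⟨Q, hQ, hQ0⟩ := hInt
        refine ⟨Q, hQ, ?_⟩
        apply (algebraMap F E).injective
        rw [map_zero, ← hQ0, Polynomial.hom_eval₂, hc]
        congr 1
        apply Polynomial.ringHom_ext
        · intro c; simp; rfl
        · simp [x]
          exact RatFunc.algebraMap_X
      obtain ⟨P, hP⟩ := IsIntegrallyClosed.isIntegral_iff.1 h1
      refine ⟨P, ?_⟩
      rw [← hc, ← hP]
      have h1 : (Polynomial.aeval x : Polynomial k →ₐ[k] E) =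
          (IsScalarTower.toAlgHom k F E).comp (IsScalarTower.toAlgHom k (Polynomial k) F) := by
        apply Polynomial.algHom_ext
        simp [x]
        exact RatFunc.algebraMap_X.symm
      rw [h1]; rfl
  · intro a τ hτ
    let L := FractionRing (PowerSeries k)
    let g0 : Polynomial k →ₐ[k] L :=
      (IsScalarTower.toAlgHom k (PowerSeries k) L).comp (Polynomial.aeval (sx a))
    have hg0 : Function.Injective g0 :=
      (IsFractionRing.injective (PowerSeries k) L).comp (sx_inj a)
    let g : F →ₐ[k] L := RatFunc.liftAlgHom g0 (nonZeroDivisors_le_comap_nonZeroDivisors_of_injective _ hg0)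
    have hgX : g RatFunc.X = algebraMap _ L (sx a) := by
      have := RatFunc.liftAlgHom_apply_div g0 (nonZeroDivisors_le_comap_nonZeroDivisors_of_injective _ hg0) Polynomial.X 1
      simp only [map_one, div_one] at this
      rw [RatFunc.algebraMap_X] at this
      refine this.trans ?_
      simp [g0]
    letI : Algebra F L := g.toRingHom.toAlgebra
    have : IsScalarTower k F L := IsScalarTower.of_algebraMap_eq (fun c => (g.commutes c).symm)
    have hs : (P0.map (algebraMap F L)).Splits := by
      rw [Polynomial.map_prod]
      refine Polynomial.Splits.prod fun i _ => ?_
      have h1 : (slc (h i) (RatFunc.X : F)).map (algebraMap F L) = slc (h i) (algebraMap _ L (sx a)) := by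
        rw [← hgX]
        exact map_slc g (h i) RatFunc.X
      have h2 := map_slc (IsScalarTower.toAlgHom k (PowerSeries k) L) (h i) (sx a)
      rw [h1]
      have h3 : slc (h i) (algebraMap _ L (sx a)) = (slc (h i) (sx a)).map (algebraMap _ L) := h2.symm
      rw [h3, hτ i, Polynomial.map_prod]
      refine Polynomial.Splits.prod fun j _ => ?_
      simp only [Polynomial.map_sub, Polynomial.map_X, Polynomial.map_C]
      exact Polynomial.Splits.X_sub_C _
    let ψ : E →ₐ[F] L := Polynomial.IsSplittingField.lift E P0 hs
    refine ⟨ψ.restrictScalars k, ?_⟩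
    rw [← hgX]
    exact ψ.commutes _

end ExSys

section Geo

universe u
variable {k : Type u} [Field k] {ι : Type*} [Fintype ι] [DecidableEq ι] {d : ι → ℕ}
  {h : ι → MvPolynomial (Fin 2) k} {E : Type*} [Field E] [Algebra k E]

/-- geometric input for the point count -/
structure Geo (d : ι → ℕ) (h : ι → MvPolynomial (Fin 2) k)
    (φ : MvPolynomial (Option (Σ i, Fin (d i))) k →ₐ[k] E) : Prop where
  ker : ∀ (a : k) (τ : (Σ i, Fin (d i)) → PowerSeries k), IsPt h a τ →
    ∀ P, φ P = 0 ↔ aeval (opt (sx a) τ) P = 0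
  norm : ∀ P (D : ℕ), P.totalDegree ≤ D → φ P ≠ 0 → ∃ N : Polynomial k, N ≠ 0 ∧
    N.natDegree ≤ Fintype.card (∀ i, Equiv.Perm (Fin (d i))) * D ∧
    ∀ (a : k) (τ : (Σ i, Fin (d i)) → PowerSeries k), IsPt h a τ →
      Polynomial.aeval (sx a) N = ∏ π : ∀ i, Equiv.Perm (Fin (d i)),
        aeval (opt (sx a) τ) (rename (Option.map (sgm π)) P)
  fam : ∀ D : ℕ, ∃ g : (∀ i, Equiv.Perm (Fin (d i))) ×
      Fin (D + 2 - Fintype.card (∀ i, Equiv.Perm (Fin (d i)))) →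
      MvPolynomial (Option (Σ i, Fin (d i))) k,
    (∀ b, (g b).totalDegree ≤ D) ∧ LinearIndependent k (fun b => φ (g b))

lemma ren_mul (π ρ : ∀ i, Equiv.Perm (Fin (d i))) (P : MvPolynomial (Option (Σ i, Fin (d i))) k) :
    rename (Option.map (sgm π)) (rename (Option.map (sgm ρ)) P) = rename (Option.map (sgm (π * ρ))) P := by
  rw [rename_rename]
  congr 2
  funext o
  cases o <;> rfl

lemma ren_one (P : MvPolynomial (Option (Σ i, Fin (d i))) k) :
    rename (Option.map (sgm (1 : ∀ i, Equiv.Perm (Fin (d i))))) P = P := by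
  convert rename_id_apply P using 3
  funext o
  cases o <;> rfl

variable [IsAlgClosed k] {x : E} {t : (Σ i, Fin (d i)) → E} {G : Subgroup (E ≃ₐ[k] E)}

lemma Sys.ren_zero [Finite G] (H : Sys d h x t G) (π : ∀ i, Equiv.Perm (Fin (d i)))
    (P : MvPolynomial (Option (Σ i, Fin (d i))) k) :
    aeval (opt x t) (rename (Option.map (sgm π)) P) = 0 ↔ aeval (opt x t) P = 0 := by
  obtain ⟨σ, hσ, hσ'⟩ := H.full π
  rw [← aeval_rename_opt (σ := (σ : E →ₐ[k] E)) (H.fix _ hσ) _ hσ' P]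
  exact map_eq_zero_iff _ σ.injective

lemma Sys.ker [Finite G] (H : Sys d h x t G) (a : k) (τ : (Σ i, Fin (d i)) → PowerSeries k) (hτ : IsPt h a τ)
    (ψ : E →ₐ[k] FractionRing (PowerSeries k)) (hψ : ψ x = algebraMap _ _ (sx a))
    (P : MvPolynomial (Option (Σ i, Fin (d i))) k) :
    aeval (opt x t) P = 0 ↔ aeval (opt (sx a) τ) P = 0 := by
  set L := FractionRing (PowerSeries k)
  let ι0 : PowerSeries k →ₐ[k] L := IsScalarTower.toAlgHom k (PowerSeries k) L
  have hι0 : Function.Injective ι0 := IsFractionRing.injective (PowerSeries k) L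
  have hψ' : ψ x = ι0 (sx a) := hψ
  have h1 : ∀ i j, ∃ l, ψ (t ⟨i, j⟩) = ι0 (τ ⟨i, l⟩) := by
    intro i j
    have h2 : (slc (h i) (ι0 (sx a))).eval (ψ (t ⟨i, j⟩)) = 0 := by
      rw [← hψ', ← map_slc ψ, H.split i, Polynomial.map_prod, Polynomial.eval_prod]
      exact Finset.prod_eq_zero (Finset.mem_univ j) (by simp)
    rw [← map_slc ι0, hτ i, Polynomial.map_prod, Polynomial.eval_prod, Finset.prod_eq_zero_iff] at h2
    obtain ⟨l, _, hl⟩ := h2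
    exact ⟨l, by simpa [sub_eq_zero] using hl⟩
  choose ρ hρ using h1
  have hinj : ∀ i, Function.Injective (ρ i) := by
    intro i j l hjl
    by_contra hne
    apply H.ne i j l (fun h => hne h.symm)
    apply (show Function.Injective ψ from ψ.injective)
    rw [hρ, hρ, hjl]
  let π : ∀ i, Equiv.Perm (Fin (d i)) := fun i =>
    Equiv.ofBijective (ρ i) (Finite.injective_iff_bijective.1 (hinj i))
  have key : ψ.comp (aeval (opt x t)) = (ι0.comp (aeval (opt (sx a) τ))).comp
      (rename (Option.map (sgm π))) := by
    apply MvPolynomial.algHom_ext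
    intro o
    cases o with
    | none => simp [hψ']
    | some s =>
      simp only [AlgHom.comp_apply, aeval_X, rename_X, Option.map_some, opt_some]
      exact hρ s.1 s.2
  have h3 := congrArg (fun g => g (rename (Option.map (sgm π⁻¹)) P)) key
  simp only [AlgHom.comp_apply, ren_mul, mul_inv_cancel, ren_one] at h3
  rw [← H.ren_zero π⁻¹, ← map_eq_zero_iff ψ (show Function.Injective ψ from ψ.injective), h3, map_eq_zero_iff _ hι0]

lemma Sys.norm [Finite G] (H : Sys d h x t G)
    (hker : ∀ (a : k) (τ : (Σ i, Fin (d i)) → PowerSeries k), IsPt h a τ →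
    ∀ P : MvPolynomial (Option (Σ i, Fin (d i))) k, aeval (opt x t) P = 0 ↔ aeval (opt (sx a) τ) P = 0)
    (P : MvPolynomial (Option (Σ i, Fin (d i))) k) (D : ℕ) (hD : P.totalDegree ≤ D)
    (hP : aeval (opt x t) P ≠ 0) : ∃ N : Polynomial k, N ≠ 0 ∧
    N.natDegree ≤ Fintype.card (∀ i, Equiv.Perm (Fin (d i))) * D ∧
    ∀ (a : k) (τ : (Σ i, Fin (d i)) → PowerSeries k), IsPt h a τ →
      Polynomial.aeval (sx a) N = ∏ π : ∀ i, Equiv.Perm (Fin (d i)),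
        aeval (opt (sx a) τ) (rename (Option.map (sgm π)) P) := by
  set R : MvPolynomial (Option (Σ i, Fin (d i))) k := ∏ π : ∀ i, Equiv.Perm (Fin (d i)),
    rename (Option.map (sgm π)) P with hR
  obtain ⟨N, hN⟩ := H.inv (aeval (opt x t) R) (by
    intro σ hσ
    obtain ⟨π, hπ⟩ := H.perm σ hσ
    have h1 : ∀ Q, σ (aeval (opt x t) Q) = _ :=
      aeval_rename_opt (σ := (σ : E →ₐ[k] E)) (H.fix _ hσ) (sgm π) (fun s => hπ s.1 s.2)
    rw [h1, hR, map_prod]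
    congr 1
    simp only [ren_mul]
    exact Fintype.prod_equiv (Equiv.mulLeft π) _ _ (fun ρ => rfl)) (H.integral R)
  have hR0 : aeval (opt x t) R ≠ 0 := by
    rw [hR, map_prod, Finset.prod_ne_zero_iff]
    intro π _
    rwa [Ne, H.ren_zero]
  refine ⟨N, ?_, ?_, ?_⟩
  · rintro rfl
    exact hR0 (by rw [← hN, map_zero])
  · obtain ⟨V, hV, hx⟩ := exists_place x H.not_const
    apply natDegree_le_of_val hV x hx N
    rw [hN]
    refine (val_aeval_le hV _ (V.valuation x) hx.le ?_ R
      (Fintype.card (∀ i, Equiv.Perm (Fin (d i))) * D) ?_)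
    · intro o
      cases o with
      | none => exact le_rfl
      | some s =>
        exact val_root_le hV hx (by have := (H.smp.crv s.1).two_le; omega) (H.smp.crv s.1).deg
          (H.smp.crv s.1).monic (H.root s)
    · refine (totalDegree_finsetProd _ _).trans ?_
      refine (Finset.sum_le_card_nsmul _ _ D ?_).trans (by simp)
      intro π _
      exact (totalDegree_rename_le _ _).trans hD
  · intro a τ hτ
    have h1 := (hker a τ hτ (R - Polynomial.aeval (X none) N)).1 (by
      rw [map_sub, ← Polynomial.aeval_algHom_apply, aeval_X, opt_none, hN, sub_self])
    rw [map_sub, ← Polynomial.aeval_algHom_apply, aeval_X, opt_none, sub_eq_zero] at h1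
    rw [← h1, hR, map_prod]

lemma Sys.prim (H : Sys d h x t G) : ∃ c : (Σ i, Fin (d i)) → k,
    Function.Injective (fun π : ∀ i, Equiv.Perm (Fin (d i)) => ∑ s, c s • t (sgm π s)) := by
  let I := {p : (∀ i, Equiv.Perm (Fin (d i))) × (∀ i, Equiv.Perm (Fin (d i))) // p.1 ≠ p.2}
  let W : I → Submodule k ((Σ i, Fin (d i)) → k) := fun p =>
    LinearMap.ker (∑ s, (LinearMap.toSpanSingleton k E (t (sgm p.1.1 s) - t (sgm p.1.2 s))).comp
      (LinearMap.proj s))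
  have hW : ∀ p c, c ∈ W p ↔ ∑ s, c s • t (sgm p.1.1 s) = ∑ s, c s • t (sgm p.1.2 s) := by
    intro p c
    rw [← sub_eq_zero, ← Finset.sum_sub_distrib]
    simp [W, smul_sub]
  by_contra hcon
  push Not at hcon
  obtain ⟨⟨p, hp⟩, htop⟩ := Subspace.exists_eq_top_of_iUnion_eq_univ (p := W) (Set.eq_univ_of_forall fun c => by
    have := hcon c
    rw [Function.not_injective_iff] at this
    obtain ⟨π, ρ, h1, h2⟩ := this
    exact Set.mem_iUnion.2 ⟨⟨(π, ρ), h2⟩, (hW _ _).2 h1⟩)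
  apply hp
  funext i
  ext1 j
  by_contra hne
  have h1 : Pi.single ⟨i, j⟩ 1 ∈ W ⟨p, hp⟩ := by rw [htop]; trivial
  rw [hW, Finset.sum_eq_single ⟨i, j⟩, Finset.sum_eq_single ⟨i, j⟩] at h1
  · simp only [Pi.single_eq_same, one_smul] at h1
    exact H.ne i _ _ (fun h => hne h.symm) h1
  all_goals simp +contextual

lemma Sys.fam [Finite G] (H : Sys d h x t G) (D : ℕ) : ∃ g : (∀ i, Equiv.Perm (Fin (d i))) ×
      Fin (D + 2 - Fintype.card (∀ i, Equiv.Perm (Fin (d i)))) →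
      MvPolynomial (Option (Σ i, Fin (d i))) k,
    (∀ b, (g b).totalDegree ≤ D) ∧ LinearIndependent k (fun b => aeval (opt x t) (g b)) := by
  set n := Fintype.card (∀ i, Equiv.Perm (Fin (d i))) with hn
  obtain ⟨c, hc⟩ := H.prim
  have : DecidableEq E := Classical.decEq E
  let e : (∀ i, Equiv.Perm (Fin (d i))) ≃ Fin n := Fintype.equivFin _
  let y : MvPolynomial (Option (Σ i, Fin (d i))) k := ∑ s, c s • X (some s)
  have hy : y.totalDegree ≤ 1 := by
    refine totalDegree_finsetSum_le fun s _ => ?_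
    refine (totalDegree_smul_le _ _).trans ?_
    simp
  refine ⟨fun b => X none ^ (b.2 : ℕ) * y ^ (e b.1 : ℕ), ?_, ?_⟩
  · rintro ⟨π, i⟩
    refine (totalDegree_mul _ _).trans ?_
    have h1 := totalDegree_pow (X none : MvPolynomial (Option (Σ i, Fin (d i))) k) (i : ℕ)
    have h2 := totalDegree_pow y (e π : ℕ)
    have h3 : (e π : ℕ) * y.totalDegree ≤ (e π : ℕ) * 1 := Nat.mul_le_mul_left _ hy
    rw [totalDegree_X] at h1
    have := (e π).2
    have := i.2
    dsimp only
    omega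
  · rw [Fintype.linearIndependent_iff]
    intro w hw
    let C : (∀ i, Equiv.Perm (Fin (d i))) → Polynomial k := fun π => ∑ i, Polynomial.C (w (π, i)) * Polynomial.X ^ (i : ℕ)
    let R : Polynomial E := ∑ π, Polynomial.C (Polynomial.aeval x (C π)) * Polynomial.X ^ (e π : ℕ)
    have hRdeg : R.degree < n := by
      refine (Polynomial.degree_sum_le _ _).trans_lt ?_
      rw [Finset.sup_lt_iff (by exact WithBot.bot_lt_coe n)]
      intro π _
      refine (Polynomial.degree_C_mul_X_pow_le _ _).trans_lt ?_
      exact_mod_cast (e π).2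
    have hR0 : R.eval (aeval (opt x t) y) = 0 := by
      rw [← hw, Fintype.sum_prod_type]
      simp only [R, C, Polynomial.eval_finsetSum, map_sum, Finset.sum_mul, Polynomial.eval_mul,
        Polynomial.eval_C, Polynomial.eval_pow, Polynomial.eval_X, map_mul, map_pow, aeval_X, opt_none,
        Polynomial.aeval_C, Polynomial.aeval_X, Algebra.smul_def, mul_assoc]
    have hRc : ∀ π : ∀ i, Equiv.Perm (Fin (d i)), R.eval (∑ s, c s • t (sgm π s)) = 0 := by
      intro π
      obtain ⟨σ, hσ, hσ'⟩ := H.full π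
      have h1 : σ (aeval (opt x t) y) = ∑ s, c s • t (sgm π s) := by
        simp [y, hσ']
      have h2 : ∀ Q : Polynomial k, σ (Polynomial.aeval x Q) = Polynomial.aeval x Q := by
        intro Q
        have := Polynomial.aeval_algHom_apply (σ : E →ₐ[k] E) x Q
        have h3 : (σ : E →ₐ[k] E) x = x := H.fix _ hσ
        rw [h3] at this
        exact this.symm
      rw [← h1, ← map_zero σ, ← hR0]
      simp only [R, Polynomial.eval_finsetSum, map_sum, Polynomial.eval_mul,
        Polynomial.eval_C, Polynomial.eval_pow, Polynomial.eval_X, map_mul, map_pow, h2]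
    have hR : R = 0 := by
      refine Polynomial.eq_zero_of_degree_lt_of_eval_finset_eq_zero
        (Finset.univ.image fun π : ∀ i, Equiv.Perm (Fin (d i)) => ∑ s, c s • t (sgm π s)) ?_ ?_
      · rw [Finset.card_image_of_injective _ hc, Finset.card_univ, ← hn]
        exact hRdeg
      · intro z hz
        obtain ⟨π, _, rfl⟩ := Finset.mem_image.1 hz
        exact hRc π
    rintro ⟨π, i⟩
    have h1 := congrArg (fun q => Polynomial.coeff q (e π : ℕ)) hR
    simp only [R, Polynomial.finsetSum_coeff, Polynomial.coeff_C_mul_X_pow, Polynomial.coeff_zero] at h1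
    rw [Finset.sum_eq_single π] at h1
    · rw [if_pos rfl] at h1
      have h2 : C π = 0 := H.trans (by rw [h1, map_zero])
      have h3 := congrArg (fun q => Polynomial.coeff q (i : ℕ)) h2
      simp only [C, Polynomial.finsetSum_coeff, Polynomial.coeff_C_mul_X_pow, Polynomial.coeff_zero] at h3
      rw [Finset.sum_eq_single i] at h3
      · simpa using h3
      · intro j _ hj
        rw [if_neg (fun h => hj (Fin.ext h.symm))]
      · simp
    · intro ρ _ hρ
      rw [if_neg (fun h => hρ (e.injective (Fin.ext h.symm)))]
    · simp

lemma exists_geo (hS : Smp d h) : ∃ (E : Type u) (_ : Field E) (_ : Algebra k E)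
    (φ : MvPolynomial (Option (Σ i, Fin (d i))) k →ₐ[k] E), Geo d h φ := by
  obtain ⟨E, _, _, x, t, G, hG, H, hl⟩ := exists_sys hS
  have hker : ∀ (a : k) (τ : (Σ i, Fin (d i)) → PowerSeries k), IsPt h a τ →
      ∀ P : MvPolynomial (Option (Σ i, Fin (d i))) k, aeval (opt x t) P = 0 ↔ aeval (opt (sx a) τ) P = 0 := by
    intro a τ hτ P
    obtain ⟨ψ, hψ⟩ := hl a τ hτ
    exact H.ker a τ hτ ψ hψ P
  exact ⟨E, inferInstance, inferInstance, aeval (opt x t), hker, H.norm hker, H.fam⟩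

end Geo

section Cls

variable {k : Type*} [Field k] {σ Ω : Type*}

/-- families of power series whose coefficients are polynomials up to powers of `Δ` -/
def Cls (pt : Ω → σ → k) (Δ : MvPolynomial σ k) (J e0 e D0 D : ℕ) (g : Ω → PowerSeries k) : Prop :=
  ∀ j < J, ∃ A : MvPolynomial σ k, A.totalDegree ≤ D0 + D * j ∧
    ∀ ω, eval (pt ω) Δ ^ (e0 + e * j) * PowerSeries.coeff j (g ω) = eval (pt ω) A

variable {pt : Ω → σ → k} {Δ : MvPolynomial σ k} {J e0 e D0 D e1 D1 : ℕ} {g g' : Ω → PowerSeries k}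

lemma Cls.add (h1 : Cls pt Δ J e0 e D0 D g) (h2 : Cls pt Δ J e0 e D0 D g') :
    Cls pt Δ J e0 e D0 D (fun ω => g ω + g' ω) := by
  intro j hj
  obtain ⟨A, hA, hA'⟩ := h1 j hj
  obtain ⟨B, hB, hB'⟩ := h2 j hj
  refine ⟨A + B, (totalDegree_add _ _).trans (max_le hA hB), fun ω => ?_⟩
  rw [map_add, map_add, mul_add, hA', hB']

lemma Cls.mul (h1 : Cls pt Δ J e0 e D0 D g) (h2 : Cls pt Δ J e1 e D1 D g') :
    Cls pt Δ J (e0 + e1) e (D0 + D1) D (fun ω => g ω * g' ω) := by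
  classical
  intro j hj
  have h1' : ∀ l, ∃ A : MvPolynomial σ k, l < J → A.totalDegree ≤ D0 + D * l ∧
    ∀ ω, eval (pt ω) Δ ^ (e0 + e * l) * PowerSeries.coeff l (g ω) = eval (pt ω) A := by
    intro l
    by_cases hl : l < J
    · obtain ⟨A, hA⟩ := h1 l hl
      exact ⟨A, fun _ => hA⟩
    · exact ⟨0, fun h => absurd h hl⟩
  have h2' : ∀ l, ∃ A : MvPolynomial σ k, l < J → A.totalDegree ≤ D1 + D * l ∧
    ∀ ω, eval (pt ω) Δ ^ (e1 + e * l) * PowerSeries.coeff l (g' ω) = eval (pt ω) A := by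
    intro l
    by_cases hl : l < J
    · obtain ⟨A, hA⟩ := h2 l hl
      exact ⟨A, fun _ => hA⟩
    · exact ⟨0, fun h => absurd h hl⟩
  choose A hA using h1'
  choose B hB using h2'
  refine ⟨∑ p ∈ Finset.HasAntidiagonal.antidiagonal j, A p.1 * B p.2, ?_, fun ω => ?_⟩
  · refine totalDegree_finsetSum_le fun p hp => ?_
    rw [Finset.HasAntidiagonal.mem_antidiagonal] at hp
    have ha := (hA p.1 (by omega)).1
    have hb := (hB p.2 (by omega)).1
    refine (totalDegree_mul _ _).trans ?_
    rw [← hp]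
    linarith
  · rw [PowerSeries.coeff_mul, Finset.mul_sum, map_sum]
    refine Finset.sum_congr rfl fun p hp => ?_
    rw [Finset.HasAntidiagonal.mem_antidiagonal] at hp
    have ha := (hA p.1 (by omega)).2 ω
    have hb := (hB p.2 (by omega)).2 ω
    rw [map_mul, ← ha, ← hb, ← hp]
    ring

lemma Cls.const (c : k) : Cls pt Δ J 0 e 0 D (fun _ => PowerSeries.C c) := by
  intro j _
  by_cases hj : j = 0
  · refine ⟨C c, by simp, fun ω => by simp [hj]⟩
  · refine ⟨0, by simp, fun ω => by simp [PowerSeries.coeff_C, hj]⟩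

lemma Cls.zero : Cls pt Δ J e0 e D0 D (fun _ => 0) := by
  intro j _
  exact ⟨0, by simp, fun ω => by simp⟩

lemma Cls.pad {δ : ℕ} (hΔ : Δ.totalDegree ≤ δ) (h1 : Cls pt Δ J e0 e D0 D g) (f : ℕ) (D1 : ℕ)
    (hD1 : D0 + f * δ ≤ D1) : Cls pt Δ J (e0 + f) e D1 D g := by
  intro j hj
  obtain ⟨A, hA, hA'⟩ := h1 j hj
  refine ⟨Δ ^ f * A, ?_, fun ω => ?_⟩
  · refine (totalDegree_mul _ _).trans ?_
    have h2 := totalDegree_pow Δ f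
    have h3 := Nat.mul_le_mul_left f hΔ
    omega
  · rw [map_mul, ← hA', map_pow]; ring

lemma Cls.aeval {δ : ℕ} (hΔ : Δ.totalDegree ≤ δ) {S : Type*} (w : Ω → S → PowerSeries k)
    (hw : ∀ s, Cls pt Δ J e0 e D0 D (fun ω => w ω s)) (h0 : e0 * δ ≤ D0) (P : MvPolynomial S k) (H : ℕ)
    (hP : P.totalDegree ≤ H) : Cls pt Δ J (e0 * H) e (D0 * H) D (fun ω => MvPolynomial.aeval (w ω) P) := by
  classical
  have mon : ∀ (s : S →₀ ℕ) (a : k), (monomial s a = (0 : MvPolynomial S k)) ∨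
      Cls pt Δ J (e0 * (monomial s a).totalDegree) e
      (D0 * (monomial s a).totalDegree) D (fun ω => MvPolynomial.aeval (w ω) (monomial s a)) := by
    intro s a
    refine MvPolynomial.induction_on_monomial (motive := fun p => p = 0 ∨ Cls pt Δ J (e0 * p.totalDegree) e
      (D0 * p.totalDegree) D (fun ω => MvPolynomial.aeval (w ω) p)) ?_ ?_ s a
    · intro a
      right
      simpa using (Cls.const a : Cls pt Δ J 0 e 0 D _)
    · intro p n ih
      rcases ih with ih | ih
      · left; rw [ih, zero_mul]
      by_cases hp : p = 0
      · left; rw [hp, zero_mul]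
      right
      rw [totalDegree_mul_of_isDomain hp (X_ne_zero n), totalDegree_X, mul_add, mul_add, mul_one, mul_one]
      simpa using ih.mul (hw n)
  rw [P.as_sum]
  simp only [map_sum]
  have gen : ∀ T ⊆ P.support, Cls pt Δ J (e0 * H) e (D0 * H) D
      (fun ω => ∑ s ∈ T, MvPolynomial.aeval (w ω) (monomial s (coeff s P))) := by
    intro T
    induction T using Finset.induction_on with
    | empty => intro _; simpa using Cls.zero
    | insert s T hs ih =>
      intro hT
      simp only [Finset.sum_insert hs]
      refine Cls.add ?_ (ih fun z hz => hT (Finset.mem_insert_of_mem hz))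
      rcases mon s (coeff s P) with h1 | h1
      · simp only [h1, map_zero]; exact Cls.zero
      have hle : (monomial s (coeff s P)).totalDegree ≤ H := by
        refine le_trans ?_ hP
        rw [totalDegree_monomial _ (mem_support_iff.1 (hT (Finset.mem_insert_self _ _)))]
        exact le_totalDegree (hT (Finset.mem_insert_self _ _))
      obtain ⟨f, hf⟩ := Nat.exists_eq_add_of_le hle
      have h2 := h1.pad hΔ (e0 * f) (D0 * H) (by
        rw [hf, mul_add]
        have := Nat.mul_le_mul_right f h0
        nlinarith)
      rw [← mul_add, ← hf] at h2
      exact h2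
  exact gen _ (Finset.Subset.refl _)

end Cls

section Coeffs

variable {k : Type*} [Field k] {ι : Type*} [Fintype ι] {d : ι → ℕ}
  {h : ι → MvPolynomial (Fin 2) k}

/-- discriminant factor -/
noncomputable def dl (h : ι → MvPolynomial (Fin 2) k) (s : Σ i, Fin (d i)) : MvPolynomial (Option (Σ i, Fin (d i))) k :=
  rename ![some s, none] (pderiv 0 (h s.1))

/-- discriminant -/
noncomputable def dlt (d : ι → ℕ) (h : ι → MvPolynomial (Fin 2) k) : MvPolynomial (Option (Σ i, Fin (d i))) k :=
  ∏ s, dl h s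

lemma eval_dl (s : Σ i, Fin (d i)) (a : k) (θ : (Σ i, Fin (d i)) → k) :
    eval (opt a θ) (dl h s) = eval ![θ s, a] (pderiv 0 (h s.1)) := by
  rw [dl, eval_rename]
  congr 2
  funext i
  fin_cases i <;> rfl

variable {m : ℕ}

lemma card_S_le (hm : ∑ i, d i ≤ m) : Fintype.card (Σ i, Fin (d i)) ≤ m := by
  simpa using hm

lemma d_le (hm : ∑ i, d i ≤ m) (i : ι) : d i ≤ m :=
  (Finset.single_le_sum (f := d) (fun _ _ => Nat.zero_le _) (Finset.mem_univ i)).trans hm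

lemma dlt_deg (hm : ∑ i, d i ≤ m) (hdeg : ∀ i, (h i).totalDegree ≤ d i) :
    (dlt d h).totalDegree ≤ m * m := by
  refine (totalDegree_finsetProd _ _).trans ?_
  refine (Finset.sum_le_card_nsmul _ _ m ?_).trans ?_
  · intro s _
    refine (totalDegree_rename_le _ _).trans ?_
    refine (totalDegree_pderiv_le 0 _ _ (hdeg s.1)).trans ?_
    have := d_le hm s.1
    omega
  · rw [smul_eq_mul]
    exact Nat.mul_le_mul_right _ (card_S_le hm)

/-- exponents -/
def cre (m : ℕ) : ℕ → ℕ
  | 0 => 0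
  | J + 1 => m * cre m J + 1
/-- degrees -/
def crD (m : ℕ) : ℕ → ℕ
  | 0 => 1
  | J + 1 => m * crD m J + m * m + 1

lemma cre_crD (m J : ℕ) : cre m J * (m * m) + 1 ≤ crD m J := by
  induction J with
  | zero => simp [cre, crD]
  | succ J ih =>
    simp only [cre, crD]
    nlinarith [Nat.zero_le m]

lemma coeff_newton (f : MvPolynomial (Fin 2) k) (a : k) (τ : PowerSeries k) (hτ : aeval ![τ, sx a] f = 0)
    (J : ℕ) (hJ : 0 < J) :
    PowerSeries.coeff J (aeval ![((PowerSeries.trunc J τ : Polynomial k) : PowerSeries k), sx a] f) +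
      eval ![cc k τ, a] (pderiv 0 f) * PowerSeries.coeff J τ = 0 := by
  set u : PowerSeries k := ((PowerSeries.trunc J τ : Polynomial k) : PowerSeries k) with hu
  have hdv : PowerSeries.X ^ J ∣ τ - u := by
    rw [PowerSeries.X_pow_dvd_iff]
    intro j hj
    rw [map_sub, hu, Polynomial.coeff_coe, PowerSeries.coeff_trunc, if_pos hj, sub_self]
  obtain ⟨v, hv⟩ := hdv
  have hτu : τ = u + PowerSeries.X ^ J * v := by rw [← hv]; ring
  obtain ⟨z, hz⟩ := Polynomial.binomExpansion (slc f (sx a)) u (PowerSeries.X ^ J * v)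
  rw [← hτu, eval_slc, hτ, derivative_slc, eval_slc, eval_slc] at hz
  have h1 := congrArg (PowerSeries.coeff J) hz
  have h2 : z * (PowerSeries.X ^ J * v) ^ 2 = PowerSeries.X ^ J * (PowerSeries.X ^ J * (z * v ^ 2)) := by ring
  have h3 : ∀ w, PowerSeries.coeff J (PowerSeries.X ^ J * w : PowerSeries k) = PowerSeries.constantCoeff w := by
    intro w
    have := PowerSeries.coeff_X_pow_mul w J 0
    simpa using this
  have hcv : PowerSeries.constantCoeff v = PowerSeries.coeff J τ := by
    rw [hτu, map_add, h3, hu, Polynomial.coeff_coe, PowerSeries.coeff_trunc]; simp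
  have hcu : cc k u = cc k τ := by
    rw [cc_apply, cc_apply, hτu]; simp [hJ.ne']
  have hcd : PowerSeries.constantCoeff (aeval ![u, sx a] (pderiv 0 f)) = eval ![cc k τ, a] (pderiv 0 f) := by
    rw [← cc_apply, aeval_cc]
    congr 2
    funext i
    fin_cases i
    · exact hcu
    · exact cc_sx a
  rw [map_zero, map_add, map_add, h2, h3, mul_left_comm, h3, map_mul, map_mul, map_pow, hcd, hcv] at h1
  simp only [PowerSeries.constantCoeff_X, zero_pow hJ.ne', zero_mul, add_zero] at h1
  exact h1.symm

/-- evaluation data of a formal point -/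
noncomputable def ptOf (ω : {p : k × ((Σ i, Fin (d i)) → PowerSeries k) // IsPt h p.1 p.2}) :
    Option (Σ i, Fin (d i)) → k := opt ω.1.1 (fun s => cc k (ω.1.2 s))

lemma cls_sx (hm : ∑ i, d i ≤ m) (hdeg : ∀ i, (h i).totalDegree ≤ d i) (J L : ℕ) :
    Cls (ptOf (h := h) (d := d)) (dlt d h) L (cre m J) 0 (crD m J) 0 (fun ω => sx ω.1.1) := by
  intro j hj
  have hD := dlt_deg hm hdeg
  have hc := cre_crD m J
  have hp : (dlt d h ^ cre m J).totalDegree ≤ cre m J * (m * m) :=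
    (totalDegree_pow _ _).trans (Nat.mul_le_mul_left _ hD)
  rcases j with _ | _ | j
  · refine ⟨dlt d h ^ cre m J * X none, ?_, fun ω => ?_⟩
    · refine (totalDegree_mul _ _).trans ?_
      rw [totalDegree_X]; omega
    · simp [sx, ptOf]
  · refine ⟨dlt d h ^ cre m J, by omega, fun ω => ?_⟩
    simp [sx, PowerSeries.coeff_C]
  · refine ⟨0, by simp, fun ω => ?_⟩
    simp [sx, PowerSeries.coeff_C, PowerSeries.coeff_X]

lemma cls_crude (hm : ∑ i, d i ≤ m) (hdeg : ∀ i, (h i).totalDegree ≤ d i) (hm0 : 0 < m) (J : ℕ)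
    (s : Σ i, Fin (d i)) :
    Cls (ptOf (h := h) (d := d)) (dlt d h) J (cre m J) 0 (crD m J) 0 (fun ω => ω.1.2 s) := by
  have hD := dlt_deg hm hdeg
  induction J with
  | zero => intro j hj; omega
  | succ J ih =>
    have hcJ := cre_crD m J
    intro j hj
    by_cases hjJ : j < J
    · obtain ⟨A, hA, hA'⟩ := ih.pad hD (m * cre m J + 1 - cre m J) (crD m (J + 1)) (by
        obtain ⟨m', rfl⟩ : ∃ m', m = m' + 1 := ⟨m - 1, by omega⟩
        have : (m' + 1) * cre (m' + 1) J + 1 - cre (m' + 1) J = m' * cre (m' + 1) J + 1 := by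
          rw [add_mul]; omega
        rw [this]
        simp only [crD]
        nlinarith) j hjJ
      refine ⟨A, hA, fun ω => ?_⟩
      rw [← hA']
      have : cre m J + (m * cre m J + 1 - cre m J) = cre m (J + 1) := by
        simp only [cre]
        have : cre m J ≤ m * cre m J := Nat.le_mul_of_pos_left _ hm0
        omega
      rw [this]
    have hjJ' : j = J := by omega
    subst hjJ'
    have hdl : ∃ B, dlt d h = dl h s * B ∧ B.totalDegree ≤ m * m := by
      classical
      refine ⟨∏ s ∈ Finset.univ.erase s, dl h s, ?_, ?_⟩
      · rw [dlt, Finset.mul_prod_erase _ _ (Finset.mem_univ s)]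
      · refine (totalDegree_finsetProd _ _).trans ?_
        refine (Finset.sum_le_card_nsmul _ _ m ?_).trans ?_
        · intro s _
          refine (totalDegree_rename_le _ _).trans ?_
          refine (totalDegree_pderiv_le 0 _ _ (hdeg s.1)).trans ?_
          have := d_le hm s.1
          omega
        · rw [smul_eq_mul]
          exact Nat.mul_le_mul_right _ ((Finset.card_le_univ _).trans (card_S_le hm))
    obtain ⟨B, hB, hBd⟩ := hdl
    by_cases hj0 : j = 0
    · subst hj0
      refine ⟨dlt d h * X (some s), ?_, fun ω => ?_⟩
      · refine (totalDegree_mul _ _).trans ?_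
        rw [totalDegree_X]; simp only [crD]; omega
      · simp [cre, ptOf, cc_apply]
    have hu : Cls (ptOf (h := h) (d := d)) (dlt d h) (j + 1) (cre m j) 0 (crD m j) 0
        (fun ω => ((PowerSeries.trunc j (ω.1.2 s) : Polynomial k) : PowerSeries k)) := by
      intro l hl
      by_cases hlj : l < j
      · obtain ⟨A, hA, hA'⟩ := ih l hlj
        refine ⟨A, hA, fun ω => ?_⟩
        rw [← hA', Polynomial.coeff_coe, PowerSeries.coeff_trunc, if_pos hlj]
      · refine ⟨0, by simp, fun ω => ?_⟩
        rw [Polynomial.coeff_coe, PowerSeries.coeff_trunc, if_neg hlj, mul_zero, map_zero]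
    have hcl := Cls.aeval hD (S := Fin 2) (e0 := cre m j) (D0 := crD m j) (e := 0) (D := 0) (J := j + 1)
      (pt := ptOf (h := h) (d := d)) (fun ω : {p : k × ((Σ i, Fin (d i)) → PowerSeries k) // IsPt h p.1 p.2} => ![((PowerSeries.trunc j (ω.1.2 s) : Polynomial k) : PowerSeries k), sx ω.1.1])
      (by
        intro i
        fin_cases i
        · exact hu
        · exact cls_sx hm hdeg j (j + 1)) (by omega) (h s.1) m ((hdeg _).trans (d_le hm _))
    obtain ⟨A, hA, hA'⟩ := hcl j (by omega)
    refine ⟨- (B * A), ?_, fun ω => ?_⟩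
    · rw [totalDegree_neg]
      refine (totalDegree_mul _ _).trans ?_
      simp only [crD]
      nlinarith
    · have h1 := coeff_newton (h s.1) ω.1.1 (ω.1.2 s) (root_of_split (ω.2 s.1) s.2) j (by omega)
      have h2 := hA' ω
      have h3 := eval_dl (h := h) s ω.1.1 (fun s => cc k (ω.1.2 s))
      change eval (ptOf ω) (dl h s) = _ at h3
      rw [← h3] at h1
      have h4 := congrArg (eval (ptOf ω)) hB
      rw [map_mul] at h4
      rw [map_neg, map_mul, ← h2]
      simp only [cre, zero_mul, add_zero]
      rw [pow_succ, mul_comm m]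
      nth_rewrite 2 [h4]
      linear_combination (eval (ptOf ω) (dlt d h)) ^ (cre m j * m) * (eval (ptOf ω) B) * h1

lemma cls_main (hm : ∑ i, d i ≤ m) (hdeg : ∀ i, (h i).totalDegree ≤ d i) (hm0 : 0 < m) (J : ℕ)
    (P : MvPolynomial (Option (Σ i, Fin (d i))) k) (H : ℕ) (hP : P.totalDegree ≤ H) :
    Cls (ptOf (h := h) (d := d)) (dlt d h) J 0 (cre m J) H (crD m J)
      (fun ω => aeval (opt (sx ω.1.1) ω.1.2) P) := by
  have hD := dlt_deg hm hdeg
  have hcJ := cre_crD m J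
  have conv : ∀ (g : {p : k × ((Σ i, Fin (d i)) → PowerSeries k) // IsPt h p.1 p.2} → PowerSeries k),
      (∃ A : MvPolynomial (Option (Σ i, Fin (d i))) k, A.totalDegree ≤ 1 ∧
        ∀ ω, PowerSeries.coeff 0 (g ω) = eval (ptOf ω) A) →
      Cls (ptOf (h := h) (d := d)) (dlt d h) J (cre m J) 0 (crD m J) 0 g →
      Cls (ptOf (h := h) (d := d)) (dlt d h) J 0 (cre m J) 1 (crD m J) g := by
    intro g h0 hg j hj
    rcases j with _ | j
    · obtain ⟨A, hA, hA'⟩ := h0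
      exact ⟨A, by omega, fun ω => by simpa using hA' ω⟩
    · obtain ⟨A, hA, hA'⟩ := hg (j + 1) hj
      refine ⟨dlt d h ^ (cre m J * j) * A, ?_, fun ω => ?_⟩
      · refine (totalDegree_mul _ _).trans ?_
        have h2 := (totalDegree_pow (dlt d h) (cre m J * j)).trans (Nat.mul_le_mul_left _ hD)
        have h3 : cre m J * j * (m * m) ≤ crD m J * j := by nlinarith
        rw [mul_add]
        omega
      · rw [map_mul, ← hA', map_pow]
        ring
  have := Cls.aeval hD (S := Option (Σ i, Fin (d i))) (fun ω => opt (sx ω.1.1) ω.1.2) (e0 := 0) (D0 := 1)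
    (e := cre m J) (D := crD m J) (J := J) (pt := ptOf (h := h) (d := d)) (by
      intro o
      cases o with
      | none =>
        refine conv _ ⟨X none, by simp, fun ω => ?_⟩ (cls_sx hm hdeg J J)
        simp [ptOf, sx]
      | some s =>
        refine conv _ ⟨X (some s), by simp, fun ω => ?_⟩ (cls_crude hm hdeg hm0 J s)
        simp [ptOf, cc_apply]) (by simp) P H hP
  simpa using this

end Coeffs

section Step

variable {k : Type*} [Field k]

lemma sx_dvd (N : Polynomial k) (a : k) (j : ℕ) :
    PowerSeries.X ^ j ∣ Polynomial.aeval (sx a) N ↔ (Polynomial.X - Polynomial.C a) ^ j ∣ N := by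
  have h1 : Polynomial.aeval (sx a) N =
      ((N.comp (Polynomial.X + Polynomial.C a) : Polynomial k) : PowerSeries k) := by
    have : (Polynomial.aeval (sx a) : Polynomial k →ₐ[k] PowerSeries k) =
        (Polynomial.coeToPowerSeries.algHom k).comp (Polynomial.aeval (Polynomial.X + Polynomial.C a)) := by
      apply Polynomial.algHom_ext
      simp [sx, Polynomial.coeToPowerSeries.algHom_apply, add_comm]
    rw [this]
    simp [Polynomial.coeToPowerSeries.algHom_apply, Polynomial.aeval_def, Polynomial.comp]
  rw [Polynomial.X_sub_C_pow_dvd_iff, h1, PowerSeries.X_pow_dvd_iff, Polynomial.X_pow_dvd_iff]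
  simp only [Polynomial.coeff_coe]

variable {p : ℕ} [Fact p.Prime] [CharP k p]

lemma ps_charP : CharP (PowerSeries k) p :=
  charP_of_injective_algebraMap (R := k) (FaithfulSMul.algebraMap_injective k (PowerSeries k)) p

lemma ps_pow_trunc (e l : ℕ) (G : PowerSeries k) :
    PowerSeries.X ^ (l * p ^ e) ∣ G ^ p ^ e -
      ∑ j ∈ Finset.range l, ((PowerSeries.coeff j G) ^ p ^ e) • (PowerSeries.X ^ (j * p ^ e) : PowerSeries k) := by
  have := ps_charP (k := k) (p := p)
  have : ExpChar (PowerSeries k) p := inferInstance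
  have h1 : ∑ j ∈ Finset.range l, ((PowerSeries.coeff j G) ^ p ^ e) • (PowerSeries.X ^ (j * p ^ e) : PowerSeries k) =
      (∑ j ∈ Finset.range l, (PowerSeries.coeff j G) • (PowerSeries.X ^ j : PowerSeries k)) ^ p ^ e := by
    rw [sum_pow_char_pow]
    refine Finset.sum_congr rfl fun j _ => ?_
    rw [smul_pow, pow_mul]
  rw [h1, ← sub_pow_char_pow, pow_mul]
  refine pow_dvd_pow_of_dvd ?_ _
  rw [PowerSeries.X_pow_dvd_iff]
  intro j hj
  rw [map_sub, map_sum, Finset.sum_eq_single j]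
  · simp
  · intro i _ hi
    simp [PowerSeries.coeff_X_pow, hi.symm]
  · intro h; simp at h; omega

lemma ps_indep (e : ℕ) {B : Type*} [Fintype B] (U G : B → PowerSeries k)
    (h0 : ∑ b, U b * G b ^ p ^ e = 0)
    (hU : ∀ v : B → k, PowerSeries.X ^ (p ^ e) ∣ ∑ b, v b • U b → ∑ b, v b • U b = 0) (l : ℕ) :
    ∑ b, ((PowerSeries.coeff l (G b)) ^ p ^ e) • U b = 0 := by
  induction l using Nat.strong_induction_on with
  | _ l ih =>
  apply hU
  have h1 : ∀ b, PowerSeries.X ^ ((l + 1) * p ^ e) ∣ U b * (G b ^ p ^ e -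
      ∑ j ∈ Finset.range (l + 1), ((PowerSeries.coeff j (G b)) ^ p ^ e) • (PowerSeries.X ^ (j * p ^ e) : PowerSeries k)) :=
    fun b => Dvd.dvd.mul_left (ps_pow_trunc e (l + 1) (G b)) _
  have h2 := Finset.dvd_sum (fun b (_ : b ∈ Finset.univ) => h1 b)
  have h3 : ∑ b, U b * (G b ^ p ^ e -
      ∑ j ∈ Finset.range (l + 1), ((PowerSeries.coeff j (G b)) ^ p ^ e) • (PowerSeries.X ^ (j * p ^ e) : PowerSeries k))
      = - (PowerSeries.X ^ (l * p ^ e) * ∑ b, ((PowerSeries.coeff l (G b)) ^ p ^ e) • U b) := by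
    simp only [mul_sub, Finset.sum_sub_distrib, h0, zero_sub, Finset.mul_sum]
    rw [Finset.sum_comm, Finset.sum_range_succ, Finset.sum_eq_zero, zero_add]
    · congr 1
      refine Finset.sum_congr rfl fun b _ => ?_
      rw [mul_smul_comm, mul_smul_comm, mul_comm]
    · intro j hj
      have := ih j (Finset.mem_range.1 hj)
      have h4 : PowerSeries.X ^ (j * p ^ e) * ∑ b, ((PowerSeries.coeff j (G b)) ^ p ^ e) • U b = 0 := by
        rw [this, mul_zero]
      rw [Finset.mul_sum] at h4
      rw [← h4]
      refine Finset.sum_congr rfl fun b _ => ?_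
      rw [mul_smul_comm, mul_smul_comm, mul_comm]
  rw [h3, dvd_neg, add_mul, one_mul, pow_add] at h2
  exact (mul_dvd_mul_iff_left (pow_ne_zero _ PowerSeries.X_ne_zero)).1 h2

lemma exists_lin_zero {A B : Type*} [Fintype A] [Fintype B] (M : B → A → k)
    (h : Fintype.card B < Fintype.card A) : ∃ c : A → k, c ≠ 0 ∧ ∀ b, ∑ a, c a * M b a = 0 := by
  classical
  have h1 : LinearMap.ker (Matrix.mulVecLin (Matrix.of M)) ≠ ⊥ :=
    LinearMap.ker_ne_bot_of_finrank_lt (by simpa using h)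
  obtain ⟨c, hc, hc0⟩ := (Submodule.ne_bot_iff _).1 h1
  refine ⟨c, hc0, fun b => ?_⟩
  have := congrFun (LinearMap.mem_ker.1 hc) b
  simpa [Matrix.mulVec, dotProduct, mul_comm] using this

end Step

section Step2

variable {k E : Type*} [Field k] [IsAlgClosed k] [Field E] [Algebra k E] {ι : Type*} [Fintype ι] [DecidableEq ι]
  {d : ι → ℕ} {h : ι → MvPolynomial (Fin 2) k} {φ : MvPolynomial (Option (Σ i, Fin (d i))) k →ₐ[k] E}

lemma IsPt.ren {a : k} {τ : (Σ i, Fin (d i)) → PowerSeries k} (hτ : IsPt h a τ) (π : ∀ i, Equiv.Perm (Fin (d i))) :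
    IsPt h a (fun s => τ (sgm π s)) := by
  intro i
  rw [hτ i]
  exact (Equiv.prod_comp (π i) (fun j => (Polynomial.X - Polynomial.C (τ ⟨i, j⟩)))).symm

lemma opt_sgm {A : Type*} (x : A) (τ : (Σ i, Fin (d i)) → A) (π : ∀ i, Equiv.Perm (Fin (d i))) :
    opt x τ ∘ Option.map (sgm π) = opt x (fun s => τ (sgm π s)) := by
  funext o
  cases o <;> rfl

lemma Geo.order (geo : Geo d h φ) {a : k} {τ : (Σ i, Fin (d i)) → PowerSeries k} (hτ : IsPt h a τ)
    {P : MvPolynomial (Option (Σ i, Fin (d i))) k} {D : ℕ} (hD : P.totalDegree ≤ D) (hP : φ P ≠ 0) {j : ℕ}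
    (hj : PowerSeries.X ^ j ∣ aeval (opt (sx a) τ) P) :
    j ≤ Fintype.card (∀ i, Equiv.Perm (Fin (d i))) * D := by
  obtain ⟨N, hN0, hN, hN'⟩ := geo.norm P D hD hP
  have h1 : PowerSeries.X ^ j ∣ Polynomial.aeval (sx a) N := by
    rw [hN' a τ hτ]
    refine hj.trans ?_
    have := Finset.dvd_prod_of_mem (fun π => aeval (opt (sx a) τ) (rename (Option.map (sgm π)) P))
      (Finset.mem_univ (1 : ∀ i, Equiv.Perm (Fin (d i))))
    simpa only [ren_one] using this
  rw [sx_dvd] at h1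
  have h2 := Polynomial.natDegree_le_of_dvd h1 hN0
  rw [Polynomial.natDegree_pow, Polynomial.natDegree_X_sub_C, mul_one] at h2
  exact h2.trans hN

lemma Geo.total (geo : Geo d h φ) (A : Finset k) (T : k → (Σ i, Fin (d i)) → PowerSeries k)
    (hT : ∀ a ∈ A, IsPt h a (T a)) (Z : k → Finset (∀ i, Equiv.Perm (Fin (d i))))
    {P : MvPolynomial (Option (Σ i, Fin (d i))) k} {D : ℕ} (hD : P.totalDegree ≤ D) (hP : φ P ≠ 0) (J : ℕ)
    (hZ : ∀ a ∈ A, ∀ ρ ∈ Z a, PowerSeries.X ^ J ∣ aeval (opt (sx a) (fun s => T a (sgm ρ s))) P) :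
    J * ∑ a ∈ A, (Z a).card ≤ Fintype.card (∀ i, Equiv.Perm (Fin (d i))) * D := by
  obtain ⟨N, hN0, hN, hN'⟩ := geo.norm P D hD hP
  have h1 : ∀ a ∈ A, (Polynomial.X - Polynomial.C a) ^ (J * (Z a).card) ∣ N := by
    intro a ha
    rw [← sx_dvd, hN' a _ (hT a ha)]
    refine dvd_trans ?_ (Finset.prod_dvd_prod_of_subset (Z a) Finset.univ _ (Finset.subset_univ _))
    rw [pow_mul, ← Finset.prod_const]
    refine Finset.prod_dvd_prod_of_dvd _ _ fun ρ hρ => ?_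
    rw [aeval_rename, opt_sgm]
    exact hZ a ha ρ hρ
  have h2 : ∏ a ∈ A, (Polynomial.X - Polynomial.C a) ^ (J * (Z a).card) ∣ N := by
    refine Finset.prod_dvd_of_coprime ?_ h1
    intro a _ b _ hab
    exact (Polynomial.pairwise_coprime_X_sub_C (s := fun x : k => x) Function.injective_id hab).pow
  have h3 := Polynomial.natDegree_le_of_dvd h2 hN0
  rw [Polynomial.natDegree_prod _ _ (fun a _ => pow_ne_zero _ (Polynomial.X_sub_C_ne_zero a))] at h3
  simp only [Polynomial.natDegree_pow, Polynomial.natDegree_X_sub_C, mul_one] at h3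
  rw [Finset.mul_sum]
  exact h3.trans hN

variable {p : ℕ} [Fact p.Prime] [CharP k p]

lemma eval_frob {S : Type*} (e : ℕ) (w : S → k) (P : MvPolynomial S k) :
    eval w P ^ p ^ e = eval (fun s => w s ^ p ^ e) (map (iterateFrobenius k p e) P) := by
  have h1 := eval₂_comp_left (iterateFrobenius k p e) (RingHom.id k) w P
  rw [eval_map, eval₂_id] at *
  rw [iterateFrobenius_def] at h1
  rw [h1, RingHom.comp_id]
  rfl

lemma totalDegree_map_le' {S R R' : Type*} [CommRing R] [CommRing R'] (g : R →+* R') (P : MvPolynomial S R) :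
    (map g P).totalDegree ≤ P.totalDegree := by
  classical
  refine Finset.sup_mono (f := fun s : S →₀ ℕ => s.sum fun _ e => e) ?_
  exact support_map_subset g P

lemma Geo.nonvanish {e : ℕ} (geo : Geo d h φ) {a : k} {τ : (Σ i, Fin (d i)) → PowerSeries k} (hτ : IsPt h a τ)
    {A B : Type*} [Fintype A] [Fintype B] (gh : A → MvPolynomial (Option (Σ i, Fin (d i))) k)
    (gg : B → MvPolynomial (Option (Σ i, Fin (d i))) k) (H : ℕ) (hgh : ∀ b, (gh b).totalDegree ≤ H)
    (hghi : LinearIndependent k (fun b => φ (gh b))) (hggi : LinearIndependent k (fun b => φ (gg b)))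
    (hH : Fintype.card (∀ i, Equiv.Perm (Fin (d i))) * H < p ^ e) (c : A × B → k)
    (h0 : φ (∑ b, (∑ x, c (x, b) • gh x) * gg b ^ p ^ e) = 0) : c = 0 := by
  set ε := (aeval (opt (sx a) τ) : MvPolynomial (Option (Σ i, Fin (d i))) k →ₐ[k] PowerSeries k) with hε
  have hker : ∀ P, φ P = 0 ↔ ε P = 0 := geo.ker a τ hτ
  have hq0 : p ^ e ≠ 0 := by omega
  have h1 := ps_indep (p := p) e (fun b => ε (∑ x, c (x, b) • gh x)) (fun b => ε (gg b)) (by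
    rw [hker, map_sum] at h0
    simpa only [map_mul, map_pow] using h0) (by
    intro v hv
    have h2 : ∑ b, v b • ε (∑ x, c (x, b) • gh x) = ε (∑ b, v b • ∑ x, c (x, b) • gh x) := by
      rw [map_sum]; simp only [map_smul]
    rw [h2] at hv ⊢
    by_contra h3
    rw [← hker] at h3
    have h4 := geo.order hτ (D := H) (by
      refine totalDegree_finsetSum_le fun b _ => ?_
      refine (totalDegree_smul_le _ _).trans ?_
      refine totalDegree_finsetSum_le fun x _ => ?_
      exact (totalDegree_smul_le _ _).trans (hgh x)) h3 hv
    omega)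
  have hroot : ∀ z : k, ∃ y, y ^ p ^ e = z := fun z => IsAlgClosed.exists_pow_nat_eq z (Nat.pos_of_ne_zero hq0)
  choose rt hrt using hroot
  have h2 : ∀ l x, ∑ b, PowerSeries.coeff l (ε (gg b)) ^ p ^ e * c (x, b) = 0 := by
    intro l
    have h3 : φ (∑ x, (∑ b, PowerSeries.coeff l (ε (gg b)) ^ p ^ e * c (x, b)) • gh x) = 0 := by
      rw [hker, ← h1 l, map_sum]
      simp only [map_smul, map_sum, Finset.smul_sum, Finset.sum_smul]
      rw [Finset.sum_comm]
      simp only [mul_smul]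
    rw [map_sum] at h3
    simp only [map_smul] at h3
    exact Fintype.linearIndependent_iff.1 hghi _ h3
  have h3 : ∀ x, φ (∑ b, rt (c (x, b)) • gg b) = 0 := by
    intro x
    rw [hker, map_sum]
    simp only [map_smul]
    ext l
    have h4 := h2 l x
    have h5 : (∑ b, PowerSeries.coeff l (ε (gg b)) * rt (c (x, b))) ^ p ^ e = 0 := by
      rw [sum_pow_char_pow, ← h4]
      refine Finset.sum_congr rfl fun b _ => ?_
      rw [mul_pow, hrt]
    rw [map_sum, map_zero, ← pow_eq_zero_iff hq0, ← h5]
    congr 1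
    refine Finset.sum_congr rfl fun b _ => ?_
    rw [map_smul, smul_eq_mul, mul_comm]
  funext ⟨x, b⟩
  have h4 := h3 x
  rw [map_sum] at h4
  simp only [map_smul] at h4
  have h5 := Fintype.linearIndependent_iff.1 hggi _ h4 b
  rw [← hrt (c (x, b)), h5, zero_pow hq0]
  rfl

lemma coeff_mul_pow (e : ℕ) (U G : PowerSeries k) (j : ℕ) (hj : j < p ^ e) :
    PowerSeries.coeff j (U * G ^ p ^ e) = PowerSeries.coeff j U * cc k G ^ p ^ e := by
  obtain ⟨v, hv⟩ := ps_pow_trunc (p := p) e 1 G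
  have h1 : G ^ p ^ e = (cc k G ^ p ^ e) • (1 : PowerSeries k) + PowerSeries.X ^ p ^ e * v := by
    rw [one_mul] at hv
    rw [← hv]
    simp [cc_apply]
  rw [h1, mul_add, map_add, mul_smul_comm, mul_one, map_smul, smul_eq_mul, mul_left_comm,
    PowerSeries.coeff_X_pow_mul', if_neg (by omega), add_zero, mul_comm]

theorem stepanov_aux {m e : ℕ} (geo : Geo d h φ) (hm : ∑ i, d i ≤ m) (hm0 : 0 < m)
    (hdeg : ∀ i, (h i).totalDegree ≤ d i) (τ : ∀ i, Equiv.Perm (Fin (d i)))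
    (A : Finset k) (T : k → (Σ i, Fin (d i)) → PowerSeries k) (hT : ∀ a ∈ A, IsPt h a (T a))
    (hA : ∀ a ∈ A, a ^ p ^ e = a)
    (hs : ∀ a ∈ A, ∀ s, eval ![cc k (T a s), a] (pderiv 0 (h s.1)) ≠ 0)
    (Z : k → Finset (∀ i, Equiv.Perm (Fin (d i))))
    (hZ : ∀ a ∈ A, ∀ ρ ∈ Z a, ∀ s, cc k (T a (sgm ρ s)) ^ p ^ e = cc k (T a (sgm ρ (sgm τ s))))
    (J H M : ℕ) (hH : Fintype.card (∀ i, Equiv.Perm (Fin (d i))) * H < p ^ e)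
    (hJ : J ≤ p ^ e) {A' B' : Type*} [Fintype A'] [Fintype B']
    (gh : A' → MvPolynomial (Option (Σ i, Fin (d i))) k)
    (gg : B' → MvPolynomial (Option (Σ i, Fin (d i))) k) (hgh : ∀ b, (gh b).totalDegree ≤ H)
    (hgg : ∀ b, (gg b).totalDegree ≤ M)
    (hghi : LinearIndependent k (fun b => φ (gh b))) (hggi : LinearIndependent k (fun b => φ (gg b)))
    (hcount : J * (Fintype.card (∀ i, Equiv.Perm (Fin (d i))) * (H + M + crD m J * J) + 1) <
      Fintype.card A' * Fintype.card B') :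
    J * ∑ a ∈ A, (Z a).card ≤ Fintype.card (∀ i, Equiv.Perm (Fin (d i))) * (H + p ^ e * M) := by
  classical
  rcases A.eq_empty_or_nonempty with rfl | ⟨a0, ha0⟩
  · simp
  set n := Fintype.card (∀ i, Equiv.Perm (Fin (d i))) with hn
  set D := H + M + crD m J * J with hD
  have hcl : ∀ x (j : Fin J), ∃ Q : MvPolynomial (Option (Σ i, Fin (d i))) k, Q.totalDegree ≤ H + crD m J * j ∧
      ∀ ω : {p : k × ((Σ i, Fin (d i)) → PowerSeries k) // IsPt h p.1 p.2},
        eval (ptOf ω) (dlt d h) ^ (0 + cre m J * j) *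
          PowerSeries.coeff j (aeval (opt (sx ω.1.1) ω.1.2) (gh x)) = eval (ptOf ω) Q :=
    fun x j => cls_main hm hdeg hm0 J (gh x) H (hgh x) j j.2
  choose Q hQd hQ using hcl
  let gt : B' → MvPolynomial (Option (Σ i, Fin (d i))) k := fun b =>
    rename (Option.map (sgm τ)) (map (iterateFrobenius k p e) (gg b))
  have hgt : ∀ b, (gt b).totalDegree ≤ M := fun b =>
    (totalDegree_rename_le _ _).trans ((totalDegree_map_le' _ _).trans (hgg b))
  obtain ⟨c, hc0, hc⟩ := exists_lin_zero (A := A' × B') (B := Fin J × Fin (n * D + 1))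
    (fun jl ab => PowerSeries.coeff jl.2 (aeval (opt (sx a0) (T a0)) (Q ab.1 jl.1 * gt ab.2))) (by
      simpa using hcount)
  have hW : ∀ j : Fin J, φ (∑ ab : A' × B', c ab • (Q ab.1 j * gt ab.2)) = 0 := by
    intro j
    by_contra h1
    have h2 := geo.order (hT a0 ha0) (D := D) (j := n * D + 1) (by
      refine totalDegree_finsetSum_le fun ab _ => ?_
      refine (totalDegree_smul_le _ _).trans ((totalDegree_mul _ _).trans ?_)
      have h3 := hQd ab.1 j
      have h4 := hgt ab.2
      have h5 : crD m J * j ≤ crD m J * J := Nat.mul_le_mul_left _ j.2.le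
      omega) h1 (by
      rw [PowerSeries.X_pow_dvd_iff]
      intro l hl
      rw [map_sum, map_sum, ← hc (j, ⟨l, hl⟩)]
      refine Finset.sum_congr rfl fun ab _ => ?_
      rw [map_smul, map_smul, smul_eq_mul])
    rw [← hn] at h2
    omega
  have hR : φ (∑ b, (∑ x, c (x, b) • gh x) * gg b ^ p ^ e) ≠ 0 := fun h0 =>
    hc0 (geo.nonvanish (hT a0 ha0) gh gg H hgh hghi hggi hH c h0)
  refine geo.total A T hT Z (D := H + p ^ e * M) ?_ hR J ?_
  · refine totalDegree_finsetSum_le fun b _ => ?_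
    refine (totalDegree_mul _ _).trans (add_le_add ?_ ?_)
    · refine totalDegree_finsetSum_le fun x _ => ?_
      exact (totalDegree_smul_le _ _).trans (hgh x)
    · exact (totalDegree_pow _ _).trans (Nat.mul_le_mul_left _ (hgg b))
  · intro a ha ρ hρ
    have hpt := (hT a ha).ren ρ
    let ω : {p : k × ((Σ i, Fin (d i)) → PowerSeries k) // IsPt h p.1 p.2} := ⟨(a, fun s => T a (sgm ρ s)), hpt⟩
    rw [PowerSeries.X_pow_dvd_iff]
    intro j hj
    have hdl : eval (ptOf ω) (dlt d h) ≠ 0 := by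
      rw [dlt, map_prod, Finset.prod_ne_zero_iff]
      intro s _
      have := eval_dl (h := h) s a (fun s => cc k (T a (sgm ρ s)))
      change eval (ptOf ω) (dl h s) = _ at this
      rw [this]
      exact hs a ha (sgm ρ s)
    have hε : ∀ P, cc k (aeval (opt (sx a) (fun s => T a (sgm ρ s))) P) = eval (ptOf ω) P := by
      intro P
      rw [aeval_cc]
      congr 2
      funext o
      cases o
      · exact cc_sx a
      · rfl
    have hg : ∀ b, eval (ptOf ω) (gg b) ^ p ^ e = eval (ptOf ω) (gt b) := by
      intro b
      rw [eval_frob, eval_rename]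
      congr 2
      funext o
      cases o with
      | none => exact hA a ha
      | some s => exact hZ a ha ρ hρ s
    have h3 := (geo.ker _ _ hpt _).1 (hW ⟨j, hj⟩)
    have h4 := congrArg (cc k) h3
    rw [hε, map_zero, map_sum] at h4
    refine ((mul_eq_zero (a := eval (ptOf ω) (dlt d h) ^ (0 + cre m J * j))).1 ?_).resolve_left (pow_ne_zero _ hdl)
    rw [← h4, map_sum, map_sum, Finset.mul_sum, Fintype.sum_prod_type, Finset.sum_comm]
    refine Finset.sum_congr rfl fun b _ => ?_
    rw [map_mul, map_pow, coeff_mul_pow e _ _ j (lt_of_lt_of_le hj hJ), hε, hg, map_sum, map_sum, Finset.sum_mul,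
      Finset.mul_sum]
    refine Finset.sum_congr rfl fun x _ => ?_
    have h5 := hQ x ⟨j, hj⟩ ω
    rw [smul_eval, map_mul, ← h5, map_smul, map_smul, smul_eq_mul]
    ring

theorem stepanov {m e : ℕ} (geo : Geo d h φ) (hm : ∑ i, d i ≤ m) (hm0 : 0 < m)
    (hdeg : ∀ i, (h i).totalDegree ≤ d i) (τ : ∀ i, Equiv.Perm (Fin (d i)))
    (A : Finset k) (T : k → (Σ i, Fin (d i)) → PowerSeries k) (hT : ∀ a ∈ A, IsPt h a (T a))
    (hA : ∀ a ∈ A, a ^ p ^ e = a)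
    (hs : ∀ a ∈ A, ∀ s, eval ![cc k (T a s), a] (pderiv 0 (h s.1)) ≠ 0)
    (Z : k → Finset (∀ i, Equiv.Perm (Fin (d i))))
    (hZ : ∀ a ∈ A, ∀ ρ ∈ Z a, ∀ s, cc k (T a (sgm ρ s)) ^ p ^ e = cc k (T a (sgm ρ (sgm τ s))))
    (n : ℕ) (hn : n = Fintype.card (∀ i, Equiv.Perm (Fin (d i)))) (J H M : ℕ) (hH : n * H < p ^ e)
    (hJ : J ≤ p ^ e)
    (hcount : J * (n * (H + M + crD m J * J) + 1) < (n * (H + 2 - n)) * (n * (M + 2 - n))) :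
    J * ∑ a ∈ A, (Z a).card ≤ n * (H + p ^ e * M) := by
  subst hn
  obtain ⟨gh, hgh, hghi⟩ := geo.fam H
  obtain ⟨gg, hgg, hggi⟩ := geo.fam M
  exact stepanov_aux geo hm hm0 hdeg τ A T hT hA hs Z hZ J H M hH hJ gh gg hgh hgg hghi hggi (by
    simpa only [Fintype.card_prod, Fintype.card_fin] using hcount)

end Step2

section Count

lemma par_count (n G M J C H : ℕ) (hG : G + n = M + 2) (hJ : J + 1 = n * G) (hHn : n ≤ H + 2)
    (hbig : n * n * n * G + J * (n * (M + C) + 1) < n * H) :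
    J * (n * (H + M + C) + 1) < (n * (H + 2 - n)) * (n * (M + 2 - n)) := by
  have h1 : M + 2 - n = G := by omega
  rw [h1]
  obtain ⟨y, hy⟩ := Nat.exists_eq_add_of_le hHn
  have h2 : H + 2 - n = y := by omega
  rw [h2, ← hJ]
  zify at *
  have h3 : (y : ℤ) = H + 2 - n := by linarith
  rw [h3]
  have h4 : (n : ℤ) * (H + 2 - n) * (J + 1) = n * H * J + n * H + 2 * n * (J + 1) - n * (n * (n * G)) := by
    rw [← hJ]; ring
  rw [h4]
  have h5 : (0 : ℤ) ≤ 2 * n * (J + 1) := by positivity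
  nlinarith

lemma par_final (n' G M J H q c A : ℕ) (hM : M = n' * n' + 2) (hG : G + (n' + 1) = M + 2) (hJ : J + 1 = (n' + 1) * G)
    (hH : (n' + 1) * H < q) (hA : q ≤ A + c) (hq : (n' + 1) * J * c < q) :
    n' * (H + q * M) < J * A := by
  by_contra hcon
  push Not at hcon
  have h1 : (n' + 1) * (J * A) ≤ n' * (q + (n' + 1) * (q * M)) := by
    calc (n' + 1) * (J * A) ≤ (n' + 1) * (n' * (H + q * M)) := Nat.mul_le_mul_left _ hcon
      _ = n' * ((n' + 1) * H + (n' + 1) * (q * M)) := by ring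
      _ ≤ _ := Nat.mul_le_mul_left _ (by omega)
  have h2 : (n' + 1) * (J * q) ≤ (n' + 1) * (J * A) + (n' + 1) * J * c := by
    calc (n' + 1) * (J * q) ≤ (n' + 1) * (J * (A + c)) := by gcongr
      _ = _ := by ring
  have h3 : (n' + 1) * (J * q) < n' * (q + (n' + 1) * (q * M)) + q := by omega
  have h4 : (n' + 1) * (J * q) = n' * (q + (n' + 1) * (q * M)) + q * (n' + 2) := by
    zify at *
    have hG' : (G : ℤ) = n' * n' - n' + 3 := by linarith
    have hJ' : (J : ℤ) = (n' + 1) * (n' * n' - n' + 3) - 1 := by rw [← hG']; linarith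
    rw [hJ', hM]
    push_cast
    ring
  rw [h4] at h3
  nlinarith

/-- number of conditions parameter -/
def parM (n : ℕ) : ℕ := (n - 1) * (n - 1) + 2
/-- multiplicity parameter -/
def parJ (n : ℕ) : ℕ := n * (parM n + 2 - n) - 1
/-- bound for given `n` -/
def parQ (m n : ℕ) : ℕ :=
  n * n * n * (parM n + 2 - n) + parJ n * (n * (parM n + crD m (parJ n) * parJ n) + 1) + n * n + n +
    n * parJ n * (m * m + 1) + parJ n + 1

lemma rot_all (d : ℕ) (S : Fin d → Prop) (h : ∀ j, S j → S (finRotate d j)) (h0 : ∀ hd : 0 < d, S ⟨0, hd⟩) (j) : S j := by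
  cases d with
  | zero => exact j.elim0
  | succ d =>
    refine Fin.induction (motive := S) (h0 (by omega)) ?_ j
    intro i hi
    have := h _ hi
    rwa [finRotate_apply, Fin.coeSucc_eq_succ] at this

variable {K : Type*} [Field K] [Fintype K] {k : Type*} [Field k] [Algebra K k]

lemma frob_eval (w : Fin 2 → k) (f : MvPolynomial (Fin 2) K) :
    eval w (map (algebraMap K k) f) ^ Fintype.card K =
      eval (fun i => w i ^ Fintype.card K) (map (algebraMap K k) f) := by
  rw [eval_map, eval_map, ← aeval_def, ← aeval_def, ← FiniteField.frobeniusAlgHom_apply K]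
  have : (FiniteField.frobeniusAlgHom K k).comp (aeval w) =
      aeval (R := K) (fun i => w i ^ Fintype.card K) := by
    apply MvPolynomial.algHom_ext
    intro i
    simp
  rw [← this]; rfl

lemma minpoly_cycle (D : ℕ) (hD : 0 < D) (θ : Fin D → k) (hθ : Function.Injective θ)
    (h : ∀ j, θ j ^ Fintype.card K = θ (finRotate D j)) (hInt : IsIntegral K (θ ⟨0, hD⟩)) :
    D ≤ (minpoly K (θ ⟨0, hD⟩)).natDegree := by
  classical
  set P := minpoly K (θ ⟨0, hD⟩) with hP
  have h1 : ∀ j, Polynomial.aeval (θ j) P = 0 := by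
    apply rot_all
    · intro j hj
      rw [← h, ← FiniteField.frobeniusAlgHom_apply K, Polynomial.aeval_algHom_apply, hj, map_zero]
    · intro _; exact minpoly.aeval _ _
  have hP0 : P ≠ 0 := minpoly.ne_zero hInt
  have h2 : (Finset.univ.image θ) ⊆ (P.map (algebraMap K k)).roots.toFinset := by
    intro z hz
    obtain ⟨j, _, rfl⟩ := Finset.mem_image.1 hz
    rw [Multiset.mem_toFinset, Polynomial.mem_roots (Polynomial.map_ne_zero hP0), Polynomial.IsRoot,
      Polynomial.eval_map_algebraMap, h1]
  have h3 := Finset.card_le_card h2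
  rw [Finset.card_image_of_injective _ hθ, Finset.card_fin] at h3
  refine h3.trans ((Multiset.toFinset_card_le _).trans ((Polynomial.card_roots' _).trans ?_))
  rw [Polynomial.natDegree_map]

variable [IsAlgClosed k] {ι : Type*} [Fintype ι] [DecidableEq ι]

/-- the Frobenius permutation and lifts above a good point -/
lemma good_pt {D : ℕ} {f : MvPolynomial (Fin 2) K} (hf : Crv D (map (algebraMap K k) f)) (a : K)
    (ha : (nrm (map (algebraMap K k) f) (pderiv 0 (map (algebraMap K k) f)) D (D - 1)).eval (algebraMap K k a) ≠ 0) :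
    ∃ (τ : Fin D → PowerSeries k) (π : Equiv.Perm (Fin D)),
      slc (map (algebraMap K k) f) (sx (algebraMap K k a)) = ∏ j, (Polynomial.X - Polynomial.C (τ j)) ∧
      (∀ j, eval ![cc k (τ j), algebraMap K k a] (pderiv 0 (map (algebraMap K k) f)) ≠ 0) ∧
      (∀ j, eval ![cc k (τ j), algebraMap K k a] (map (algebraMap K k) f) = 0) ∧
      Function.Injective (fun j => cc k (τ j)) ∧ ∀ j, cc k (τ j) ^ Fintype.card K = cc k (τ (π j)) := by
  classical
  have hd : 0 < D := by have := hf.two_le; omega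
  obtain ⟨θ, hθ⟩ := exists_split hd hf.deg hf.monic (algebraMap K k a)
  rw [eval_nrm _ (totalDegree_pderiv_le 0 _ D hf.deg) hθ, Finset.prod_ne_zero_iff] at ha
  have hr : ∀ j, eval ![θ j, algebraMap K k a] (map (algebraMap K k) f) = 0 := by
    intro j
    have := root_of_split hθ j
    rwa [aeval_eq_eval] at this
  have hinj : Function.Injective θ := by
    intro j l hjl
    by_contra hne
    have h1 := eval_fT_prod hθ j
    rw [aeval_eq_eval] at h1
    refine ha j (Finset.mem_univ _) ?_
    refine h1.trans (Finset.prod_eq_zero (Finset.mem_erase.2 ⟨Ne.symm hne, Finset.mem_univ l⟩) ?_)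
    rw [hjl, sub_self]
  obtain ⟨τ, hτ, hτc⟩ := ps_split hd hf.deg hf.monic _ θ hinj hθ
  have hex : ∀ j, ∃ l, θ j ^ Fintype.card K = θ l := by
    intro j
    have h1 := frob_eval ![θ j, algebraMap K k a] f
    rw [hr, zero_pow Fintype.card_ne_zero] at h1
    have h2 : (fun i => (![θ j, algebraMap K k a] : Fin 2 → k) i ^ Fintype.card K) =
        ![θ j ^ Fintype.card K, algebraMap K k a] := by
      funext i
      fin_cases i
      · rfl
      · simp [← map_pow, FiniteField.pow_card]
    rw [h2, ← aeval_eq_eval, ← eval_slc, hθ, Polynomial.eval_prod] at h1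
    obtain ⟨l, _, hl⟩ := Finset.prod_eq_zero_iff.1 h1.symm
    refine ⟨l, ?_⟩
    simpa [sub_eq_zero] using hl
  choose g hg using hex
  have hgi : Function.Injective g := by
    intro j l hjl
    apply hinj
    apply (FiniteField.frobeniusAlgHom K k).injective
    change FiniteField.frobeniusAlgHom K k (θ j) = FiniteField.frobeniusAlgHom K k (θ l)
    rw [FiniteField.frobeniusAlgHom_apply, FiniteField.frobeniusAlgHom_apply, hg, hg, hjl]
  refine ⟨τ, Equiv.ofBijective g (Finite.injective_iff_bijective.1 hgi), hτ, ?_, ?_, ?_, ?_⟩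
  · intro j; rw [hτc]; exact ha j (Finset.mem_univ _)
  · intro j; rw [hτc]; exact hr j
  · simp only [hτc]; exact hinj
  · intro j; rw [hτc, hτc]; exact hg j

/-- bound for the counting argument -/
def cntQ (m : ℕ) : ℕ := ∑ n ∈ Finset.range (m.factorial + 1), parQ m n

lemma count_main {m p : ℕ} [Fact p.Prime] [CharP K p] (hm0 : 0 < m) (hq : cntQ m < Fintype.card K) (d : ι → ℕ)
    (f : ι → MvPolynomial (Fin 2) K) (hS : Smp d (fun i => map (algebraMap K k) (f i))) (hm : ∑ i, d i ≤ m)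
    (hInt : ∀ z : k, IsIntegral K z) :
    ∃ a : K, a ≠ 0 ∧ ∀ i, ∃ θ : k, eval ![θ, algebraMap K k a] (map (algebraMap K k) (f i)) = 0 ∧
      d i ≤ (minpoly K θ).natDegree := by
  classical
  by_contra hcon
  push Not at hcon
  set h : ι → MvPolynomial (Fin 2) k := fun i => map (algebraMap K k) (f i) with hh
  have : CharP k p := charP_of_injective_algebraMap (algebraMap K k).injective p
  obtain ⟨E, _, _, φ, geo⟩ := exists_geo hS
  obtain ⟨e, _, hpe⟩ := FiniteField.card K p
  set q := Fintype.card K with hqdef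
  let B : Polynomial k := Polynomial.X * ∏ i, nrm (h i) (pderiv 0 (h i)) (d i) (d i - 1)
  have hB0 : B ≠ 0 := mul_ne_zero Polynomial.X_ne_zero
    (Finset.prod_ne_zero_iff.2 fun i _ => (nrm_fT_natDegree (hS.crv i)).1)
  have hBd : B.natDegree ≤ m * m + 1 := by
    refine Polynomial.natDegree_mul_le.trans ?_
    rw [Polynomial.natDegree_X]
    have h1 := Polynomial.natDegree_prod_le Finset.univ (fun i => nrm (h i) (pderiv 0 (h i)) (d i) (d i - 1))
    have h2 : ∑ i, (nrm (h i) (pderiv 0 (h i)) (d i) (d i - 1)).natDegree ≤ m * m := by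
      calc _ = ∑ i, d i * (d i - 1) := Finset.sum_congr rfl fun i _ => (nrm_fT_natDegree (hS.crv i)).2
        _ ≤ ∑ i, d i * m := Finset.sum_le_sum fun i _ => Nat.mul_le_mul_left _ (by have := d_le hm i; omega)
        _ = (∑ i, d i) * m := by rw [Finset.sum_mul]
        _ ≤ m * m := Nat.mul_le_mul_right _ hm
    have h3 := h1.trans h2
    omega
  let A : Finset k := (Finset.univ.image (algebraMap K k)).filter (fun a => B.eval a ≠ 0)
  have hAc : q ≤ A.card + (m * m + 1) := by
    have h1 : (Finset.univ.image (algebraMap K k)).card = q := by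
      rw [Finset.card_image_of_injective _ (algebraMap K k).injective, Finset.card_univ]
    rw [← h1, ← Finset.card_filter_add_card_filter_not (fun a => B.eval a ≠ 0)]
    refine Nat.add_le_add_left ?_ _
    refine le_trans (Finset.card_le_card (t := B.roots.toFinset) ?_)
      ((Multiset.toFinset_card_le _).trans ((Polynomial.card_roots' _).trans hBd))
    intro a ha
    rw [Multiset.mem_toFinset, Polynomial.mem_roots hB0]
    simpa using (Finset.mem_filter.1 ha).2
  have hpt : ∀ a, ∃ (T : (Σ i, Fin (d i)) → PowerSeries k) (π : ∀ i, Equiv.Perm (Fin (d i))), a ∈ A →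
      IsPt h a T ∧ (∀ s, eval ![cc k (T s), a] (pderiv 0 (h s.1)) ≠ 0) ∧
      (∀ s, eval ![cc k (T s), a] (h s.1) = 0) ∧ (∀ i, Function.Injective (fun j => cc k (T ⟨i, j⟩))) ∧
      ∀ s, cc k (T s) ^ q = cc k (T (sgm π s)) := by
    intro a
    by_cases ha : a ∈ A
    · obtain ⟨ha1, ha2⟩ := Finset.mem_filter.1 ha
      obtain ⟨b, _, rfl⟩ := Finset.mem_image.1 ha1
      rw [Polynomial.eval_mul, Polynomial.eval_prod] at ha2
      have ha3 := Finset.prod_ne_zero_iff.1 (right_ne_zero_of_mul ha2)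
      have h1 := fun i => good_pt (hS.crv i) b (ha3 i (Finset.mem_univ i))
      choose τ π h2 h3 h4 h5 h6 using h1
      exact ⟨fun s => τ s.1 s.2, π, fun _ => ⟨h2, fun s => h3 s.1 s.2, fun s => h4 s.1 s.2, h5, fun s => h6 s.1 s.2⟩⟩
    · exact ⟨0, 1, fun h => absurd h ha⟩
  choose T π hT using hpt
  let Z : (∀ i, Equiv.Perm (Fin (d i))) → k → Finset (∀ i, Equiv.Perm (Fin (d i))) := fun τ a =>
    Finset.univ.filter (fun ρ => ρ⁻¹ * π a * ρ = τ)
  let τ0 : ∀ i, Equiv.Perm (Fin (d i)) := fun i => finRotate (d i)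
  set n := Fintype.card (∀ i, Equiv.Perm (Fin (d i))) with hn
  have hn0 : 0 < n := Fintype.card_pos
  have hsum : ∀ a, ∑ τ, (Z τ a).card = n := by
    intro a
    rw [hn, ← Finset.card_univ]
    exact (Finset.card_eq_sum_card_fiberwise (f := fun ρ => ρ⁻¹ * π a * ρ) (fun _ _ => Finset.mem_coe.2 (Finset.mem_univ _))).symm
  have hsw : ∀ τ a ρ, ρ ∈ Z τ a → π a * ρ = ρ * τ := by
    intro τ a ρ hρ
    have := (Finset.mem_filter.1 hρ).2
    rw [← this]; group
  have hempty : ∀ a ∈ A, Z τ0 a = ∅ := by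
    intro a ha
    rw [Finset.eq_empty_iff_forall_notMem]
    intro ρ hρ
    have h1 := hsw _ _ _ hρ
    obtain ⟨-, -, h4, h5, h6⟩ := hT a ha
    obtain ⟨ha1, ha2⟩ := Finset.mem_filter.1 ha
    obtain ⟨b, _, rfl⟩ := Finset.mem_image.1 ha1
    obtain ⟨i, hi⟩ := hcon b (by
      rintro rfl
      apply ha2
      simp [B])
    have hd : 0 < d i := by have := (hS.crv i).two_le; omega
    have h7 := minpoly_cycle (K := K) (d i) hd (fun j => cc k (T (algebraMap K k b) ⟨i, ρ i j⟩))
      (fun j l hjl => (ρ i).injective (h5 i hjl)) (by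
        intro j
        rw [h6]
        have h8 := congrArg (fun g => g j) (congrFun h1 i)
        simp only [Pi.mul_apply, Equiv.Perm.mul_apply] at h8
        change cc k (T _ ⟨i, π _ i (ρ i j)⟩) = _
        rw [h8]) (hInt _)
    exact absurd h7 (not_le.2 (hi _ (h4 ⟨i, _⟩)))
  have hnm : n ≤ m.factorial := by
    have h1 : n = ∏ i, (d i).factorial := by
      rw [hn, Fintype.card_pi]
      simp [Fintype.card_perm]
    rw [h1]
    refine (Nat.le_of_dvd (Nat.factorial_pos _) (Nat.prod_factorial_dvd_factorial_sum Finset.univ d)).trans ?_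
    exact Nat.factorial_le hm
  have hqn : parQ m n < q := lt_of_le_of_lt
    (Finset.single_le_sum (f := parQ m) (fun _ _ => Nat.zero_le _) (Finset.mem_range.2 (by omega))) hq
  obtain ⟨n', hn'⟩ : ∃ n', n = n' + 1 := ⟨n - 1, by omega⟩
  have hMv : parM n = n' * n' + 2 := by simp [parM, hn']
  have hn'' : n' ≤ n' * n' := Nat.le_mul_self n'
  have hG : (parM n + 2 - n) + n = parM n + 2 := by omega
  have hGp : 0 < parM n + 2 - n := by omega
  have hJ : parJ n + 1 = n * (parM n + 2 - n) := by
    have := Nat.mul_pos hn0 hGp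
    rw [parJ]; omega
  set H := (q - 1) / n with hH
  have hq0 : 0 < q := by omega
  have hH1 : n * H < q := by
    have := Nat.mul_div_le (q - 1) n
    rw [← hH] at this
    omega
  have hH2 : q ≤ n * H + n := by
    have := Nat.lt_mul_div_succ (q - 1) hn0
    rw [← hH, mul_add, mul_one] at this
    omega
  unfold parQ at hqn
  have hcount := par_count n (parM n + 2 - n) (parM n) (parJ n) (crD m (parJ n) * parJ n) H hG hJ
    (by
      by_contra hlt
      push Not at hlt
      have : n * H ≤ n * n := Nat.mul_le_mul_left _ (by omega)
      omega) (by omega)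
  have hst : ∀ τ, parJ n * ∑ a ∈ A, (Z τ a).card ≤ n * (H + q * parM n) := by
    intro τ
    have := stepanov (p := p) (e := e) geo hm hm0 (fun i => (hS.crv i).deg) τ A T (fun a ha => (hT a ha).1)
      (by
        intro a ha
        obtain ⟨ha1, _⟩ := Finset.mem_filter.1 ha
        obtain ⟨b, _, rfl⟩ := Finset.mem_image.1 ha1
        rw [← hpe, ← map_pow, FiniteField.pow_card]) (fun a ha => (hT a ha).2.1) (Z τ)
      (by
        intro a ha ρ hρ s
        rw [← hpe, (hT a ha).2.2.2.2]
        have h1 := hsw _ _ _ hρ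
        have h2 : sgm (π a) (sgm ρ s) = sgm (π a * ρ) s := rfl
        rw [h2, h1]; rfl) n hn (parJ n) H (parM n) (by rw [← hpe]; exact hH1) (by rw [← hpe]; omega) hcount
    rwa [← hpe] at this
  have hfin := par_final n' (parM n + 2 - n) (parM n) (parJ n) H q (m * m + 1) A.card hMv (by omega)
    (by rw [← hn']; exact hJ) (by rw [← hn']; exact hH1) hAc (by rw [← hn']; omega)
  have htot : n * (parJ n * A.card) ≤ n * (n' * (H + q * parM n)) := by
    calc n * (parJ n * A.card) = parJ n * ∑ a ∈ A, ∑ τ, (Z τ a).card := by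
          simp only [hsum, Finset.sum_const, smul_eq_mul]; ring
      _ = ∑ τ, parJ n * ∑ a ∈ A, (Z τ a).card := by rw [Finset.sum_comm, Finset.mul_sum]
      _ = ∑ τ ∈ Finset.univ.erase τ0, parJ n * ∑ a ∈ A, (Z τ a).card := by
          rw [← Finset.add_sum_erase _ _ (Finset.mem_univ τ0), Finset.sum_eq_zero (s := A), mul_zero, zero_add]
          intro a ha
          rw [hempty a ha, Finset.card_empty]
      _ ≤ (Finset.univ.erase τ0).card • (n * (H + q * parM n)) := Finset.sum_le_card_nsmul _ _ _ fun τ _ => hst τ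
      _ = n' * (n * (H + q * parM n)) := by
          rw [Finset.card_erase_of_mem (Finset.mem_univ _), Finset.card_univ, ← hn, smul_eq_mul]
          congr 1; omega
      _ = _ := by ring
  exact absurd (Nat.le_of_mul_le_mul_left htot hn0) (not_le.2 hfin)

end Count

section Proj

variable {k : Type*} [Field k] {d : ℕ}

/-- the projective change of coordinates `F(X, T, 1 + a₁ T + a₂ X)` -/
noncomputable def prj (a1 a2 : k) : MvPolynomial (Fin 3) k →ₐ[k] MvPolynomial (Fin 2) k :=
  aeval ![X 1, X 0, 1 + C a1 * X 0 + C a2 * X 1]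

/-- its top form -/
noncomputable def prt (a1 a2 : k) : MvPolynomial (Fin 3) k →ₐ[k] MvPolynomial (Fin 2) k :=
  aeval ![X 1, X 0, C a1 * X 0 + C a2 * X 1]

lemma eval_prj (a1 a2 : k) (P : Fin 2 → k) (F : MvPolynomial (Fin 3) k) :
    eval P (prj a1 a2 F) = eval ![P 1, P 0, 1 + a1 * P 0 + a2 * P 1] F := by
  have : (aeval P).comp (prj a1 a2) =
      (aeval ![P 1, P 0, 1 + a1 * P 0 + a2 * P 1] : MvPolynomial (Fin 3) k →ₐ[k] k) := by
    apply MvPolynomial.algHom_ext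
    intro i
    fin_cases i <;> simp [prj]
  exact congrArg (fun g => g F) this

lemma eval_prt (a1 a2 : k) (P : Fin 2 → k) (F : MvPolynomial (Fin 3) k) :
    eval P (prt a1 a2 F) = eval ![P 1, P 0, a1 * P 0 + a2 * P 1] F := by
  have : (aeval P).comp (prt a1 a2) =
      (aeval ![P 1, P 0, a1 * P 0 + a2 * P 1] : MvPolynomial (Fin 3) k →ₐ[k] k) := by
    apply MvPolynomial.algHom_ext
    intro i
    fin_cases i <;> simp [prt]
  exact congrArg (fun g => g F) this

lemma map_prj {K : Type*} [Field K] (g : K →+* k) (a1 a2 : K) (F : MvPolynomial (Fin 3) K) :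
    map g (prj a1 a2 F) = prj (g a1) (g a2) (map g F) := by
  have : (map g).comp (prj a1 a2 : MvPolynomial (Fin 3) K →+* MvPolynomial (Fin 2) K) =
      ((prj (g a1) (g a2)) : MvPolynomial (Fin 3) k →+* MvPolynomial (Fin 2) k).comp (map g) := by
    apply MvPolynomial.ringHom_ext
    · intro r; simp [prj, algebraMap_eq]
    · intro i
      fin_cases i <;> simp [prj]
  exact congrArg (fun h => h F) this

lemma pderiv0_prj (a1 a2 : k) (F : MvPolynomial (Fin 3) k) :
    pderiv 0 (prj a1 a2 F) = prj a1 a2 (pderiv 1 F) + C a1 * prj a1 a2 (pderiv 2 F) := by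
  rw [prj, deriv_aeval, Fin.sum_univ_three]
  simp [pderiv_X, mul_comm]

lemma pderiv1_prj (a1 a2 : k) (F : MvPolynomial (Fin 3) k) :
    pderiv 1 (prj a1 a2 F) = prj a1 a2 (pderiv 0 F) + C a2 * prj a1 a2 (pderiv 2 F) := by
  rw [prj, deriv_aeval, Fin.sum_univ_three]
  simp [pderiv_X, mul_comm]

lemma pderiv0_prt (a1 a2 : k) (F : MvPolynomial (Fin 3) k) :
    pderiv 0 (prt a1 a2 F) = prt a1 a2 (pderiv 1 F) + C a1 * prt a1 a2 (pderiv 2 F) := by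
  rw [prt, deriv_aeval, Fin.sum_univ_three]
  simp [pderiv_X, mul_comm]

/-- dehomogenization: degree and top form -/
lemma dh_deg_hc {G : MvPolynomial (Fin 3) k} (hG : G.IsHomogeneous d) :
    (aeval ![1, X 0, X 1] G : MvPolynomial (Fin 2) k).totalDegree ≤ d ∧
    homogeneousComponent d (aeval ![1, X 0, X 1] G : MvPolynomial (Fin 2) k) =
      aeval ![0, X 0, X 1] G := by
  have key : ∀ s ∈ G.support,
      ((C (coeff s G) * (X 0 ^ s 1 * X 1 ^ s 2) : MvPolynomial (Fin 2) k).IsHomogeneous (s 1 + s 2)) ∧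
      s 0 + s 1 + s 2 = d := by
    intro s hs
    constructor
    · have := (isHomogeneous_C (Fin 2) (coeff s G)).mul
        ((isHomogeneous_X_pow (R := k) (0 : Fin 2) (s 1)).mul (isHomogeneous_X_pow (R := k) (1 : Fin 2) (s 2)))
      simpa using this
    · have h1 := hG (mem_support_iff.1 hs)
      rw [Finsupp.weight_apply, Finsupp.sum_fintype _ _ (by simp), Fin.sum_univ_three] at h1
      simpa using h1
  have e1 : (aeval ![1, X 0, X 1] G : MvPolynomial (Fin 2) k) =
      ∑ s ∈ G.support, C (coeff s G) * (X 0 ^ s 1 * X 1 ^ s 2) := by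
    rw [aeval_def, eval₂_eq']
    refine Finset.sum_congr rfl fun s _ => ?_
    rw [Fin.prod_univ_three]; simp [algebraMap_eq]
  have e2 : (aeval ![0, X 0, X 1] G : MvPolynomial (Fin 2) k) =
      ∑ s ∈ G.support, C (coeff s G) * ((0 : MvPolynomial (Fin 2) k) ^ s 0 * X 0 ^ s 1 * X 1 ^ s 2) := by
    rw [aeval_def, eval₂_eq']
    refine Finset.sum_congr rfl fun s _ => ?_
    rw [Fin.prod_univ_three]; simp [algebraMap_eq]
  constructor
  · rw [e1]
    refine totalDegree_finsetSum_le fun s hs => ?_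
    refine (key s hs).1.totalDegree_le.trans ?_
    have := (key s hs).2
    omega
  · rw [e1, e2, map_sum]
    refine Finset.sum_congr rfl fun s hs => ?_
    rw [homogeneousComponent_of_mem (key s hs).1]
    have := (key s hs).2
    split_ifs with h
    · have h0 : s 0 = 0 := by omega
      simp [h0]
    · have h0 : s 0 ≠ 0 := by omega
      simp [h0]

lemma prj_deg_hc (a1 a2 : k) {F : MvPolynomial (Fin 3) k} (hF : F.IsHomogeneous d) :
    (prj a1 a2 F).totalDegree ≤ d ∧ homogeneousComponent d (prj a1 a2 F) = prt a1 a2 F := by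
  have hG := hF.aeval (![X 2, X 1, X 0 + C a1 * X 1 + C a2 * X 2] :
      Fin 3 → MvPolynomial (Fin 3) k) (n := 1) (by
    intro i
    fin_cases i
    · exact isHomogeneous_X _ _
    · exact isHomogeneous_X _ _
    · exact ((isHomogeneous_X _ _).add (isHomogeneous_C_mul_X _ _)).add (isHomogeneous_C_mul_X _ _))
  rw [one_mul] at hG
  have e1 : ((aeval ![1, X 0, X 1] : MvPolynomial (Fin 3) k →ₐ[k] MvPolynomial (Fin 2) k)).comp
      (aeval ![X 2, X 1, X 0 + C a1 * X 1 + C a2 * X 2]) = prj a1 a2 := by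
    apply MvPolynomial.algHom_ext
    intro i
    fin_cases i <;> simp [prj, algebraMap_eq]
  have e2 : ((aeval ![0, X 0, X 1] : MvPolynomial (Fin 3) k →ₐ[k] MvPolynomial (Fin 2) k)).comp
      (aeval ![X 2, X 1, X 0 + C a1 * X 1 + C a2 * X 2]) = prt a1 a2 := by
    apply MvPolynomial.algHom_ext
    intro i
    fin_cases i <;> simp [prt, algebraMap_eq]
  have := dh_deg_hc hG
  have h1 := congrArg (fun g => g F) e1
  have h2 := congrArg (fun g => g F) e2
  simp only [AlgHom.comp_apply] at h1 h2
  rw [h1, h2] at this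
  exact this

lemma eval_homog3 {G : MvPolynomial (Fin 3) k} {n : ℕ} (hG : G.IsHomogeneous n) (c x y z : k) :
    eval ![c * x, c * y, c * z] G = c ^ n * eval ![x, y, z] G := by
  have h := aeval_homog hG c (![x, y, z] : Fin 3 → k)
  have e : (fun i => c * (![x, y, z] : Fin 3 → k) i) = ![c * x, c * y, c * z] := by
    ext i; fin_cases i <;> rfl
  rw [e] at h
  exact h

lemma prj_crv (hd : 2 ≤ d) {a1 a2 : k} {F : MvPolynomial (Fin 3) k} (hF : F.IsHomogeneous d)
    (hs : ∀ x : Fin 3 → k, x ≠ 0 → eval x F = 0 → ∃ j, eval x (pderiv j F) ≠ 0)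
    (hc : eval ![0, 1, a1] F ≠ 0)
    (h2 : ∀ θ : k, eval ![1, θ, a1 * θ + a2] F = 0 →
      eval ![1, θ, a1 * θ + a2] (pderiv 1 F) + a1 * eval ![1, θ, a1 * θ + a2] (pderiv 2 F) ≠ 0) :
    Crv d (C (eval ![0, 1, a1] F)⁻¹ * prj a1 a2 F) := by
  have hci := inv_ne_zero hc
  obtain ⟨hdeg, hhc⟩ := prj_deg_hc a1 a2 hF
  refine ⟨hd, ?_, ?_, ?_, ?_⟩
  · refine (totalDegree_mul _ _).trans ?_
    rw [totalDegree_C, zero_add]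
    exact hdeg
  · have h1 : coeff (Finsupp.single 0 d) (prj a1 a2 F) =
        coeff (Finsupp.single 0 d) (homogeneousComponent d (prj a1 a2 F)) := by
      rw [coeff_homogeneousComponent]; simp
    rw [coeff_C_mul, h1, ← eval_one_zero (homogeneousComponent_isHomogeneous _ _), hhc, eval_prt]
    simp [hc]
  · intro P hP
    rw [map_mul, eval_C, eval_prj] at hP
    have hP := (mul_eq_zero.1 hP).resolve_left hci
    rw [pderiv_C_mul, pderiv_C_mul, pderiv0_prj, pderiv1_prj]
    simp only [map_mul, eval_C, map_add, eval_prj, ne_eq, mul_eq_zero, hci, false_or]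
    by_contra hcon
    push Not at hcon
    obtain ⟨hc1, hc2⟩ := hcon
    have hE := congrArg (eval ![P 1, P 0, 1 + a1 * P 0 + a2 * P 1]) hF.sum_X_mul_pderiv
    rw [Fin.sum_univ_three] at hE
    simp [hP] at hE
    set v := ![P 1, P 0, 1 + a1 * P 0 + a2 * P 1] with hv
    have hF2 : eval v (pderiv 2 F) = 0 := by linear_combination hE - P 0 * hc1 - P 1 * hc2
    have hv0 : v ≠ 0 := by
      intro h0
      have g0 := congrFun h0 0
      have g1 := congrFun h0 1
      have g2 := congrFun h0 2
      simp [hv] at g0 g1 g2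
      simp [g0, g1] at g2
    obtain ⟨j, hj⟩ := hs v hv0 hP
    rw [hF2, mul_zero, add_zero] at hc1 hc2
    fin_cases j
    · exact hj hc2
    · exact hj hc1
    · exact hj hF2
  · intro P hP0 hP
    rw [homogeneousComponent_C_mul, hhc] at hP ⊢
    rw [map_mul, eval_C, eval_prt] at hP
    have hP := (mul_eq_zero.1 hP).resolve_left hci
    rw [pderiv_C_mul, pderiv0_prt]
    left
    simp only [map_mul, eval_C, map_add, eval_prt, ne_eq, mul_eq_zero, hci, false_or]
    by_cases hx : P 1 = 0
    · exfalso
      have ht : P 0 ≠ 0 := by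
        intro h0
        apply hP0
        ext i; fin_cases i <;> simpa
      have := eval_homog3 hF (P 0) 0 1 a1
      rw [hx] at hP
      simp only [mul_zero, mul_one, add_zero] at this hP
      rw [mul_comm a1, this] at hP
      exact mul_ne_zero (pow_ne_zero _ ht) hc hP
    · have e : ![P 1, P 0, a1 * P 0 + a2 * P 1] =
          ![P 1 * 1, P 1 * (P 0 / P 1), P 1 * (a1 * (P 0 / P 1) + a2)] := by
        congr 1
        · rw [mul_one]
        · have : P 0 = P 1 * (P 0 / P 1) := by field_simp
          have h2 : a1 * P 0 + a2 * P 1 = P 1 * (a1 * (P 0 / P 1) + a2) := by field_simp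
          rw [← this, ← h2]
      rw [e, eval_homog3 hF] at hP
      have hP := (mul_eq_zero.1 hP).resolve_left (pow_ne_zero _ hx)
      rw [e, eval_homog3 hF.pderiv, eval_homog3 hF.pderiv]
      have := h2 _ hP
      intro h0
      apply this
      have hne := pow_ne_zero (d-1) hx
      apply mul_left_cancel₀ hne
      rw [mul_zero]
      linear_combination h0

end Proj

section Choice

variable {k : Type*} [Field k] {d : ℕ} {f : MvPolynomial (Fin 2) k}

/-- `k[T,X]` is `k[X][T]` -/
noncomputable def slcEquiv (k : Type*) [Field k] :
    MvPolynomial (Fin 2) k ≃+* Polynomial (Polynomial k) :=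
  RingEquiv.ofRingHom
    ((aeval ![Polynomial.X, Polynomial.C Polynomial.X] :
      MvPolynomial (Fin 2) k →ₐ[k] Polynomial (Polynomial k)) : MvPolynomial (Fin 2) k →+* Polynomial (Polynomial k))
    (Polynomial.eval₂RingHom ((Polynomial.aeval (X 1) : Polynomial k →ₐ[k] MvPolynomial (Fin 2) k) :
      Polynomial k →+* MvPolynomial (Fin 2) k) (X 0))
    (by
      apply Polynomial.ringHom_ext'
      · apply Polynomial.ringHom_ext'
        · ext a; simp [algebraMap_eq, Polynomial.algebraMap_apply]
        · simp
      · simp)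
    (by
      apply MvPolynomial.ringHom_ext
      · intro a
        simp [algebraMap_eq, Polynomial.algebraMap_apply]
      · intro i
        fin_cases i <;> simp)

lemma slcEquiv_apply (f : MvPolynomial (Fin 2) k) :
    slcEquiv k f = slc f (Polynomial.X : Polynomial k) := rfl

lemma slc_X_inj {f g : MvPolynomial (Fin 2) k}
    (h : slc f (Polynomial.X : Polynomial k) = slc g (Polynomial.X : Polynomial k)) : f = g :=
  (slcEquiv k).injective h

/-- the shear is an automorphism -/
noncomputable def shEquiv (α : k) : MvPolynomial (Fin 2) k ≃ₐ[k] MvPolynomial (Fin 2) k :=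
  AlgEquiv.ofAlgHom (sh α) (sh (-α))
    (by
      apply MvPolynomial.algHom_ext
      intro i
      fin_cases i <;> simp [sh, algebraMap_eq])
    (by
      apply MvPolynomial.algHom_ext
      intro i
      fin_cases i <;> simp [sh, algebraMap_eq])

lemma shn_irr {α : k} (hf : Irreducible f) (hα : eval ![1, α] (homogeneousComponent d f) ≠ 0) :
    Irreducible (slc (shn d α f) (Polynomial.X : Polynomial k)) := by
  rw [← slcEquiv_apply, MulEquiv.irreducible_iff, shn, irreducible_isUnit_mul]
  · exact (MulEquiv.irreducible_iff (shEquiv α)).2 hf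
  · exact (inv_ne_zero hα).isUnit.map C

lemma top_ne_zero (hf : f ≠ 0) : homogeneousComponent f.totalDegree f ≠ 0 := by
  obtain ⟨s, hs, h⟩ := Finset.exists_mem_eq_sup f.support (support_nonempty.2 hf) (fun s => s.sum fun _ e => e)
  intro h0
  have := congrArg (coeff s) h0
  rw [coeff_homogeneousComponent, if_pos, coeff_zero] at this
  · exact mem_support_iff.1 hs this
  · rw [totalDegree, h]
    rfl

lemma top_poly [Infinite k] (hf : f ≠ 0) (hd : d = f.totalDegree) : ∃ u : Polynomial k, u ≠ 0 ∧ u.natDegree ≤ d ∧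
    ∀ a, u.eval a = eval ![1, a] (homogeneousComponent d f) := by
  have hev : ∀ a, (aeval ![1, Polynomial.X] (homogeneousComponent d f) : Polynomial k).eval a =
      eval ![1, a] (homogeneousComponent d f) := by
    intro a
    have : (Polynomial.aeval a).comp (aeval ![1, Polynomial.X] :
        MvPolynomial (Fin 2) k →ₐ[k] Polynomial k) = aeval ![1, a] := by
      apply MvPolynomial.algHom_ext
      intro i
      fin_cases i <;> simp
    exact congrArg (fun g => g (homogeneousComponent d f)) this
  have hh := homogeneousComponent_isHomogeneous d f
  refine ⟨aeval ![1, Polynomial.X] (homogeneousComponent d f), ?_, ?_, hev⟩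
  · intro h0
    apply top_ne_zero hf
    rw [← hd]
    have hz : (X 0 : MvPolynomial (Fin 2) k) * homogeneousComponent d f = 0 := by
      apply MvPolynomial.funext
      intro P
      rw [map_mul, eval_X, map_zero]
      by_cases hP : P 0 = 0
      · rw [hP, zero_mul]
      · have h1 := aeval_homog hh (P 0) (![1, P 1 / P 0] : Fin 2 → k)
        have e : (fun i => P 0 * (![1, P 1 / P 0] : Fin 2 → k) i) = P := by
          ext i; fin_cases i
          · simp
          · simp; field_simp
        rw [e] at h1
        have h2 := hev (P 1 / P 0)
        rw [h0, Polynomial.eval_zero] at h2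
        have h3 : eval P (homogeneousComponent d f) = P 0 ^ d * eval ![1, P 1 / P 0] (homogeneousComponent d f) := h1
        rw [h3, ← h2]; simp
    exact (mul_eq_zero.1 hz).resolve_left (X_ne_zero 0)
  · have := MvPolynomial.aeval_natDegree_le (homogeneousComponent d f) (m := d) (n := 1) hh.totalDegree_le
      (![1, Polynomial.X] : Fin 2 → Polynomial k) (by intro i; fin_cases i <;> simp)
    simpa using this

lemma tan_poly [IsAlgClosed k] (hd : 2 ≤ d) (hdeg : f.totalDegree ≤ d) (hf : Irreducible f) (hdk : (d : k) ≠ 0) {α : k}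
    (hα : eval ![1, α] (homogeneousComponent d f) ≠ 0) :
    ∃ u : Polynomial k, u ≠ 0 ∧ u.natDegree ≤ d * d ∧ ∀ a, u.eval a ≠ 0 →
      ∀ θ, eval ![θ, α * θ + a] f = 0 →
        eval ![θ, α * θ + a] (pderiv 0 f) + α * eval ![θ, α * θ + a] (pderiv 1 f) ≠ 0 := by
  have hirr := shn_irr hf hα
  have hc := inv_ne_zero hα
  have hd0 : 0 < d := by omega
  set h := shn d α f with hh
  have hdegh : h.totalDegree ≤ d := by
    refine (totalDegree_mul _ _).trans ?_
    rw [totalDegree_C, zero_add]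
    exact sh_deg α hdeg
  have hmon : coeff (Finsupp.single 0 d) h = 1 := by
    rw [hh, shn, coeff_C_mul, coeff_sh_top, inv_mul_cancel₀ hα]
  have hdd : (pderiv 0 h).totalDegree ≤ d - 1 := totalDegree_pderiv_le 0 h d hdegh
  refine ⟨nrm h (pderiv 0 h) d (d-1), ?_, ?_, ?_⟩
  · set S := slc h (Polynomial.X : Polynomial k) with hS
    have hSm : S.Monic := slc_monic h d hd0 hdegh hmon _
    have hSn : S.natDegree = d := slc_natDegree h d hd0 hdegh hmon _
    have hirr' : Irreducible (S.map (algebraMap (Polynomial k) (RatFunc k))) :=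
      (hSm.irreducible_iff_irreducible_map_fraction_map).1 hirr
    have hsep : (S.map (algebraMap (Polynomial k) (RatFunc k))).Separable := by
      rw [Polynomial.separable_iff_derivative_ne_zero hirr', Polynomial.derivative_map]
      intro h0
      rw [Polynomial.map_eq_zero_iff (RatFunc.algebraMap_injective k)] at h0
      have := congrArg (fun P => P.coeff (d-1)) h0
      simp only [Polynomial.coeff_derivative, Polynomial.coeff_zero] at this
      rw [show d - 1 + 1 = S.natDegree by omega, hSm.coeff_natDegree, one_mul] at this
      have h1 : ((d : ℕ) : Polynomial k) = 0 := by
        rw [← this, ← Nat.cast_succ]; congr 1; omega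
      rw [← Polynomial.C_eq_natCast, Polynomial.C_eq_zero] at h1
      exact hdk h1
    let Ω := AlgebraicClosure (RatFunc k)
    let x : Ω := algebraMap (RatFunc k) Ω RatFunc.X
    obtain ⟨t, ht⟩ := exists_split hd0 hdegh hmon x
    intro h0
    have hns := nrm_spec (pderiv 0 h) hdd ht
    rw [h0, map_zero] at hns
    obtain ⟨j, -, hj⟩ := Finset.prod_eq_zero_iff.1 hns.symm
    have hsep2 := hsep.map (f := algebraMap (RatFunc k) Ω)
    have e : (S.map (algebraMap (Polynomial k) (RatFunc k))).map (algebraMap (RatFunc k) Ω) = slc h x := by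
      have e1 := map_slc ((IsScalarTower.toAlgHom k (RatFunc k) Ω).comp
        (IsScalarTower.toAlgHom k (Polynomial k) (RatFunc k))) h (Polynomial.X : Polynomial k)
      rw [Polynomial.map_map]
      have e2 : ((IsScalarTower.toAlgHom k (RatFunc k) Ω).comp
        (IsScalarTower.toAlgHom k (Polynomial k) (RatFunc k))) (Polynomial.X : Polynomial k) = x := by
        simp [x, RatFunc.algebraMap_X]
      rw [e2] at e1
      exact e1
    rw [e] at hsep2
    have hr : (slc h x).eval (t j) = 0 := by
      rw [ht, Polynomial.eval_prod]
      exact Finset.prod_eq_zero (Finset.mem_univ j) (by simp)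
    apply hsep2.eval₂_derivative_ne_zero (RingHom.id _) (x := t j) (by simpa using hr)
    rw [derivative_slc]
    have := eval_slc (pderiv 0 h) x (t j)
    rw [hj] at this
    simpa using this
  · refine (nrm_natDegree_le hd0 hdegh hmon _ hdd).trans ?_
    exact Nat.mul_le_mul_left _ (by omega)
  · intro a ha θ hθ hcon
    obtain ⟨t, ht⟩ := exists_split hd0 hdegh hmon a
    rw [eval_nrm (pderiv 0 h) hdd ht] at ha
    apply ha
    have hr : (slc h a).eval θ = 0 := by
      rw [eval_slc, aeval_eq_eval, hh, shn, map_mul, eval_sh]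
      simp [hθ]
    rw [ht, Polynomial.eval_prod] at hr
    obtain ⟨j, -, hj⟩ := Finset.prod_eq_zero_iff.1 hr
    have hj : θ = t j := by simpa [sub_eq_zero] using hj
    refine Finset.prod_eq_zero (Finset.mem_univ j) ?_
    rw [← hj, hh, shn, pderiv_C_mul, pderiv0_sh, map_mul, eval_sh]
    simp [hcon]

end Choice

section Transfer

variable {k : Type*} [Field k] {d : ℕ}

lemma dh_eval (s y : k) (F : MvPolynomial (Fin 3) k) :
    eval ![s, y] (aeval ![1, X 0, X 1] F : MvPolynomial (Fin 2) k) = eval ![1, s, y] F := by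
  have : (aeval ![s, y]).comp (aeval ![1, X 0, X 1] : MvPolynomial (Fin 3) k →ₐ[k] MvPolynomial (Fin 2) k) =
      (aeval ![1, s, y] : MvPolynomial (Fin 3) k →ₐ[k] k) := by
    apply MvPolynomial.algHom_ext
    intro i
    fin_cases i <;> simp
  exact congrArg (fun g => g F) this

lemma dh0_eval (s y : k) (F : MvPolynomial (Fin 3) k) :
    eval ![s, y] (aeval ![0, X 0, X 1] F : MvPolynomial (Fin 2) k) = eval ![0, s, y] F := by
  have : (aeval ![s, y]).comp (aeval ![0, X 0, X 1] : MvPolynomial (Fin 3) k →ₐ[k] MvPolynomial (Fin 2) k) =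
      (aeval ![0, s, y] : MvPolynomial (Fin 3) k →ₐ[k] k) := by
    apply MvPolynomial.algHom_ext
    intro i
    fin_cases i <;> simp
  exact congrArg (fun g => g F) this

lemma map_dh {K : Type*} [Field K] (g : K →+* k) (F : MvPolynomial (Fin 3) K) :
    map g (aeval ![1, X 0, X 1] F : MvPolynomial (Fin 2) K) = aeval ![1, X 0, X 1] (map g F) := by
  have : (map g).comp ((aeval ![1, X 0, X 1] : MvPolynomial (Fin 3) K →ₐ[K] MvPolynomial (Fin 2) K) :
        MvPolynomial (Fin 3) K →+* MvPolynomial (Fin 2) K) =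
      ((aeval ![1, X 0, X 1] : MvPolynomial (Fin 3) k →ₐ[k] MvPolynomial (Fin 2) k) :
        MvPolynomial (Fin 3) k →+* MvPolynomial (Fin 2) k).comp (map g) := by
    apply MvPolynomial.ringHom_ext
    · intro r; simp [algebraMap_eq]
    · intro i
      fin_cases i <;> simp
  exact congrArg (fun h => h F) this

lemma dh_pderiv0 (F : MvPolynomial (Fin 3) k) :
    pderiv 0 (aeval ![1, X 0, X 1] F : MvPolynomial (Fin 2) k) = aeval ![1, X 0, X 1] (pderiv 1 F) := by
  rw [deriv_aeval, Fin.sum_univ_three]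
  simp [pderiv_X]

lemma dh_pderiv1 (F : MvPolynomial (Fin 3) k) :
    pderiv 1 (aeval ![1, X 0, X 1] F : MvPolynomial (Fin 2) k) = aeval ![1, X 0, X 1] (pderiv 2 F) := by
  rw [deriv_aeval, Fin.sum_univ_three]
  simp [pderiv_X]

lemma prj_inj [Infinite k] {a1 a2 : k} {F : MvPolynomial (Fin 3) k} (hF : F.IsHomogeneous d)
    (h : prj a1 a2 F = 0) : F = 0 := by
  have hu : (X 2 - C a1 * X 1 - C a2 * X 0 : MvPolynomial (Fin 3) k) ≠ 0 := by
    intro h0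
    have := congrArg (eval ![0, 0, 1]) h0
    simp at this
  have hz : (X 2 - C a1 * X 1 - C a2 * X 0 : MvPolynomial (Fin 3) k) * F = 0 := by
    apply MvPolynomial.funext
    intro y
    rw [map_mul, map_zero]
    by_cases hy : y 2 - a1 * y 1 - a2 * y 0 = 0
    · have : eval y (X 2 - C a1 * X 1 - C a2 * X 0 : MvPolynomial (Fin 3) k) = 0 := by simpa using hy
      rw [this, zero_mul]
    · set u := y 2 - a1 * y 1 - a2 * y 0 with hu'
      have e : y = ![u * (y 0 / u), u * (y 1 / u), u * (1 + a1 * (y 1 / u) + a2 * (y 0 / u))] := by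
        ext i; fin_cases i
        · simp; field_simp
        · simp; field_simp
        · simp; field_simp; rw [hu']; ring
      have h1 := eval_homog3 hF u (y 0 / u) (y 1 / u) (1 + a1 * (y 1 / u) + a2 * (y 0 / u))
      rw [← e] at h1
      have h2 := eval_prj a1 a2 ![y 1 / u, y 0 / u] F
      rw [h, map_zero] at h2
      simp only [Matrix.cons_val_zero, Matrix.cons_val_one] at h2
      rw [h1, ← h2]; simp
  exact (mul_eq_zero.1 hz).resolve_left hu

lemma eval_shn_prj {a1 a2 α β c : k} (hβ : β ≠ 0) {F : MvPolynomial (Fin 3) k} (hF : F.IsHomogeneous d) (t : k)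
    (hY : α * t + β ≠ 0) : eval ![t, β] (shn d α (C c⁻¹ * prj a1 a2 F)) =
      (eval ![1, α] (homogeneousComponent d (C c⁻¹ * prj a1 a2 F)))⁻¹ * (c⁻¹ * ((α * t + β) ^ d *
        eval ![1, t / (α * t + β), (a1 - α / β) * (t / (α * t + β)) + (a2 + 1 / β)] F)) := by
  rw [shn, (eval ![t, β]).map_mul, eval_C, eval_sh, (eval _).map_mul, eval_C, eval_prj, ← eval_homog3 hF]
  congr 4
  have e : (α * t + β) * (t / (α * t + β)) = t := mul_div_cancel₀ t hY
  have eb : β * β⁻¹ = 1 := mul_inv_cancel₀ hβ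
  simp
  refine ⟨e.symm, ?_⟩
  rw [div_eq_mul_inv α β]
  linear_combination (-(a1 - α * β⁻¹)) * e - eb

lemma map_hc {K : Type*} [Field K] (g : K →+* k) (n : ℕ) (P : MvPolynomial (Fin 2) K) :
    map g (homogeneousComponent n P) = homogeneousComponent n (map g P) := by
  ext s
  rw [coeff_map, coeff_homogeneousComponent, coeff_homogeneousComponent, coeff_map]
  split_ifs <;> simp

lemma eval2_map {K : Type*} [Field K] (g : K →+* k) (s t : K) (P : MvPolynomial (Fin 2) K) :
    eval ![g s, g t] (map g P) = g (eval ![s, t] P) := by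
  have : (![g s, g t] : Fin 2 → k) = g ∘ ![s, t] := by
    ext i; fin_cases i <;> rfl
  rw [this, eval_map, eval₂_comp]

lemma eval3_map {K : Type*} [Field K] (g : K →+* k) (r s t : K) (P : MvPolynomial (Fin 3) K) :
    eval ![g r, g s, g t] (map g P) = g (eval ![r, s, t] P) := by
  have : (![g r, g s, g t] : Fin 3 → k) = g ∘ ![r, s, t] := by
    ext i; fin_cases i <;> rfl
  rw [this, eval_map, eval₂_comp]

lemma map_shn {K : Type*} [Field K] (g : K →+* k) (α : K) (P : MvPolynomial (Fin 2) K) :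
    map g (shn d α P) = shn d (g α) (map g P) := by
  have h1 : map g (sh α P) = sh (g α) (map g P) := by
    have : (map g).comp (sh α : MvPolynomial (Fin 2) K →+* MvPolynomial (Fin 2) K) =
        ((sh (g α)) : MvPolynomial (Fin 2) k →+* MvPolynomial (Fin 2) k).comp (map g) := by
      apply MvPolynomial.ringHom_ext
      · intro r; simp [sh, algebraMap_eq]
      · intro i
        fin_cases i <;> simp [sh]
    exact congrArg (fun h => h P) this
  rw [shn, shn, map_mul, map_C, h1, ← map_hc, ← map_one g, eval2_map, map_inv₀]

lemma minpoly_transfer {K : Type*} [Field K] [Algebra K k] {α β : K} (hβ : β ≠ 0) {θ : k} (hθ : IsIntegral K θ)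
    (h2 : 2 ≤ (minpoly K θ).natDegree) :
    algebraMap K k α * θ + algebraMap K k β ≠ 0 ∧
    (minpoly K θ).natDegree ≤
      (minpoly K (θ / (algebraMap K k α * θ + algebraMap K k β))).natDegree := by
  set Y := algebraMap K k α * θ + algebraMap K k β with hYd
  have hb : algebraMap K k β ≠ 0 := by simpa using hβ
  have hY : Y ≠ 0 := by
    intro h0
    have hα : algebraMap K k α ≠ 0 := by
      intro h1
      rw [hYd, h1, zero_mul, zero_add] at h0
      exact hb h0
    have : θ = algebraMap K k (-β / α) := by
      rw [map_div₀, map_neg]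
      field_simp
      linear_combination h0
    rw [this, minpoly.eq_X_sub_C] at h2
    simp at h2
  refine ⟨hY, ?_⟩
  set S := θ / Y with hS
  have hYint : IsIntegral K Y := (isIntegral_algebraMap.mul hθ).add isIntegral_algebraMap
  have hSint : IsIntegral K S := by
    rw [hS, div_eq_mul_inv]
    exact hθ.mul hYint.inv
  have h1 : 1 - algebraMap K k α * S = algebraMap K k β / Y := by
    rw [hS]; field_simp; rw [hYd]; ring
  have hθS : θ = S * algebraMap K k β / (1 - algebraMap K k α * S) := by
    rw [h1, hS]; field_simp
  have : FiniteDimensional K (IntermediateField.adjoin K {S}) := IntermediateField.adjoin.finiteDimensional hSint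
  have hmem : θ ∈ IntermediateField.adjoin K {S} := by
    have hm := IntermediateField.mem_adjoin_simple_self K S
    have ha : ∀ c : K, algebraMap K k c ∈ IntermediateField.adjoin K {S} := fun c =>
      IntermediateField.algebraMap_mem _ c
    rw [hθS]
    exact div_mem (mul_mem hm (ha _)) (sub_mem (one_mem _) (mul_mem (ha _) hm))
  have h3 := minpoly.natDegree_le (A := K) (⟨θ, hmem⟩ : IntermediateField.adjoin K {S})
  rw [IntermediateField.adjoin.finrank hSint] at h3
  have h4 : minpoly K (⟨θ, hmem⟩ : IntermediateField.adjoin K {S}) = minpoly K θ :=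
    (minpoly.algebraMap_eq (algebraMap (IntermediateField.adjoin K {S}) k).injective
      (⟨θ, hmem⟩ : IntermediateField.adjoin K {S})).symm
  rwa [h4] at h3

lemma irr_of_minpoly {K : Type*} [Field K] [Algebra K k] {u : Polynomial K} (hu : u ≠ 0) {S : k}
    (hS : Polynomial.aeval S u = 0) (hd : u.natDegree ≤ (minpoly K S).natDegree) (hInt : IsIntegral K S) :
    Irreducible u := by
  obtain ⟨w, hw⟩ := minpoly.dvd K S hS
  have hw0 : w ≠ 0 := by rintro rfl; rw [mul_zero] at hw; exact hu hw
  have hdeg := congrArg Polynomial.natDegree hw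
  rw [Polynomial.natDegree_mul (minpoly.ne_zero hInt) hw0] at hdeg
  have : w.natDegree = 0 := by omega
  have hunit : IsUnit w := by
    rw [Polynomial.isUnit_iff_degree_eq_zero, Polynomial.degree_eq_natDegree hw0, this]; rfl
  rw [hw, irreducible_mul_isUnit hunit]
  exact minpoly.irreducible hInt

lemma pick_notMem {K : Type*} [Field K] [Fintype K] [Algebra K k] (B : Finset k) (hB : B.card < Fintype.card K) :
    ∃ a : K, algebraMap K k a ∉ B := by
  classical
  by_contra hcon
  push Not at hcon
  have := Finset.card_le_card_of_injOn (s := (Finset.univ : Finset K)) (t := B) (algebraMap K k)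
    (fun a _ => hcon a) ((algebraMap K k).injective.injOn)
  rw [Finset.card_univ] at this
  omega

lemma pick_poly {K : Type*} [Field K] [Fintype K] [Algebra K k] {r N : ℕ} (u : Fin r → Polynomial k)
    (h0 : ∀ i, u i ≠ 0) (hN : ∑ i, (u i).natDegree ≤ N) (hK : N < Fintype.card K) :
    ∃ a : K, ∀ i, (u i).eval (algebraMap K k a) ≠ 0 := by
  classical
  obtain ⟨a, ha⟩ := pick_notMem (K := K) (∏ i, u i).roots.toFinset (by
    refine (Multiset.toFinset_card_le _).trans_lt ?_
    refine (Polynomial.card_roots' _).trans_lt ?_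
    rw [Polynomial.natDegree_prod _ _ (fun i _ => h0 i)]
    omega)
  refine ⟨a, fun i hi => ha ?_⟩
  rw [Multiset.mem_toFinset, Polynomial.mem_roots (Finset.prod_ne_zero_iff.2 fun i _ => h0 i),
    Polynomial.IsRoot, Polynomial.eval_prod]
  exact Finset.prod_eq_zero (Finset.mem_univ i) hi

end Transfer

section Final

lemma aeval_lineSub {K k : Type*} [Field K] [Field k] [Algebra K k] (f : MvPolynomial (Fin 2) K) (a b : K) (S : k) :
    Polynomial.aeval S (lineSub f a b) =
      eval ![S, algebraMap K k a * S + algebraMap K k b] (map (algebraMap K k) f) := by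
  have : (Polynomial.aeval S : Polynomial K →ₐ[K] k).comp
      (aeval ![Polynomial.X, Polynomial.C a * Polynomial.X + Polynomial.C b]) =
      (aeval ![S, algebraMap K k a * S + algebraMap K k b] : MvPolynomial (Fin 2) K →ₐ[K] k) := by
    apply MvPolynomial.algHom_ext
    intro i
    fin_cases i <;> simp
  have h := congrArg (fun g => g f) this
  rw [eval_map]
  exact h

lemma final_one {K k : Type*} [Field K] [Field k] [Algebra K k] [Infinite k] {d : ℕ}
    {a1 a2 α β c : K} (hβ : β ≠ 0) (hc : c ≠ 0) {F : MvPolynomial (Fin 3) K} {f : MvPolynomial (Fin 2) K}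
    (hF : F.IsHomogeneous d) (hf : aeval ![1, X 0, X 1] F = f)
    (hcrv : Crv d (map (algebraMap K k) (shn d α (C c⁻¹ * prj a1 a2 F))))
    (hα : eval ![1, algebraMap K k α] (homogeneousComponent d (map (algebraMap K k) (C c⁻¹ * prj a1 a2 F))) ≠ 0)
    {θ : k} (hInt : ∀ z : k, IsIntegral K z)
    (hθ : eval ![θ, algebraMap K k β] (map (algebraMap K k) (shn d α (C c⁻¹ * prj a1 a2 F))) = 0)
    (hdθ : d ≤ (minpoly K θ).natDegree) : Irreducible (lineSub f (a1 - α / β) (a2 + 1 / β)) := by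
  set g := algebraMap K k with hg
  have hd := hcrv.two_le
  have hgβ : g β ≠ 0 := by simpa using hβ
  have hgc : g c ≠ 0 := by simpa using hc
  have hFk : (map g F).IsHomogeneous d := hF.map g
  have e0 : map g (C c⁻¹ * prj a1 a2 F) = C (g c)⁻¹ * prj (g a1) (g a2) (map g F) := by
    rw [(map g).map_mul, map_C, map_prj, map_inv₀]
  have key : ∀ t : k, g α * t + g β ≠ 0 → eval ![t, g β] (map g (shn d α (C c⁻¹ * prj a1 a2 F))) =
      (eval ![1, g α] (homogeneousComponent d (map g (C c⁻¹ * prj a1 a2 F))))⁻¹ * ((g c)⁻¹ * ((g α * t + g β) ^ d *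
        Polynomial.aeval (t / (g α * t + g β)) (lineSub f (a1 - α / β) (a2 + 1 / β)))) := by
    intro t ht
    rw [map_shn, e0, eval_shn_prj hgβ hFk t ht, aeval_lineSub, ← hf, map_dh, dh_eval]
    simp [hg]
  obtain ⟨hY, hmp⟩ := minpoly_transfer (α := α) hβ (hInt θ) (by omega)
  have hroot : Polynomial.aeval (θ / (g α * θ + g β)) (lineSub f (a1 - α / β) (a2 + 1 / β)) = 0 := by
    rw [key θ hY] at hθ
    have h1 := (mul_eq_zero.1 hθ).resolve_left (inv_ne_zero hα)
    have h2 := (mul_eq_zero.1 h1).resolve_left (inv_ne_zero hgc)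
    exact (mul_eq_zero.1 h2).resolve_left (pow_ne_zero _ hY)
  refine irr_of_minpoly (k := k) ?_ hroot ?_ (hInt _)
  · intro h0
    set H := map g (shn d α (C c⁻¹ * prj a1 a2 F)) with hH
    have hmon := slc_monic H d (by omega) hcrv.deg hcrv.monic (g β)
    have hz : (Polynomial.C (g α) * Polynomial.X + Polynomial.C (g β)) * slc H (g β) = 0 := by
      apply Polynomial.funext
      intro t
      rw [Polynomial.eval_mul, Polynomial.eval_zero, eval_slc, aeval_eq_eval]
      by_cases ht : g α * t + g β = 0
      · simp [ht]
      · rw [key t ht, h0]; simp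
    rcases mul_eq_zero.1 hz with h | h
    · have := congrArg (fun P => P.eval 0) h
      simp at this
      exact hβ this
    · exact hmon.ne_zero h
  · refine le_trans ?_ (hdθ.trans hmp)
    refine lnp_natDegree_le (L := K) f d ?_ _ _
    rw [← hf]
    exact (dh_deg_hc hF).1

end Final

/-- for every `m > 0` there exists `Q = Q(m)` such that for every finite
field `K` with `q > Q` elements and characteristic `p`, and all pairwise non-associate
absolutely irreducible `f₁, …, f_r ∈ K[T,X]` with total degrees `d_i ≥ 2`,
`p ∤ d_i(d_i − 1)`, smooth homogenizations, and `∑ d_i ≤ m`, there is a pair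
`(a₁,a₂) ∈ K²` such that every `f_i(T, a₁T + a₂)` is irreducible in `K[T]`. -/
theorem exists_irreducible_line_substitution (m : ℕ) (hm : 0 < m) :
    ∃ Q : ℕ, ∀ (K : Type) (_ : Field K) (_ : Fintype K) (q p : ℕ),
      Fintype.card K = q → CharP K p → q > Q →
      ∀ (r : ℕ) (f : Fin r → MvPolynomial (Fin 2) K) (d : Fin r → ℕ),
      (∀ i, d i = (f i).totalDegree) →
      (∀ i, 2 ≤ d i) →
      (∀ i, ¬ (p ∣ d i * (d i - 1))) →
      (∀ i, AbsolutelyIrreducible (f i)) →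
      (∀ i j, i ≠ j → ∀ c : K, f i ≠ c • f j) →
      (∀ i, ∃ F : MvPolynomial (Fin 3) K, IsSmoothHomogenization F (f i) (d i)) →
      (∑ i, d i) ≤ m →
      ∃ a₁ a₂ : K, ∀ i, Irreducible (lineSub (f i) a₁ a₂) := by
  classical
  refine ⟨cntQ m + badBound m + m + m * m, ?_⟩
  intro K _ _ q p hcard hchar hq r f d hd h2 hp hirr hne hF hsum
  subst hcard
  have hpp : Fact p.Prime := ⟨CharP.char_is_prime K p⟩
  set k := AlgebraicClosure K with hk
  have hchark : CharP k p := charP_of_injective_algebraMap (algebraMap K k).injective p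
  have : Infinite k := IsAlgClosed.instInfinite
  set g := algebraMap K k with hg
  have ginj : Function.Injective g := g.injective
  have hInt : ∀ z : k, IsIntegral K z := fun z => (AlgebraicClosure.isAlgebraic K).isAlgebraic z |>.isIntegral
  choose F hFh hFf hFs using hF
  have hdm : ∀ i, d i ≤ m := fun i =>
    (Finset.single_le_sum (f := d) (fun _ _ => Nat.zero_le _) (Finset.mem_univ i)).trans hsum
  have hpk : ∀ i, ((d i * (d i - 1) : ℕ) : k) ≠ 0 := fun i h => hp i ((CharP.cast_eq_zero_iff k p _).1 h)
  have hdk : ∀ i, ((d i : ℕ) : k) ≠ 0 := by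
    intro i h
    apply hpk i
    rw [Nat.cast_mul, h, zero_mul]
  have hFk : ∀ i, (map g (F i)).IsHomogeneous (d i) := fun i => (hFh i).map g
  have hfk : ∀ i, map g (f i) = aeval ![1, X 0, X 1] (map g (F i)) := by
    intro i
    rw [← hFf i, map_dh]
  have hfirr : ∀ i, Irreducible (map g (f i)) := hirr
  have htd : ∀ i, d i = (map g (f i)).totalDegree := by
    intro i
    rw [hd i, totalDegree, totalDegree, support_map_of_injective _ ginj]
  have htop : ∀ i a, eval ![1, a] (homogeneousComponent (d i) (map g (f i))) = eval ![0, 1, a] (map g (F i)) := by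
    intro i a
    rw [hfk i, (dh_deg_hc (hFk i)).2, dh0_eval]
  -- the first coefficient
  choose u hu0 hud hue using fun i => top_poly (hfirr i).ne_zero (htd i)
  obtain ⟨a1, ha1⟩ := pick_poly (K := K) u hu0
    ((Finset.sum_le_sum fun i _ => hud i).trans hsum) (by omega)
  have ha1' : ∀ i, eval ![1, g a1] (homogeneousComponent (d i) (map g (f i))) ≠ 0 := fun i => by
    rw [← hue]; exact ha1 i
  -- the second coefficient
  choose w hw0 hwd hwe using fun i => tan_poly (h2 i) (htd i).ge (hfirr i) (hdk i) (ha1' i)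
  obtain ⟨a2, ha2⟩ := pick_poly (K := K) (N := m * m) w hw0
    (by
      refine (Finset.sum_le_sum fun i _ => hwd i).trans ?_
      refine (Finset.sum_le_sum fun i _ => Nat.mul_le_mul_left (d i) (hdm i)).trans ?_
      rw [← Finset.sum_mul]
      exact Nat.mul_le_mul_right m hsum) (by omega)
  have hcK : ∀ i, g (eval ![0, 1, a1] (F i)) = eval ![0, 1, g a1] (map g (F i)) := by
    intro i
    rw [← eval3_map, map_zero, map_one]
  have hcne : ∀ i, eval ![0, 1, g a1] (map g (F i)) ≠ 0 := fun i => by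
    rw [← htop]; exact ha1' i
  have hcne' : ∀ i, eval ![0, 1, a1] (F i) ≠ 0 := fun i h => by
    apply hcne i
    rw [← hcK, h, map_zero]
  set f2 : Fin r → MvPolynomial (Fin 2) K := fun i =>
    C (eval ![0, 1, a1] (F i))⁻¹ * prj a1 a2 (F i) with hf2
  have hmf2 : ∀ i, map g (f2 i) = C (eval ![0, 1, g a1] (map g (F i)))⁻¹ * prj (g a1) (g a2) (map g (F i)) := by
    intro i
    rw [hf2, (map g).map_mul, map_C, map_prj, map_inv₀, hcK]
  have hcrv : ∀ i, Crv (d i) (map g (f2 i)) := by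
    intro i
    rw [hmf2]
    refine prj_crv (h2 i) (hFk i) ?_ (hcne i) ?_
    · intro x hx h0
      obtain ⟨j, hj⟩ := hFs i x hx h0
      refine ⟨j, ?_⟩
      rw [pderiv_map]
      exact hj
    · intro θ hθ
      have := hwe i (g a2) (ha2 i) θ (by rw [hfk i, dh_eval]; exact hθ)
      rw [hfk i, dh_pderiv0, dh_pderiv1, dh_eval, dh_eval] at this
      exact this
  have hdist : ∀ i j, i ≠ j → ¬ slc (map g (f2 i)) (Polynomial.X : Polynomial k) ∣
      slc (map g (f2 j)) (Polynomial.X : Polynomial k) := by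
    intro i j hij hdvd
    have hmi := slc_monic _ _ (by have := h2 i; omega) (hcrv i).deg (hcrv i).monic (Polynomial.X : Polynomial k)
    have hmj := slc_monic _ _ (by have := h2 j; omega) (hcrv j).deg (hcrv j).monic (Polynomial.X : Polynomial k)
    have hni := slc_natDegree _ _ (by have := h2 i; omega) (hcrv i).deg (hcrv i).monic (Polynomial.X : Polynomial k)
    have hnj := slc_natDegree _ _ (by have := h2 j; omega) (hcrv j).deg (hcrv j).monic (Polynomial.X : Polynomial k)
    have hass : Associated (slc (map g (f2 i)) (Polynomial.X : Polynomial k))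
        (slc (map g (f2 j)) (Polynomial.X : Polynomial k)) :=
      (hcrv i).irr.associated_of_dvd (hcrv j).irr hdvd
    have heq := Polynomial.eq_of_monic_of_associated hmi hmj hass
    have hdd : d i = d j := by rw [← hni, ← hnj, heq]
    have h3 : f2 i = f2 j := map_injective g ginj (slc_X_inj heq)
    set ci := eval ![0, 1, a1] (F i) with hci
    set cj := eval ![0, 1, a1] (F j) with hcj
    have h4 : prj a1 a2 (F i - C (ci * cj⁻¹) * F j) = 0 := by
      have h5 : C ci⁻¹ * prj a1 a2 (F i) = C cj⁻¹ * prj a1 a2 (F j) := h3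
      have h6 : prj a1 a2 (F i) = C ci * (C ci⁻¹ * prj a1 a2 (F i)) := by
        rw [← mul_assoc, ← C_mul, mul_inv_cancel₀ (hcne' i), C_1, one_mul]
      have h7 : prj a1 a2 (C (ci * cj⁻¹)) = C (ci * cj⁻¹) := by
        rw [← algebraMap_eq, AlgHom.commutes]; rfl
      rw [map_sub, map_mul, h6, h5, h7, C_mul]
      ring
    have h5 : (F i - C (ci * cj⁻¹) * F j).IsHomogeneous (d i) := by
      refine (hFh i).sub ?_
      rw [hdd]
      simpa using (isHomogeneous_C (Fin 3) (ci * cj⁻¹)).mul (hFh j)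
    have h6 := congrArg (map g) h4
    rw [map_prj, map_zero] at h6
    have h7 := prj_inj (h5.map g) h6
    rw [map_eq_zero_iff _ (map_injective g ginj), sub_eq_zero] at h7
    apply hne i j hij (ci * cj⁻¹)
    rw [← hFf i, h7, map_mul, hFf j, smul_eq_C_mul]
    simp [algebraMap_eq]
  -- the slope
  obtain ⟨B, hB, hBα⟩ := good_slope (p := p) d (fun i => map g (f2 i)) hcrv hpk hdist hsum
  obtain ⟨α, hα⟩ := pick_notMem (K := K) B (by omega)
  obtain ⟨g1, g2, g3⟩ := hBα (g α) hα
  have hS := shn_smp hcrv g1 g2 g3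
  have hS' : Smp d (fun i => map g (shn (d i) α (f2 i))) := by
    have : (fun i => map g (shn (d i) α (f2 i))) = fun i => shn (d i) (g α) (map g (f2 i)) := by
      funext i
      rw [map_shn]
    rw [this]
    exact hS
  obtain ⟨β, hβ, hθ⟩ := count_main (p := p) hm (by omega) d (fun i => shn (d i) α (f2 i)) hS' hsum hInt
  refine ⟨a1 - α / β, a2 + 1 / β, fun i => ?_⟩
  obtain ⟨θ, hθ1, hθ2⟩ := hθ i
  exact final_one hβ (hcne' i) (hFh i) (hFf i) (hS'.crv i) (g1 i) hInt hθ1 hθ2
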